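/- Let K ⊆ ℝ² be a convex triangulated 2-disk (affine simplices) with m interior vertices. Then the space E_{∂K}(K) of simplexwise-linear homeomorphisms of K fixing ∂K pointwise, with the compact-open topology, is homeomorphic to ℝ^{2m}. -/

import Mathlib

/-! Basic notions for triangulated 2-disks with straight simplices in the plane. -/

/-- Vertex set of an ordered triangle. -/
def vset {ι : Type} [DecidableEq ι] (t : ι × ι × ι) : Finset ι := {t.1, t.2.1, t.2.2}

/-- The geometric (closed, filled) triangle spanned by an ordered triple of vertices. -/
def triSet {ι : Type} (pos : ι → ℝ × ℝ) (t : ι × ι × ι) : Set (ℝ × ℝ) :=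
  convexHull ℝ {pos t.1, pos t.2.1, pos t.2.2}

/-- A triangulated 2-disk with straight (affine) simplices in the plane: finitely many
nondegenerate affine triangles, any two of which intersect exactly in the convex hull of
their common vertices, whose union is homeomorphic to the closed 2-disk. -/
structure TriDisk (ι : Type) [Fintype ι] [DecidableEq ι] where
  pos : ι → ℝ × ℝ
  inj : Function.Injective pos
  tris : Finset (ι × ι × ι)
  nonempty : tris.Nonempty
  indep : ∀ t ∈ tris, AffineIndependent ℝ ![pos t.1, pos t.2.1, pos t.2.2]
  glue : ∀ s ∈ tris, ∀ t ∈ tris,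
    triSet pos s ∩ triSet pos t = convexHull ℝ (pos '' ((vset s ∩ vset t : Finset ι) : Set ι))
  disk : Nonempty ((⋃ t ∈ tris, triSet pos t) ≃ₜ
      (Metric.closedBall (0 : EuclideanSpace ℝ (Fin 2)) 1))

namespace TriDisk

variable {ι : Type} [Fintype ι] [DecidableEq ι]

/-- The underlying space of the triangulated disk. -/
def space (D : TriDisk ι) : Set (ℝ × ℝ) := ⋃ t ∈ D.tris, triSet D.pos t

/-- `a b` span an edge (1-simplex) of the triangulation. -/
def IsEdge (D : TriDisk ι) (a b : ι) : Prop :=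
  a ≠ b ∧ ∃ t ∈ D.tris, a ∈ vset t ∧ b ∈ vset t

/-- A spanning edge: both endpoints on the boundary circle, open edge in the interior. -/
def IsSpanningEdge (D : TriDisk ι) (a b : ι) : Prop :=
  D.IsEdge a b ∧ D.pos a ∈ frontier D.space ∧ D.pos b ∈ frontier D.space ∧
    openSegment ℝ (D.pos a) (D.pos b) ⊆ interior D.space

/-- `K` is simple if it has no spanning edge. -/
def Simple (D : TriDisk ι) : Prop := ∀ a b : ι, ¬ D.IsSpanningEdge a b

/-- Transverse to the verticals: every intersection with a vertical line is connected. -/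
def TrV (D : TriDisk ι) : Prop :=
  ∀ c : ℝ, IsPreconnected (D.space ∩ {p : ℝ × ℝ | p.1 = c})

/-- A boundary edge of the triangulation. -/
def IsBoundaryEdge (D : TriDisk ι) (a b : ι) : Prop :=
  D.IsEdge a b ∧ segment ℝ (D.pos a) (D.pos b) ⊆ frontier D.space

/-- A roof edge: a boundary edge no ascending vertical ray from which meets the interior. -/
def IsRoofEdge (D : TriDisk ι) (a b : ι) : Prop :=
  D.IsBoundaryEdge a b ∧
    ∀ p ∈ segment ℝ (D.pos a) (D.pos b), ∀ s : ℝ, 0 ≤ s →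
      (p.1, p.2 + s) ∉ interior D.space

/-- The roof of a TrV disk, as a subset of the boundary. -/
def roof (D : TriDisk ι) : Set (ℝ × ℝ) :=
  ⋃ (a : ι) (b : ι) (_ : D.IsRoofEdge a b), segment ℝ (D.pos a) (D.pos b)

/-- `F` is simplexwise linear on the boundary of `D`. -/
def SLOnBoundary (D : TriDisk ι) (F : ℝ × ℝ → ℝ × ℝ) : Prop :=
  ∀ a b : ι, D.IsBoundaryEdge a b →
    ∃ g : (ℝ × ℝ) →ᵃ[ℝ] (ℝ × ℝ), Set.EqOn F g (segment ℝ (D.pos a) (D.pos b))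

/-- `F` is simplexwise linear on the whole disk `D`. -/
def SLOn (D : TriDisk ι) (F : ℝ × ℝ → ℝ × ℝ) : Prop :=
  ∀ t ∈ D.tris, ∃ g : (ℝ × ℝ) →ᵃ[ℝ] (ℝ × ℝ), Set.EqOn F g (triSet D.pos t)

/-- `F` is vertical on `S`: it preserves first coordinates there. -/
def VerticalOn (F : ℝ × ℝ → ℝ × ℝ) (S : Set (ℝ × ℝ)) : Prop :=
  ∀ p ∈ S, (F p).1 = p.1

/-- The image of the boundary under `F` is a convex polygon, i.e. it is the boundary
of a compact convex set with nonempty interior. -/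
def ConvexImage (D : TriDisk ι) (F : ℝ × ℝ → ℝ × ℝ) : Prop :=
  ∃ C : Set (ℝ × ℝ), Convex ℝ C ∧ IsCompact C ∧ (interior C).Nonempty ∧
    F '' frontier D.space = frontier C

/-- A spanning edge `{a,b}` is `F`-obstructive: `F` maps (the closure of) one of the two
arcs of the boundary circle determined by its endpoints into a straight line. -/
def Obstructive (D : TriDisk ι) (F : ℝ × ℝ → ℝ × ℝ) (a b : ι) : Prop :=
  D.IsSpanningEdge a b ∧ ∃ x ∈ frontier D.space \ {D.pos a, D.pos b},
    Collinear ℝ (F '' closure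
      (connectedComponentIn (frontier D.space \ {D.pos a, D.pos b}) x))

end TriDisk

section
open Filter Topology

/-! ### Part 1 : plane geometry -/

/-- twice the signed area of a triangle -/
def d3 (a b c : ℝ × ℝ) : ℝ := (b.1-a.1)*(c.2-a.2)-(b.2-a.2)*(c.1-a.1)

/-- membership in a positively oriented triangle -/
def InT (a b c p : ℝ × ℝ) : Prop := 0 ≤ d3 a b p ∧ 0 ≤ d3 b c p ∧ 0 ≤ d3 c a p

/-- membership in the open triangle -/
def InO (a b c p : ℝ × ℝ) : Prop := 0 < d3 a b p ∧ 0 < d3 b c p ∧ 0 < d3 c a p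

lemma InO.inT {a b c p : ℝ × ℝ} (h : InO a b c p) : InT a b c p :=
  ⟨h.1.le, h.2.1.le, h.2.2.le⟩

lemma d3_rot (a b c : ℝ × ℝ) : d3 b c a = d3 a b c := by unfold d3; ring
lemma d3_swap (a b c : ℝ × ℝ) : d3 b a c = - d3 a b c := by unfold d3; ring
lemma d3_sum (a b c p : ℝ × ℝ) : d3 a b p + d3 b c p + d3 c a p = d3 a b c := by unfold d3; ring
lemma d3_self1 (a b : ℝ × ℝ) : d3 a b a = 0 := by unfold d3; ring
lemma d3_self2 (a b : ℝ × ℝ) : d3 a b b = 0 := by unfold d3; ring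
lemma d3_self0 (a b : ℝ × ℝ) : d3 a a b = 0 := by unfold d3; ring

lemma InT.rot {a b c p : ℝ × ℝ} (h : InT a b c p) : InT b c a p := ⟨h.2.1, h.2.2, h.1⟩
lemma InO.rot {a b c p : ℝ × ℝ} (h : InO a b c p) : InO b c a p := ⟨h.2.1, h.2.2, h.1⟩

lemma d3_comb (a b x y z : ℝ × ℝ) (r s t : ℝ) (h : r + s + t = 1) :
    d3 a b (r • x + s • y + t • z) = r * d3 a b x + s * d3 a b y + t * d3 a b z := by
  have : r = 1 - s - t := by linarith
  subst this
  simp only [d3, Prod.fst_add, Prod.snd_add, Prod.smul_fst, Prod.smul_snd, smul_eq_mul]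
  ring

lemma d3_comb2 (a b x y : ℝ × ℝ) (r s : ℝ) (h : r + s = 1) :
    d3 a b (r • x + s • y) = r * d3 a b x + s * d3 a b y := by
  have : r = 1 - s := by linarith
  subst this
  simp only [d3, Prod.fst_add, Prod.snd_add, Prod.smul_fst, Prod.smul_snd, smul_eq_mul]
  ring

lemma bary_eq {a b c : ℝ × ℝ} (h : d3 a b c ≠ 0) (p : ℝ × ℝ) :
    (d3 b c p / d3 a b c) • a + (d3 c a p / d3 a b c) • b + (d3 a b p / d3 a b c) • c = p := by
  ext
  · simp only [Prod.fst_add, Prod.smul_fst, smul_eq_mul]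
    field_simp
    unfold d3; ring
  · simp only [Prod.snd_add, Prod.smul_snd, smul_eq_mul]
    field_simp
    unfold d3; ring

lemma bary_sum {a b c : ℝ × ℝ} (h : d3 a b c ≠ 0) (p : ℝ × ℝ) :
    (d3 b c p / d3 a b c) + (d3 c a p / d3 a b c) + (d3 a b p / d3 a b c) = 1 := by
  rw [← add_div, ← add_div, div_eq_one_iff_eq h, ← d3_sum a b c p]; ring

@[fun_prop]
lemma continuous_d3 {X : Type*} [TopologicalSpace X] {f g h : X → ℝ × ℝ} (hf : Continuous f)
    (hg : Continuous g) (hh : Continuous h) : Continuous fun x => d3 (f x) (g x) (h x) := by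
  unfold d3; fun_prop

lemma convex_InT (a b c : ℝ × ℝ) : Convex ℝ {p | InT a b c p} := by
  intro p hp q hq r s hr hs hrs
  simp only [Set.mem_setOf_eq, InT] at *
  rw [d3_comb2 _ _ _ _ _ _ hrs, d3_comb2 _ _ _ _ _ _ hrs, d3_comb2 _ _ _ _ _ _ hrs]
  obtain ⟨h1, h2, h3⟩ := hp
  obtain ⟨k1, k2, k3⟩ := hq
  refine ⟨?_, ?_, ?_⟩ <;> positivity

lemma isClosed_InT (a b c : ℝ × ℝ) : IsClosed {p | InT a b c p} := by
  unfold InT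
  refine IsClosed.and ?_ (IsClosed.and ?_ ?_) <;>
  exact isClosed_le continuous_const (by fun_prop)

lemma isOpen_InO (a b c : ℝ × ℝ) : IsOpen {p | InO a b c p} := by
  unfold InO
  refine IsOpen.and ?_ (IsOpen.and ?_ ?_) <;>
  exact isOpen_lt continuous_const (by fun_prop)

lemma mem_hull {a b c : ℝ × ℝ} (h : 0 < d3 a b c) (p : ℝ × ℝ) :
    p ∈ convexHull ℝ {a, b, c} ↔ InT a b c p := by
  constructor
  · intro hp
    have : convexHull ℝ {a, b, c} ⊆ {p | InT a b c p} := by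
      refine convexHull_min ?_ (convex_InT a b c)
      have h1 := d3_rot a b c
      have h2 := d3_rot b c a
      rintro x (rfl | rfl | rfl) <;>
      simp [InT, d3_self1, d3_self2] <;> linarith
    exact this hp
  · rintro ⟨h1, h2, h3⟩
    have hc := (convex_convexHull ℝ ({a, b, c} : Set (ℝ × ℝ)))
    have := hc.sum_mem (t := Finset.univ) (w := ![d3 b c p / d3 a b c, d3 c a p / d3 a b c,
      d3 a b p / d3 a b c]) (z := ![a, b, c]) ?_ ?_ ?_
    · rw [Fin.sum_univ_three] at this
      simp only [Matrix.cons_val_zero, Matrix.cons_val_one, Matrix.cons_val] at this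
      rwa [bary_eq h.ne'] at this
    · intro i _
      fin_cases i <;> simp <;> positivity
    · rw [Fin.sum_univ_three]
      simpa using bary_sum h.ne' p
    · intro i _
      apply subset_convexHull
      fin_cases i <;> simp

lemma d3_ne_of_indep {a b c : ℝ × ℝ} (h : AffineIndependent ℝ ![a, b, c]) : d3 a b c ≠ 0 := by
  intro h0
  rw [affineIndependent_iff_not_collinear_set] at h
  apply h
  rw [collinear_iff_of_mem (p₀ := a) (by simp)]
  by_cases hab : b.1 - a.1 = 0
  · by_cases hab2 : b.2 - a.2 = 0
    · refine ⟨c - a, ?_⟩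
      rintro p (rfl | rfl | rfl)
      · exact ⟨0, by simp⟩
      · refine ⟨0, ?_⟩
        ext <;> simp <;> linarith
      · exact ⟨1, by simp⟩
    · refine ⟨b - a, ?_⟩
      rintro p (rfl | rfl | rfl)
      · exact ⟨0, by simp⟩
      · exact ⟨1, by simp⟩
      · refine ⟨(p.2 - a.2) / (b.2 - a.2), ?_⟩
        unfold d3 at h0
        ext
        · simp; field_simp; linarith
        · simp; field_simp; ring
  · refine ⟨b - a, ?_⟩
    rintro p (rfl | rfl | rfl)
    · exact ⟨0, by simp⟩
    · exact ⟨1, by simp⟩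
    · refine ⟨(p.1 - a.1) / (b.1 - a.1), ?_⟩
      unfold d3 at h0
      ext
      · simp; field_simp; ring
      · simp; field_simp; linarith

/-- affine functions of the plane vanish on a set with dense open complement -/
lemma dense_affine {α β γ : ℝ} (h : α ≠ 0 ∨ β ≠ 0) :
    IsOpen {p : ℝ × ℝ | α * p.1 + β * p.2 + γ ≠ 0} ∧
    Dense {p : ℝ × ℝ | α * p.1 + β * p.2 + γ ≠ 0} := by
  constructor
  · exact isOpen_ne_fun (by fun_prop) (by fun_prop)
  · intro p
    by_cases hp : α * p.1 + β * p.2 + γ = 0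
    · have hpos : 0 < α ^ 2 + β ^ 2 := by
        rcases h with h | h <;> positivity
      have ht : Filter.Tendsto (fun ε : ℝ => p + ε • ((α, β) : ℝ × ℝ)) (nhdsWithin 0 (Set.Ioi 0))
          (nhds p) := by
        have : Continuous (fun ε : ℝ => p + ε • ((α, β) : ℝ × ℝ)) := by fun_prop
        have h2 := this.tendsto 0
        simp only [zero_smul, add_zero] at h2
        exact h2.mono_left nhdsWithin_le_nhds
      refine mem_closure_of_tendsto ht ?_
      filter_upwards [self_mem_nhdsWithin] with ε hε
      have hε' : (0 : ℝ) < ε := hε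
      simp only [Set.mem_setOf_eq, Prod.fst_add, Prod.snd_add, Prod.smul_fst, Prod.smul_snd,
        smul_eq_mul]
      have : α * (p.1 + ε * α) + β * (p.2 + ε * β) + γ = ε * (α ^ 2 + β ^ 2) := by
        linear_combination hp
      rw [this]; positivity
    · exact subset_closure hp

lemma dense_finite {J : Type*} [Finite J] (s : J → Set (ℝ × ℝ)) (h : ∀ j, IsOpen (s j) ∧ Dense (s j)) :
    Dense (⋂ j, s j) := 
  dense_iInter_of_isOpen (fun j => (h j).1) (fun j => (h j).2)

end

section
open Filter Topology

/-! ### Part 2 : combinatorics of the triangulation -/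

namespace TriDisk

variable {ι : Type} [Fintype ι] [DecidableEq ι]

/-- positively oriented triangles of the triangulation -/
def Tr (D : TriDisk ι) (a b c : ι) : Prop :=
  (∃ t ∈ D.tris, vset t = {a, b, c}) ∧ 0 < d3 (D.pos a) (D.pos b) (D.pos c)

lemma Tr.rot {D : TriDisk ι} {a b c : ι} (h : D.Tr a b c) : D.Tr b c a := by
  obtain ⟨⟨t, ht, hv⟩, h2⟩ := h
  refine ⟨⟨t, ht, ?_⟩, by rw [d3_rot]; exact h2⟩
  rw [hv]; ext x; simp; tauto

lemma Tr.ne {D : TriDisk ι} {a b c : ι} (h : D.Tr a b c) : a ≠ b := by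
  rintro rfl
  have := h.2
  rw [d3_self0] at this
  exact lt_irrefl _ this

lemma Tr.not_swap {D : TriDisk ι} {a b c : ι} (h : D.Tr a b c) (h' : D.Tr b a c) : False := by
  have h1 := h.2
  have h2 := h'.2
  rw [d3_swap] at h2
  linarith

lemma triSet_eq (pos : ι → ℝ × ℝ) (t : ι × ι × ι) :
    triSet pos t = convexHull ℝ (pos '' ((vset t : Finset ι) : Set ι)) := by
  unfold triSet vset
  congr 1
  ext x; simp [Set.image_insert_eq]

lemma hull_of_vset {D : TriDisk ι} {a b c : ι} {t : ι × ι × ι} (hv : vset t = {a, b, c}) :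
    triSet D.pos t = convexHull ℝ {D.pos a, D.pos b, D.pos c} := by
  rw [triSet_eq, hv]
  congr 1
  ext x; simp [Set.image_insert_eq]

lemma exists_orient (D : TriDisk ι) {t : ι × ι × ι} (ht : t ∈ D.tris) :
    ∃ a b c, D.Tr a b c ∧ vset t = {a, b, c} := by
  rcases lt_or_gt_of_ne (d3_ne_of_indep (D.indep t ht)) with h | h
  · refine ⟨t.2.1, t.1, t.2.2, ⟨⟨t, ht, ?_⟩, by rw [d3_swap]; linarith⟩, ?_⟩ <;>
    · ext x; simp [vset]; tauto
  · exact ⟨t.1, t.2.1, t.2.2, ⟨⟨t, ht, rfl⟩, h⟩, rfl⟩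

lemma mem_space (D : TriDisk ι) (p : ℝ × ℝ) :
    p ∈ D.space ↔ ∃ a b c, D.Tr a b c ∧ InT (D.pos a) (D.pos b) (D.pos c) p := by
  unfold space
  simp only [Set.mem_iUnion]
  constructor
  · rintro ⟨t, ht, hp⟩
    obtain ⟨a, b, c, h, hv⟩ := D.exists_orient ht
    refine ⟨a, b, c, h, ?_⟩
    rwa [hull_of_vset hv, mem_hull h.2] at hp
  · rintro ⟨a, b, c, h, hp⟩
    obtain ⟨t, ht, hv⟩ := h.1
    refine ⟨t, ht, ?_⟩
    rwa [hull_of_vset hv, mem_hull h.2]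

lemma Tr.exists_third (D : TriDisk ι) {t : ι × ι × ι} (ht : t ∈ D.tris) {v : ι} (hv : v ∈ vset t) :
    ∃ b c, D.Tr v b c := by
  obtain ⟨a, b, c, h, h2⟩ := D.exists_orient ht
  rw [h2] at hv
  simp only [Finset.mem_insert, Finset.mem_singleton] at hv
  rcases hv with rfl | rfl | rfl
  · exact ⟨_, _, h⟩
  · exact ⟨_, _, h.rot⟩
  · exact ⟨_, _, h.rot.rot⟩

lemma glue0 (D : TriDisk ι) {a b c a' b' c' : ι} (h : D.Tr a b c) (h' : D.Tr a' b' c')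
    {p : ℝ × ℝ} (hp : InT (D.pos a) (D.pos b) (D.pos c) p)
    (hp' : InT (D.pos a') (D.pos b') (D.pos c') p) (hc : c ≠ a' ∧ c ≠ b' ∧ c ≠ c') :
    d3 (D.pos a) (D.pos b) p = 0 := by
  obtain ⟨t, ht, hv⟩ := h.1
  obtain ⟨t', ht', hv'⟩ := h'.1
  have hg := D.glue t ht t' ht'
  rw [hull_of_vset hv, hull_of_vset hv'] at hg
  have hmem : p ∈ convexHull ℝ (D.pos '' ((vset t ∩ vset t' : Finset ι) : Set ι)) := by
    rw [← hg]
    exact ⟨(mem_hull h.2 p).2 hp, (mem_hull h'.2 p).2 hp'⟩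
  have hsub : convexHull ℝ (D.pos '' ((vset t ∩ vset t' : Finset ι) : Set ι)) ⊆
      {p | d3 (D.pos a) (D.pos b) p = 0} := by
    refine convexHull_min ?_ ?_
    · rintro _ ⟨v, hvm, rfl⟩
      rw [hv, hv'] at hvm
      simp only [Finset.coe_inter, Set.mem_inter_iff, Finset.mem_coe, Finset.mem_insert,
        Finset.mem_singleton] at hvm
      obtain ⟨rfl | rfl | rfl, h2⟩ := hvm
      · exact d3_self1 _ _
      · exact d3_self2 _ _
      · exfalso; tauto
    · intro p hp q hq r s hr hs hrs
      have hp0 : d3 (D.pos a) (D.pos b) p = 0 := hp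
      have hq0 : d3 (D.pos a) (D.pos b) q = 0 := hq
      show d3 (D.pos a) (D.pos b) _ = 0
      rw [d3_comb2 _ _ _ _ _ _ hrs, hp0, hq0]; simp
  exact hsub hmem

lemma isClosed_space (D : TriDisk ι) : IsClosed D.space := by
  have : D.space = ⋃ x : {x : ι × ι × ι // D.Tr x.1 x.2.1 x.2.2},
      {p | InT (D.pos x.1.1) (D.pos x.1.2.1) (D.pos x.1.2.2) p} := by
    ext p
    rw [mem_space]
    simp only [Set.mem_iUnion]
    constructor
    · rintro ⟨a, b, c, h, hp⟩
      exact ⟨⟨(a, b, c), h⟩, hp⟩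
    · rintro ⟨⟨x, hx⟩, hp⟩
      exact ⟨_, _, _, hx, hp⟩
  rw [this]
  exact isClosed_iUnion_of_finite fun x => isClosed_InT _ _ _

lemma Tr.in1 {D : TriDisk ι} {a b c : ι} (h : D.Tr a b c) :
    InT (D.pos a) (D.pos b) (D.pos c) (D.pos a) := by
  refine ⟨by rw [d3_self1], ?_, by rw [d3_self2]⟩
  rw [d3_rot]; exact h.2.le

lemma pos_mem (D : TriDisk ι) (hall : ∀ v : ι, ∃ t ∈ D.tris, v ∈ vset t) (v : ι) :
    D.pos v ∈ D.space := by
  obtain ⟨t, ht, hv⟩ := hall v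
  obtain ⟨b, c, h⟩ := Tr.exists_third D ht hv
  rw [mem_space]
  exact ⟨_, _, _, h, h.in1⟩

lemma vertex_mem (D : TriDisk ι) (hall : ∀ v : ι, ∃ t ∈ D.tris, v ∈ vset t) {a b c v : ι}
    (h : D.Tr a b c) (hp : InT (D.pos a) (D.pos b) (D.pos c) (D.pos v)) : v = a ∨ v = b ∨ v = c := by
  obtain ⟨t, ht, hv⟩ := hall v
  obtain ⟨b', c', h'⟩ := Tr.exists_third D ht hv
  by_contra hne
  have := D.glue0 h'.rot h h'.in1.rot hp (by tauto)
  rw [d3_rot] at this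
  have h2 := h'.2
  linarith

lemma near (D : TriDisk ι) (x : ℝ × ℝ) : ∀ᶠ p in 𝓝 x, p ∈ D.space →
    ∃ a b c, D.Tr a b c ∧ InT (D.pos a) (D.pos b) (D.pos c) p ∧
      InT (D.pos a) (D.pos b) (D.pos c) x := by
  have h1 : ∀ᶠ p in 𝓝 x, ∀ t : ι × ι × ι, ¬ InT (D.pos t.1) (D.pos t.2.1) (D.pos t.2.2) x →
      ¬ InT (D.pos t.1) (D.pos t.2.1) (D.pos t.2.2) p := by
    rw [eventually_all]
    intro t
    by_cases hx : InT (D.pos t.1) (D.pos t.2.1) (D.pos t.2.2) x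
    · exact Eventually.of_forall fun p h => absurd hx h
    · have := (isClosed_InT (D.pos t.1) (D.pos t.2.1) (D.pos t.2.2)).isOpen_compl.mem_nhds
        (x := x) hx
      filter_upwards [this] with p hp _
      exact hp
  filter_upwards [h1] with p hp hps
  obtain ⟨a, b, c, h, h2⟩ := (D.mem_space p).1 hps
  refine ⟨a, b, c, h, h2, ?_⟩
  by_contra hx
  exact hp (a, b, c) hx h2

lemma near_vertex (D : TriDisk ι) (hall : ∀ v : ι, ∃ t ∈ D.tris, v ∈ vset t) (v : ι) :
    ∀ᶠ p in 𝓝 (D.pos v), p ∈ D.space →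
    ∃ b c, D.Tr v b c ∧ InT (D.pos v) (D.pos b) (D.pos c) p := by
  filter_upwards [D.near (D.pos v)] with p hp hps
  obtain ⟨a, b, c, h, h1, h2⟩ := hp hps
  rcases D.vertex_mem hall h h2 with rfl | rfl | rfl
  · exact ⟨_, _, h, h1⟩
  · exact ⟨_, _, h.rot, h1.rot⟩
  · exact ⟨_, _, h.rot.rot, h1.rot.rot⟩

lemma open_unique (D : TriDisk ι) {a b c a' b' c' : ι} (h : D.Tr a b c) (h' : D.Tr a' b' c')
    {p : ℝ × ℝ} (hp : InO (D.pos a) (D.pos b) (D.pos c) p)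
    (hp' : InT (D.pos a') (D.pos b') (D.pos c') p) :
    (a' = a ∧ b' = b ∧ c' = c) ∨ (a' = b ∧ b' = c ∧ c' = a) ∨ (a' = c ∧ b' = a ∧ c' = b) := by
  have hc : c = a' ∨ c = b' ∨ c = c' := by
    by_contra hne
    have := D.glue0 h h' hp.inT hp' (by tauto)
    linarith [hp.1]
  have ha : a = a' ∨ a = b' ∨ a = c' := by
    by_contra hne
    have := D.glue0 h.rot h' hp.inT.rot hp' (by tauto)
    linarith [hp.2.1]
  have hb : b = a' ∨ b = b' ∨ b = c' := by
    by_contra hne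
    have := D.glue0 h.rot.rot h' hp.inT.rot.rot hp' (by tauto)
    linarith [hp.2.2]
  have n1 := h.ne
  have n2 := h.rot.ne
  have n3 := h.rot.rot.ne
  rcases ha with rfl | rfl | rfl <;> rcases hb with rfl | rfl | rfl <;>
    rcases hc with rfl | rfl | rfl <;> first | (exfalso; tauto; done) | (simp; done) | skip
  · exact (h.not_swap h'.rot.rot).elim
  · exact (h.not_swap h').elim
  · exact (h.not_swap h'.rot).elim

lemma third_unique (D : TriDisk ι) {a b c c' : ι} (h : D.Tr a b c) (h' : D.Tr a b c') : c = c' := by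
  -- a point close to the midpoint of the edge
  have hf : Continuous (fun ε : ℝ => ((1-ε)/2) • D.pos a + ((1-ε)/2) • D.pos b + ε • D.pos c) := by
    fun_prop
  have key : ∀ d, 0 < d3 (D.pos a) (D.pos b) (D.pos d) → ∀ᶠ ε : ℝ in 𝓝[>] 0,
      InO (D.pos a) (D.pos b) (D.pos d)
        (((1-ε)/2) • D.pos a + ((1-ε)/2) • D.pos b + ε • D.pos c) := by
    intro d hd
    have e1 : ∀ᶠ ε : ℝ in 𝓝 0, 0 < d3 (D.pos b) (D.pos d)
        (((1-ε)/2) • D.pos a + ((1-ε)/2) • D.pos b + ε • D.pos c) := by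
      refine (isOpen_lt continuous_const (by fun_prop)).mem_nhds ?_
      show 0 < d3 (D.pos b) (D.pos d) _
      rw [d3_comb _ _ _ _ _ _ _ _ (by ring), d3_self1, d3_rot]
      simpa using hd
    have e2 : ∀ᶠ ε : ℝ in 𝓝 0, 0 < d3 (D.pos d) (D.pos a)
        (((1-ε)/2) • D.pos a + ((1-ε)/2) • D.pos b + ε • D.pos c) := by
      refine (isOpen_lt continuous_const (by fun_prop)).mem_nhds ?_
      show 0 < d3 (D.pos d) (D.pos a) _
      rw [d3_comb _ _ _ _ _ _ _ _ (by ring), d3_self2, d3_rot, d3_rot]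
      simpa using hd
    filter_upwards [e1.filter_mono nhdsWithin_le_nhds, e2.filter_mono nhdsWithin_le_nhds,
      self_mem_nhdsWithin] with ε h1 h2 h3
    refine ⟨?_, h1, h2⟩
    rw [d3_comb _ _ _ _ _ _ _ _ (by ring), d3_self1, d3_self2]
    have : (0:ℝ) < ε := h3
    have := h.2
    simp only [mul_zero, zero_add]
    positivity
  obtain ⟨ε, h1, h2⟩ := ((key c h.2).and (key c' h'.2)).exists
  have n1 := h.ne
  have n2 := h.rot.ne
  have n3 := h.rot.rot.ne
  rcases D.open_unique h h' h1 h2.inT with ⟨-, -, h⟩ | ⟨h, -, -⟩ | ⟨h, -, -⟩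
  · exact h.symm
  · exact absurd h n1
  · exact absurd h.symm n3

lemma cone_unique (D : TriDisk ι) {v b c b' c' : ι} (h : D.Tr v b c) (h' : D.Tr v b' c')
    {q : ℝ × ℝ} (h1 : 0 < d3 (D.pos v) (D.pos b) q) (h2 : 0 < d3 (D.pos c) (D.pos v) q)
    (h1' : 0 < d3 (D.pos v) (D.pos b') q) (h2' : 0 < d3 (D.pos c') (D.pos v) q) :
    b = b' ∧ c = c' := by
  have key : ∀ b c, D.Tr v b c → 0 < d3 (D.pos v) (D.pos b) q → 0 < d3 (D.pos c) (D.pos v) q →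
     ∀ᶠ ε : ℝ in 𝓝[>] 0,
      InO (D.pos v) (D.pos b) (D.pos c) ((1-ε) • D.pos v + ε • q) := by
    intro b c h h1 h2
    have e1 : ∀ᶠ ε : ℝ in 𝓝 0, 0 < d3 (D.pos b) (D.pos c) ((1-ε) • D.pos v + ε • q) := by
      refine (isOpen_lt continuous_const (by fun_prop)).mem_nhds ?_
      show 0 < d3 (D.pos b) (D.pos c) _
      rw [d3_comb2 _ _ _ _ _ _ (by ring), d3_rot]
      simpa using h.2
    filter_upwards [e1.filter_mono nhdsWithin_le_nhds, self_mem_nhdsWithin] with ε he h3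
    have h3 : (0:ℝ) < ε := h3
    refine ⟨?_, he, ?_⟩
    · rw [d3_comb2 _ _ _ _ _ _ (by ring), d3_self1]
      simp only [mul_zero, zero_add]; positivity
    · rw [d3_comb2 _ _ _ _ _ _ (by ring), d3_self2]
      simp only [mul_zero, zero_add]; positivity
  obtain ⟨ε, k1, k2⟩ := ((key b c h h1 h2).and (key b' c' h' h1' h2')).exists
  have n1 := h.ne
  have n3 := h.rot.rot.ne
  rcases D.open_unique h h' k1 k2.inT with ⟨-, h2, h3⟩ | ⟨h, -, -⟩ | ⟨h, -, -⟩
  · exact ⟨h2.symm, h3.symm⟩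
  · exact absurd h n1
  · exact absurd h.symm n3

lemma other_side (D : TriDisk ι) {a b c : ι} (h : D.Tr a b c) {s : ℝ} (hs0 : 0 < s) (hs1 : s < 1)
    (hx : (1 - s) • D.pos a + s • D.pos b ∈ interior D.space) : ∃ c', D.Tr b a c' := by
  set x := (1 - s) • D.pos a + s • D.pos b with hxdef
  have hf : Tendsto (fun ε : ℝ => (1 + ε) • x + (-ε) • D.pos c) (𝓝[>] 0) (𝓝 x) := by
    have : Continuous (fun ε : ℝ => (1 + ε) • x + (-ε) • D.pos c) := by fun_prop
    have h2 := this.tendsto 0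
    simp only [add_zero, one_smul, neg_zero, zero_smul] at h2
    exact h2.mono_left nhdsWithin_le_nhds
  have hin : ∀ᶠ p in 𝓝 x, p ∈ D.space := mem_interior_iff_mem_nhds.1 hx
  obtain ⟨ε, h1, h2, h3⟩ := ((hf.eventually (D.near x)).and ((hf.eventually hin).and
    self_mem_nhdsWithin)).exists
  have h3 : (0 : ℝ) < ε := h3
  obtain ⟨a', b', c', ht, hp, hxT⟩ := h1 h2
  have hxa : d3 (D.pos a) (D.pos b) x = 0 := by
    rw [hxdef, d3_comb2 _ _ _ _ _ _ (by ring), d3_self1, d3_self2]; simp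
  have hxb : 0 < d3 (D.pos b) (D.pos c) x := by
    rw [hxdef, d3_comb2 _ _ _ _ _ _ (by ring), d3_self1, d3_rot]
    have := h.2; have : 0 < 1 - s := by linarith
    simp only [mul_zero, add_zero]; positivity
  have hxc : 0 < d3 (D.pos c) (D.pos a) x := by
    rw [hxdef, d3_comb2 _ _ _ _ _ _ (by ring), d3_self2, d3_rot, d3_rot]
    have := h.2
    simp only [mul_zero, zero_add]; positivity
  have hxI : InT (D.pos a) (D.pos b) (D.pos c) x := ⟨hxa.ge, hxb.le, hxc.le⟩
  have ha : a = a' ∨ a = b' ∨ a = c' := by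
    by_contra hne
    have := D.glue0 h.rot ht hxI.rot hxT (by tauto)
    linarith
  have hb : b = a' ∨ b = b' ∨ b = c' := by
    by_contra hne
    have := D.glue0 h.rot.rot ht hxI.rot.rot hxT (by tauto)
    linarith
  have hneg : d3 (D.pos a) (D.pos b) ((1 + ε) • x + (-ε) • D.pos c) < 0 := by
    rw [d3_comb2 _ _ _ _ _ _ (by ring), hxa]
    have := mul_pos h3 h.2
    linarith
  have n1 := h.ne
  obtain ⟨p1, p2, p3⟩ := hp
  rcases ha with rfl | rfl | rfl <;> rcases hb with rfl | rfl | rfl <;>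
    first | (exfalso; tauto; done) | (exfalso; linarith; done) | skip
  · exact ⟨_, ht.rot.rot⟩
  · exact ⟨_, ht⟩
  · exact ⟨_, ht.rot⟩

/-- connectivity of links -/
lemma link_conn (D : TriDisk ι) (hconv : Convex ℝ D.space)
    (hall : ∀ v : ι, ∃ t ∈ D.tris, v ∈ vset t) (v : ι) (P : ι → Prop)
    {u w : ι} (hu : ∃ c, D.Tr v u c ∨ D.Tr v c u) (hw : ∃ c, D.Tr v w c ∨ D.Tr v c w)
    (hPu : P u) (hPw : ¬ P w) : ∃ b c, D.Tr v b c ∧ ¬ (P b ↔ P c) := by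
  by_contra hcon
  push Not at hcon
  -- reduce to the non-collinear case
  wlog hcr : d3 (D.pos v) (D.pos u) (D.pos w) ≠ 0 generalizing u
  · push Not at hcr
    obtain ⟨c, hc⟩ := hu
    have hcv : ∃ d, D.Tr v c d ∨ D.Tr v d c := ⟨u, hc.symm⟩
    have hPc : P c := by
      rcases hc with hc | hc
      · exact (hcon _ _ hc).1 hPu
      · exact (hcon _ _ hc).2 hPu
    refine this hcv hPc ?_
    intro h0
    have hne : d3 (D.pos v) (D.pos u) (D.pos c) ≠ 0 := by
      rcases hc with hc | hc
      · exact hc.2.ne'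
      · have := hc.2
        rw [← d3_rot, d3_swap] at this
        rw [← d3_rot, d3_rot, d3_rot] at this
        intro h; rw [h] at this; simp at this
    have hwv : v ≠ w := by
      obtain ⟨e, he | he⟩ := hw
      · exact he.ne
      · exact he.rot.rot.ne.symm
    -- w - v is parallel to both u - v and c - v
    have hw0 : D.pos w = D.pos v := by
      unfold d3 at *
      have e1 : ((D.pos w).1 - (D.pos v).1) * (((D.pos u).1 - (D.pos v).1) * ((D.pos c).2 - (D.pos v).2) -
        ((D.pos u).2 - (D.pos v).2) * ((D.pos c).1 - (D.pos v).1)) = 0 := by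
        linear_combination (((D.pos c).1 - (D.pos v).1)) * hcr - ((D.pos u).1 - (D.pos v).1) * h0
      have e2 : ((D.pos w).2 - (D.pos v).2) * (((D.pos u).1 - (D.pos v).1) * ((D.pos c).2 - (D.pos v).2) -
        ((D.pos u).2 - (D.pos v).2) * ((D.pos c).1 - (D.pos v).1)) = 0 := by
        linear_combination (((D.pos c).2 - (D.pos v).2)) * hcr - ((D.pos u).2 - (D.pos v).2) * h0
      have e1' := (mul_eq_zero.1 e1).resolve_right hne
      have e2' := (mul_eq_zero.1 e2).resolve_right hne
      ext <;> linarith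
    exact hwv (D.inj hw0.symm)
  set U := D.pos u
  set W := D.pos w
  set O := D.pos v
  -- the path
  let γ : ℝ → ℝ → ℝ × ℝ := fun ε s => (1 - ε) • O + (ε * (1 - s)) • U + (ε * s) • W
  have hγ : Continuous (fun x : ℝ × ℝ => γ x.1 x.2) := by fun_prop
  have hev : ∀ᶠ ε in 𝓝 (0:ℝ), ∀ s ∈ Set.Icc (0:ℝ) 1, γ ε s ∈ D.space →
      ∃ b c, D.Tr v b c ∧ InT (D.pos v) (D.pos b) (D.pos c) (γ ε s) := by
    refine isCompact_Icc.eventually_forall_of_forall_eventually ?_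
    intro s hs
    have h1 := hγ.tendsto ((0 : ℝ), s)
    have h2 : γ 0 s = O := by simp [γ]
    simp only [h2] at h1
    exact h1.eventually (D.near_vertex hall v)
  obtain ⟨ε, hε, hε0, hε1⟩ := ((hev.filter_mono nhdsWithin_le_nhds).and
    (Ioo_mem_nhdsGT (zero_lt_one (α := ℝ)))).exists
  have hUs : U ∈ D.space := D.pos_mem hall u
  have hWs : W ∈ D.space := D.pos_mem hall w
  have hOs : O ∈ D.space := D.pos_mem hall v
  have hγs : ∀ s ∈ Set.Icc (0:ℝ) 1, γ ε s ∈ D.space := by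
    intro s hs
    have := hconv.sum_mem (t := Finset.univ) (w := ![1 - ε, ε * (1 - s), ε * s]) (z := ![O, U, W])
       ?_ ?_ ?_
    · rw [Fin.sum_univ_three] at this
      simpa using this
    · intro i _
      have : 0 ≤ 1 - s := by linarith [hs.2]
      have h4 : 0 ≤ 1 - ε := by linarith
      fin_cases i
      · exact h4
      · exact mul_nonneg hε0.le this
      · exact mul_nonneg hε0.le hs.1
    · rw [Fin.sum_univ_three]; simp; ring
    · intro i _
      fin_cases i <;> simp [hUs, hWs, hOs]
  have hγO : ∀ s, γ ε s ≠ O := by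
    intro s hs
    apply hcr
    have e1 : d3 O U (γ ε s) = 0 := by rw [hs, d3_self1]
    have e2 : d3 O W (γ ε s) = 0 := by rw [hs, d3_self1]
    simp only [γ] at e1 e2
    rw [d3_comb _ _ _ _ _ _ _ _ (by ring)] at e1 e2
    rw [d3_self1, d3_self2] at e1 e2
    have e3 : d3 O W U = - d3 O U W := by unfold d3; ring
    rw [e3] at e2
    have := hε0.ne'
    have : ε * d3 O U W = 0 := by linear_combination e1 - e2
    rcases mul_eq_zero.1 this with h | h
    · exact absurd h hε0.ne'
    · exact h
  let C : (ι → Prop) → Set ℝ := fun Q => ⋃ x : {x : ι × ι // D.Tr v x.1 x.2 ∧ Q x.1},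
    {s | InT (D.pos v) (D.pos x.1.1) (D.pos x.1.2) (γ ε s)}
  have hCc : ∀ Q, IsClosed (C Q) := by
    intro Q
    refine isClosed_iUnion_of_finite fun x => ?_
    exact (isClosed_InT _ _ _).preimage (by fun_prop)
  have hpre := (isPreconnected_Icc (a := (0:ℝ)) (b := 1))
  rw [isPreconnected_closed_iff] at hpre
  have mk : ∀ (Q : ι → Prop) b c s, D.Tr v b c → Q b →
    InT (D.pos v) (D.pos b) (D.pos c) (γ ε s) → s ∈ C Q := by
    intro Q b c s h1 h2 h3
    exact Set.mem_iUnion.2 ⟨⟨(b, c), h1, h2⟩, h3⟩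
  have hend : ∀ (Q : ι → Prop) (z : ι), (∃ c, D.Tr v z c ∨ D.Tr v c z) → Q z →
      (∀ b c, D.Tr v b c → (Q b ↔ Q c)) → ∀ s, γ ε s = (1 - ε) • O + ε • D.pos z → s ∈ C Q := by
    intro Q z hz hQ hQc s hs
    obtain ⟨c, hc | hc⟩ := hz
    · refine mk Q z c s hc hQ ?_
      rw [hs]
      exact convex_InT _ _ _ hc.in1 hc.rot.in1.rot.rot (by linarith) hε0.le (by ring)
    · refine mk Q c z s hc ((hQc _ _ hc).2 hQ) ?_
      rw [hs]
      exact convex_InT _ _ _ hc.in1 hc.rot.rot.in1.rot (by linarith) hε0.le (by ring)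
  have hcov : Set.Icc (0:ℝ) 1 ⊆ C P ∪ C (fun x => ¬ P x) := by
    intro s hs
    obtain ⟨b, c, h1, h2⟩ := hε s hs (hγs s hs)
    by_cases hb : P b
    · exact Or.inl (mk _ b c s h1 hb h2)
    · exact Or.inr (mk (fun x => ¬ P x) b c s h1 hb h2)
  obtain ⟨s, hs, hs1, hs2⟩ := hpre (C P) (C fun x => ¬ P x) (hCc _) (hCc (fun x => ¬ P x)) hcov
    ⟨0, by simp, hend P u hu hPu hcon 0 (by simp [γ, U])⟩
    ⟨1, by simp, hend (fun x => ¬ P x) w hw hPw (fun b c h => not_congr (hcon b c h)) 1 (by simp [γ, W])⟩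
  simp only [C, Set.mem_iUnion] at hs1 hs2
  obtain ⟨⟨⟨b, c⟩, ht, hb⟩, h1⟩ := hs1
  obtain ⟨⟨⟨b', c'⟩, ht', hb'⟩, h1'⟩ := hs2
  simp only at ht hb ht' hb' h1 h1'
  have hc := (hcon _ _ ht).1 hb
  have hc' : ¬ P c' := fun h => hb' ((hcon _ _ ht').2 h)
  have d1 := D.glue0 ht ht' h1 h1' ⟨ht.rot.rot.ne, by rintro rfl; tauto, by rintro rfl; tauto⟩
  have d2 := D.glue0 ht.rot.rot ht' h1.rot.rot h1' ⟨ht.ne.symm, by rintro rfl; tauto, by rintro rfl; tauto⟩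
  apply hγO s
  have := bary_eq ht.2.ne' (γ ε s)
  have hsum := bary_sum ht.2.ne' (γ ε s)
  rw [d1, d2] at this hsum
  simp only [zero_div, add_zero] at hsum
  rw [hsum] at this
  simpa using this.symm

end TriDisk

end

section
open Filter Topology

/-! ### Part 3 : sign changes -/

/-- linear functional on the plane -/
def lin (l p : ℝ × ℝ) : ℝ := l.1 * p.1 + l.2 * p.2

@[fun_prop]
lemma continuous_lin {X : Type*} [TopologicalSpace X] {f g : X → ℝ × ℝ} (hf : Continuous f)
    (hg : Continuous g) : Continuous fun x => lin (f x) (g x) := by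
  unfold lin; fun_prop

lemma lin_comb (l x y z : ℝ × ℝ) (r s t : ℝ) :
    lin l (r • x + s • y + t • z) = r * lin l x + s * lin l y + t * lin l z := by
  simp only [lin, Prod.fst_add, Prod.snd_add, Prod.smul_fst, Prod.smul_snd, smul_eq_mul]
  ring

namespace TriDisk

variable {ι : Type} [Fintype ι] [DecidableEq ι]

/-- interior vertices -/
def Int (D : TriDisk ι) (v : ι) : Prop := D.pos v ∈ interior D.space

/-- adjacency -/
def Adj (D : TriDisk ι) (v u : ι) : Prop := ∃ c, D.Tr v u c ∨ D.Tr v c u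

lemma Adj.symm {D : TriDisk ι} {v u : ι} (h : D.Adj v u) : D.Adj u v := by
  obtain ⟨c, h | h⟩ := h
  · exact ⟨c, Or.inr h.rot⟩
  · exact ⟨c, Or.inl h.rot.rot⟩

lemma Adj.ne {D : TriDisk ι} {v u : ι} (h : D.Adj v u) : v ≠ u := by
  obtain ⟨c, h | h⟩ := h
  · exact h.ne
  · exact h.rot.rot.ne.symm

lemma Tr.adj1 {D : TriDisk ι} {v b c : ι} (h : D.Tr v b c) : D.Adj v b := ⟨c, Or.inl h⟩
lemma Tr.adj2 {D : TriDisk ι} {v b c : ι} (h : D.Tr v b c) : D.Adj v c := ⟨b, Or.inr h⟩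

lemma exists_higher (D : TriDisk ι) (hall : ∀ v : ι, ∃ t ∈ D.tris, v ∈ vset t) {v : ι}
    (hv : D.Int v) {l : ℝ × ℝ} (hl : l ≠ 0) :
    ∃ u, D.Adj v u ∧ lin l (D.pos v) < lin l (D.pos u) := by
  have hf : Tendsto (fun ε : ℝ => D.pos v + ε • l) (𝓝[>] 0) (𝓝 (D.pos v)) := by
    have : Continuous (fun ε : ℝ => D.pos v + ε • l) := by fun_prop
    have h2 := this.tendsto 0
    simp only [add_zero, zero_smul] at h2
    exact h2.mono_left nhdsWithin_le_nhds
  have hin : ∀ᶠ p in 𝓝 (D.pos v), p ∈ D.space := mem_interior_iff_mem_nhds.1 hv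
  obtain ⟨ε, h1, h2, h3⟩ := ((hf.eventually (D.near_vertex hall v)).and ((hf.eventually hin).and
    self_mem_nhdsWithin)).exists
  have h3 : (0 : ℝ) < ε := h3
  obtain ⟨b, c, ht, hp⟩ := h1 h2
  by_contra hcon
  push Not at hcon
  have hb := hcon b ht.adj1
  have hc := hcon c ht.adj2
  have e := bary_eq ht.2.ne' (D.pos v + ε • l)
  have es := bary_sum ht.2.ne' (D.pos v + ε • l)
  obtain ⟨p1, p2, p3⟩ := hp
  have q1 := div_nonneg p1 ht.2.le
  have q2 := div_nonneg p2 ht.2.le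
  have q3 := div_nonneg p3 ht.2.le
  have e2 := congrArg (lin l) e
  rw [lin_comb] at e2
  have e3 : lin l (D.pos v + ε • l) = lin l (D.pos v) + ε * (l.1 ^ 2 + l.2 ^ 2) := by
    simp [lin]; ring
  have hpos : 0 < l.1 ^ 2 + l.2 ^ 2 := by
    by_contra h
    apply hl
    have h1 : l.1 = 0 := by nlinarith [sq_nonneg l.1, sq_nonneg l.2]
    have h2 : l.2 = 0 := by nlinarith [sq_nonneg l.1, sq_nonneg l.2]
    ext <;> simp [h1, h2]
  have := mul_pos h3 hpos
  set w := d3 (D.pos b) (D.pos c) (D.pos v + ε • l) / d3 (D.pos v) (D.pos b) (D.pos c)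
  set s := d3 (D.pos c) (D.pos v) (D.pos v + ε • l) / d3 (D.pos v) (D.pos b) (D.pos c)
  set t := d3 (D.pos v) (D.pos b) (D.pos v + ε • l) / d3 (D.pos v) (D.pos b) (D.pos c)
  have hw : w = 1 - s - t := by linarith
  rw [hw] at e2
  have m1 := mul_le_mul_of_nonneg_left hb q3
  have m2 := mul_le_mul_of_nonneg_left hc q1
  linarith

lemma exists_lower (D : TriDisk ι) (hall : ∀ v : ι, ∃ t ∈ D.tris, v ∈ vset t) {v : ι}
    (hv : D.Int v) {l : ℝ × ℝ} (hl : l ≠ 0) :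
    ∃ u, D.Adj v u ∧ lin l (D.pos u) < lin l (D.pos v) := by
  obtain ⟨u, h1, h2⟩ := D.exists_higher hall hv (l := -l) (by simpa using hl)
  refine ⟨u, h1, ?_⟩
  simp [lin] at h2 ⊢
  linarith

lemma mid_int (D : TriDisk ι) (hconv : Convex ℝ D.space)
    (hall : ∀ v : ι, ∃ t ∈ D.tris, v ∈ vset t) {v : ι} (hv : D.Int v) (u : ι) :
    (1 - (1/2 : ℝ)) • D.pos v + (1/2 : ℝ) • D.pos u ∈ interior D.space :=
  hconv.combo_interior_self_mem_interior hv (D.pos_mem hall u) (by norm_num) (by norm_num)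
    (by norm_num)

lemma pred_exists (D : TriDisk ι) (hconv : Convex ℝ D.space)
    (hall : ∀ v : ι, ∃ t ∈ D.tris, v ∈ vset t) {v u c : ι} (hv : D.Int v) (h : D.Tr v u c) :
    ∃ c', D.Tr v c' u := by
  obtain ⟨c', h'⟩ := D.other_side h (by norm_num) (by norm_num) (D.mid_int hconv hall hv u)
  exact ⟨c', h'.rot⟩

lemma succ_exists (D : TriDisk ι) (hconv : Convex ℝ D.space)
    (hall : ∀ v : ι, ∃ t ∈ D.tris, v ∈ vset t) {v u c : ι} (hv : D.Int v) (h : D.Tr v c u) :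
    ∃ c', D.Tr v u c' := by
  refine D.other_side h.rot.rot (s := 1/2) (by norm_num) (by norm_num) ?_
  have := D.mid_int hconv hall hv u
  rw [add_comm] at this
  convert this using 3 <;> norm_num

lemma Adj.succ {D : TriDisk ι} (hconv : Convex ℝ D.space)
    (hall : ∀ v : ι, ∃ t ∈ D.tris, v ∈ vset t) {v u : ι} (hv : D.Int v) (h : D.Adj v u) :
    ∃ c, D.Tr v u c := by
  obtain ⟨c, h | h⟩ := h
  · exact ⟨c, h⟩
  · exact D.succ_exists hconv hall hv h

lemma Adj.pred {D : TriDisk ι} (hconv : Convex ℝ D.space)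
    (hall : ∀ v : ι, ∃ t ∈ D.tris, v ∈ vset t) {v u : ι} (hv : D.Int v) (h : D.Adj v u) :
    ∃ c, D.Tr v c u := by
  obtain ⟨c, h | h⟩ := h
  · exact D.pred_exists hconv hall hv h
  · exact ⟨c, h⟩

lemma pred_unique (D : TriDisk ι) {v u c c' : ι} (h : D.Tr v c u) (h' : D.Tr v c' u) : c = c' :=
  D.third_unique h.rot.rot h'.rot.rot

lemma pigeon (D : TriDisk ι) (hconv : Convex ℝ D.space)
    (hall : ∀ v : ι, ∃ t ∈ D.tris, v ∈ vset t) {v : ι} (hv : D.Int v) (P : ι → Prop)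
    (hP : ∀ b c, D.Tr v b c → P c → P b) : ∀ b c, D.Tr v b c → P b → P c := by
  classical
  have hpred : ∀ x : {u // D.Adj v u ∧ P u}, ∃ y : {u // D.Adj v u ∧ P u}, D.Tr v y x := by
    rintro ⟨u, h1, h2⟩
    obtain ⟨c, hc⟩ := h1.pred hconv hall hv
    exact ⟨⟨c, hc.adj1, hP _ _ hc h2⟩, hc⟩
  choose f hf using hpred
  have hinj : Function.Injective f := by
    intro x y hxy
    have h1 := hf x
    have h2 := hf y
    rw [hxy] at h1
    exact Subtype.ext (D.third_unique h1 h2)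
  have hsurj := Finite.surjective_of_injective hinj
  intro b c h hb
  obtain ⟨x, hx⟩ := hsurj ⟨b, h.adj1, hb⟩
  have h1 := hf x
  rw [hx] at h1
  rw [D.third_unique h h1]
  exact x.2.2

lemma both_types (D : TriDisk ι) (hconv : Convex ℝ D.space)
    (hall : ∀ v : ι, ∃ t ∈ D.tris, v ∈ vset t) {v : ι} (hv : D.Int v) (P : ι → Prop)
    {u w : ι} (hu : D.Adj v u) (hw : D.Adj v w) (hPu : P u) (hPw : ¬ P w) :
    (∃ b c, D.Tr v b c ∧ P b ∧ ¬ P c) ∧ (∃ b c, D.Tr v b c ∧ ¬ P b ∧ P c) := by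
  obtain ⟨b, c, h1, h2⟩ := D.link_conn hconv hall v P hu hw hPu hPw
  constructor
  · by_contra hcon
    push Not at hcon
    have := D.pigeon hconv hall hv (fun x => ¬ P x)
      (fun b c h hc hb => hc (hcon b c h hb))
    apply h2
    exact ⟨hcon b c h1, fun hc => by_contra fun hb => this b c h1 hb hc⟩
  · by_contra hcon
    push Not at hcon
    have := D.pigeon hconv hall hv P
      (fun b c h hc => by_contra fun hb => hcon b c h hb hc)
    apply h2
    exact ⟨this b c h1, fun hc => by_contra fun hb => hcon b c h1 hb hc⟩

open Classical in
/-- triangles at `v` for which `v` is the median vertex -/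
noncomputable def sc (D : TriDisk ι) (r : ι → ℝ) (v : ι) : Finset (ι × ι) :=
  Finset.univ.filter (fun x => D.Tr v x.1 x.2 ∧
    ((r x.1 < r v ∧ r v < r x.2) ∨ (r x.2 < r v ∧ r v < r x.1)))

lemma mem_sc (D : TriDisk ι) (r : ι → ℝ) (v b c : ι) : (b, c) ∈ D.sc r v ↔ D.Tr v b c ∧
    ((r b < r v ∧ r v < r c) ∨ (r c < r v ∧ r v < r b)) := by
  simp [sc]

open Classical in
lemma sum_sc (D : TriDisk ι) (r : ι → ℝ) (hr : ∀ a b, D.Adj a b → r a ≠ r b) :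
    3 * ∑ v, (D.sc r v).card = ∑ a : ι, ∑ b : ι, ∑ c : ι, if D.Tr a b c then 1 else 0 := by
  let f : ι → ι → ι → ℕ := fun a b c => if D.Tr a b c ∧
    ((r b < r a ∧ r a < r c) ∨ (r c < r a ∧ r a < r b)) then 1 else 0
  have h1 : ∑ v, (D.sc r v).card = ∑ a, ∑ b, ∑ c, f a b c := by
    refine Finset.sum_congr rfl fun v _ => ?_
    rw [sc, Finset.card_filter, Fintype.sum_prod_type]
  have h2 : ∑ a, ∑ b, ∑ c, f a b c = ∑ a, ∑ b, ∑ c, f b c a := by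
    have e1 : ∑ a, ∑ b, ∑ c, f b c a = ∑ b, ∑ a, ∑ c, f b c a := Finset.sum_comm
    rw [e1]
    refine Finset.sum_congr rfl fun b _ => ?_
    rw [Finset.sum_comm]
  have h3 : ∑ a, ∑ b, ∑ c, f a b c = ∑ a, ∑ b, ∑ c, f c a b := by
    have e1 : ∀ a, ∑ b, ∑ c, f c a b = ∑ c, ∑ b, f c a b := fun a => Finset.sum_comm
    simp_rw [e1]
    rw [Finset.sum_comm]
  have h4 : ∀ a b c, f a b c + f b c a + f c a b = if D.Tr a b c then 1 else 0 := by
    intro a b c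
    by_cases h : D.Tr a b c
    · have n1 := hr _ _ h.adj1
      have n2 := hr _ _ h.adj2
      have n3 := hr _ _ h.rot.adj1
      simp only [f, h, h.rot, h.rot.rot, true_and, if_true]
      rcases lt_or_gt_of_ne n1 with l1 | l1 <;> rcases lt_or_gt_of_ne n2 with l2 | l2 <;>
        rcases lt_or_gt_of_ne n3 with l3 | l3 <;>
        simp [l1, l2, l3, l1.not_gt, l2.not_gt, l3.not_gt] <;> linarith
    · have h' : ¬ D.Tr b c a := fun h' => h h'.rot.rot
      have h'' : ¬ D.Tr c a b := fun h' => h h'.rot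
      simp [f, h, h', h'']
  rw [h1]
  have : 3 * ∑ a, ∑ b, ∑ c, f a b c = (∑ a, ∑ b, ∑ c, f a b c) + (∑ a, ∑ b, ∑ c, f b c a) +
      ∑ a, ∑ b, ∑ c, f c a b := by
    rw [← h2, ← h3]; ring
  rw [this]
  simp_rw [← Finset.sum_add_distrib, h4]

lemma cone_ev (D : TriDisk ι) {v b c : ι} (h : D.Tr v b c)
    {q : ℝ × ℝ} (h1 : 0 < d3 (D.pos v) (D.pos b) q) (h2 : 0 < d3 (D.pos c) (D.pos v) q) :
    ∀ᶠ ε : ℝ in 𝓝[>] 0, (1-ε) • D.pos v + ε • q ∈ interior D.space := by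
  have e1 : ∀ᶠ ε : ℝ in 𝓝 0, 0 < d3 (D.pos b) (D.pos c) ((1-ε) • D.pos v + ε • q) := by
    refine (isOpen_lt continuous_const (by fun_prop)).mem_nhds ?_
    show 0 < d3 (D.pos b) (D.pos c) _
    rw [d3_comb2 _ _ _ _ _ _ (by ring), d3_rot]
    simpa using h.2
  filter_upwards [e1.filter_mono nhdsWithin_le_nhds, self_mem_nhdsWithin] with ε he h3
  have h3 : (0:ℝ) < ε := h3
  have hO : InO (D.pos v) (D.pos b) (D.pos c) ((1-ε) • D.pos v + ε • q) := by
    refine ⟨?_, he, ?_⟩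
    · rw [d3_comb2 _ _ _ _ _ _ (by ring), d3_self1]
      simp only [mul_zero, zero_add]; positivity
    · rw [d3_comb2 _ _ _ _ _ _ (by ring), d3_self2]
      simp only [mul_zero, zero_add]; positivity
  rw [mem_interior]
  exact ⟨{p | InO (D.pos v) (D.pos b) (D.pos c) p},
    fun p hp => (D.mem_space p).2 ⟨_, _, _, h, InO.inT hp⟩, isOpen_InO _ _ _, hO⟩

lemma ref_le (D : TriDisk ι) (hconv : Convex ℝ D.space) (l : ℝ × ℝ) (v : ι) :
    (D.sc (fun u => lin l (D.pos u)) v).card ≤ 2 ∧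
    (¬ D.Int v → (D.sc (fun u => lin l (D.pos u)) v).card ≤ 1) := by
  classical
  set r : ι → ℝ := fun u => lin l (D.pos u) with hr
  let d : ℝ × ℝ := (l.2, - l.1)
  have f1 : ∀ b, d3 (D.pos v) (D.pos b) (D.pos v + d) = r v - r b := by
    intro b; simp [d3, hr, lin, d]; ring
  have f2 : ∀ b, d3 (D.pos b) (D.pos v) (D.pos v + d) = r b - r v := by
    intro b; simp [d3, hr, lin, d]; ring
  have f3 : ∀ b, d3 (D.pos v) (D.pos b) (D.pos v - d) = r b - r v := by
    intro b; simp [d3, hr, lin, d]; ring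
  have f4 : ∀ b, d3 (D.pos b) (D.pos v) (D.pos v - d) = r v - r b := by
    intro b; simp [d3, hr, lin, d]; ring
  let A := Finset.univ.filter (fun x : ι × ι => D.Tr v x.1 x.2 ∧ (r x.1 < r v ∧ r v < r x.2))
  let B := Finset.univ.filter (fun x : ι × ι => D.Tr v x.1 x.2 ∧ (r x.2 < r v ∧ r v < r x.1))
  have hAB : D.sc r v = A ∪ B := by
    ext ⟨b, c⟩
    simp [mem_sc, A, B]; tauto
  have hA : A.card ≤ 1 := by
    rw [Finset.card_le_one]
    rintro ⟨b, c⟩ h ⟨b', c'⟩ h'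
    simp only [A, Finset.mem_filter, Finset.mem_univ, true_and] at h h'
    obtain ⟨e1, e2⟩ := D.cone_unique (q := D.pos v + d) h.1 h'.1 (by rw [f1]; linarith)
      (by rw [f2]; linarith) (by rw [f1]; linarith) (by rw [f2]; linarith)
    rw [e1, e2]
  have hB : B.card ≤ 1 := by
    rw [Finset.card_le_one]
    rintro ⟨b, c⟩ h ⟨b', c'⟩ h'
    simp only [B, Finset.mem_filter, Finset.mem_univ, true_and] at h h'
    obtain ⟨e1, e2⟩ := D.cone_unique (q := D.pos v - d) h.1 h'.1 (by rw [f3]; linarith)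
      (by rw [f4]; linarith) (by rw [f3]; linarith) (by rw [f4]; linarith)
    rw [e1, e2]
  rw [hAB]
  constructor
  · have := Finset.card_union_le A B; omega
  · intro hv
    rcases A.eq_empty_or_nonempty with h | ⟨⟨b, c⟩, h⟩
    · rw [h]; simpa using hB
    rcases B.eq_empty_or_nonempty with h' | ⟨⟨b', c'⟩, h'⟩
    · rw [h']; simpa using hA
    exfalso
    simp only [A, B, Finset.mem_filter, Finset.mem_univ, true_and] at h h'
    have k1 := D.cone_ev (q := D.pos v + d) h.1 (by rw [f1]; linarith) (by rw [f2]; linarith)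
    have k2 := D.cone_ev (q := D.pos v - d) h'.1 (by rw [f3]; linarith) (by rw [f4]; linarith)
    obtain ⟨ε, k1, k2⟩ := (k1.and k2).exists
    apply hv
    have := hconv.interior k1 k2 (a := 1/2) (b := 1/2) (by norm_num) (by norm_num) (by norm_num)
    unfold Int
    convert this using 1
    module

/-- boundary vertices which are not extremal have a higher boundary neighbour -/
lemma bdry_higher (D : TriDisk ι) (hconv : Convex ℝ D.space)
    (hall : ∀ v : ι, ∃ t ∈ D.tris, v ∈ vset t) {v b0 c0 : ι} (hv : ¬ D.Int v) (l : ℝ × ℝ)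
    (h0 : (b0, c0) ∈ D.sc (fun u => lin l (D.pos u)) v) :
    ∃ u, D.Adj v u ∧ ¬ D.Int u ∧ lin l (D.pos v) < lin l (D.pos u) := by
  classical
  rw [mem_sc] at h0
  obtain ⟨ht0, h0⟩ := h0
  -- direction d0
  obtain ⟨d, hd0, hdn, hb, hc, hN⟩ : ∃ d : ℝ × ℝ, lin l d = 0 ∧ d ≠ 0 ∧
      0 < d3 (D.pos v) (D.pos b0) (D.pos v + d) ∧
      0 < d3 (D.pos c0) (D.pos v) (D.pos v + d) ∧
      ∃ u, D.Adj v u ∧ lin l (D.pos v) < lin l (D.pos u) := by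
    have hl : l ≠ 0 := by
      rintro rfl
      simp [lin] at h0
    rcases h0 with h0 | h0
    · refine ⟨(l.2, -l.1), by simp [lin]; ring, ?_, ?_, ?_, c0, ht0.adj2, h0.2⟩
      · intro h; apply hl
        simp [Prod.ext_iff] at h ⊢; tauto
      · have := h0.1
        simp [d3, lin] at this ⊢; linarith
      · have := h0.2
        simp [d3, lin] at this ⊢; linarith
    · refine ⟨(-l.2, l.1), by simp [lin]; ring, ?_, ?_, ?_, b0, ht0.adj1, h0.2⟩
      · intro h; apply hl
        simp [Prod.ext_iff] at h ⊢; tauto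
      · have := h0.2
        simp [d3, lin] at this ⊢; linarith
      · have := h0.1
        simp [d3, lin] at this ⊢; linarith
  have hev := D.cone_ev ht0 hb hc
  -- supporting functional
  obtain ⟨f, hf⟩ := geometric_hahn_banach_open_point hconv.interior isOpen_interior hv
  have hfK : ∀ p ∈ D.space, f p ≤ f (D.pos v) := by
    intro p hp
    have hne : (interior D.space).Nonempty := by
      obtain ⟨ε, h⟩ := hev.exists
      exact ⟨_, h⟩
    have : p ∈ closure (interior D.space) := by
      rw [hconv.closure_interior_eq_closure_of_nonempty_interior hne]
      exact subset_closure hp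
    refine closure_minimal (s := interior D.space) (t := {p | f p ≤ f (D.pos v)})
      (fun x hx => (hf x hx).le) (isClosed_le f.continuous continuous_const) this
  have hfd : f d < 0 := by
    obtain ⟨ε, h, h3⟩ := (hev.and self_mem_nhdsWithin).exists
    have h3 : (0 : ℝ) < ε := h3
    have h4 := hf _ h
    simp only [map_add, map_smul, smul_eq_mul] at h4
    by_contra hcon
    push Not at hcon
    nlinarith [mul_nonneg h3.le hcon]
  -- coordinates
  have hdd : 0 < lin d d := by
    unfold lin
    by_contra h
    apply hdn
    have h1 : d.1 = 0 := by nlinarith [sq_nonneg d.1, sq_nonneg d.2]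
    have h2 : d.2 = 0 := by nlinarith [sq_nonneg d.1, sq_nonneg d.2]
    ext <;> simp [h1, h2]
  have hl : l ≠ 0 := by
    rintro rfl
    simp [lin] at h0
  let be : ι → ℝ := fun u => lin l (D.pos u) - lin l (D.pos v)
  let al : ι → ℝ := fun u => lin d (D.pos u) - lin d (D.pos v)
  let N := Finset.univ.filter (fun u => D.Adj v u ∧ 0 < be u)
  have hNne : N.Nonempty := by
    obtain ⟨u, h1, h2⟩ := hN
    exact ⟨u, by simp [N, h1, be, h2]⟩
  obtain ⟨u, huN, hmin⟩ := N.exists_min_image (fun u => al u / be u) hNne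
  simp only [N, Finset.mem_filter, Finset.mem_univ, true_and] at huN hmin
  refine ⟨u, huN.1, ?_, by have := huN.2; simp only [be] at this; linarith⟩
  have hub := huN.2
  have hmin' : ∀ w, D.Adj v w → 0 < be w → 0 ≤ al w * be u - be w * al u := by
    intro w hw1 hw2
    have := hmin w ⟨hw1, hw2⟩
    rw [div_le_div_iff₀ hub hw2] at this
    linarith
  -- elements with be = 0 have nonnegative al
  have hzero : ∀ e : ℝ × ℝ, f e ≤ 0 → lin l e = 0 → 0 ≤ lin d e := by
    intro e he hle
    have e1 : lin d d • e = lin d e • d := by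
      have hd0' : l.1 * d.1 + l.2 * d.2 = 0 := hd0
      have hle' : l.1 * e.1 + l.2 * e.2 = 0 := hle
      have hx : d.1 * e.2 - d.2 * e.1 = 0 := by
        by_contra hne
        apply hl
        have a1 : l.1 * (d.1 * e.2 - d.2 * e.1) = 0 := by
          linear_combination e.2 * hd0' - d.2 * hle'
        have a2 : l.2 * (d.1 * e.2 - d.2 * e.1) = 0 := by
          linear_combination - e.1 * hd0' + d.1 * hle'
        ext
        · exact (mul_eq_zero.1 a1).resolve_right hne
        · exact (mul_eq_zero.1 a2).resolve_right hne
      ext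
      · simp only [lin, Prod.smul_fst, smul_eq_mul]
        linear_combination - d.2 * hx
      · simp only [lin, Prod.smul_snd, smul_eq_mul]
        linear_combination d.1 * hx
    have e2 := congrArg f e1
    simp only [map_smul, smul_eq_mul] at e2
    by_contra hcon
    push Not at hcon
    nlinarith [mul_pos_of_neg_of_neg hcon hfd, mul_nonneg hdd.le (neg_nonneg.2 he)]
  have hmixed : ∀ b c, D.Adj v b → D.Adj v c → 0 < be b → be c ≤ 0 → ∀ s t : ℝ, 0 ≤ s → 0 ≤ t →
      0 < s * be b + t * be c → 0 ≤ (s * al b + t * al c) * be u - (s * be b + t * be c) * al u := by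
    intro b c hb hc hbb hbc s t hs ht hst
    have hfb : f (D.pos b - D.pos v) ≤ 0 := by
      rw [map_sub]; linarith [hfK _ (D.pos_mem hall b)]
    have hfc : f (D.pos c - D.pos v) ≤ 0 := by
      rw [map_sub]; linarith [hfK _ (D.pos_mem hall c)]
    have hst' := hzero (be b • (D.pos c - D.pos v) + (- be c) • (D.pos b - D.pos v)) (by
      simp only [map_add, map_smul, smul_eq_mul]
      nlinarith [mul_nonneg hbb.le (neg_nonneg.2 hfc), mul_nonneg (neg_nonneg.2 hbc) (neg_nonneg.2 hfb)])
      (by simp [lin, be]; ring)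
    have e1 : lin d (be b • (D.pos c - D.pos v) + (- be c) • (D.pos b - D.pos v)) =
       be b * al c - be c * al b := by
      simp [lin, al]; ring
    rw [e1] at hst'
    have hm := hmin' b hb hbb
    have : be b * ((s * al b + t * al c) * be u - (s * be b + t * be c) * al u) =
      (s * be b + t * be c) * (al b * be u - be b * al u) + t * be u * (be b * al c - be c * al b) := by
      ring
    have hpos : 0 ≤ be b * ((s * al b + t * al c) * be u - (s * be b + t * be c) * al u) := by
      rw [this]
      have := mul_nonneg hst.le hm
      have := mul_nonneg (mul_nonneg ht hub.le) hst'
      linarith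
    exact nonneg_of_mul_nonneg_right hpos hbb
  -- the main claim
  have hK : ∀ p ∈ D.space, 0 < lin l p - lin l (D.pos v) →
      0 ≤ (lin d p - lin d (D.pos v)) * be u - (lin l p - lin l (D.pos v)) * al u := by
    intro p hp hpl
    have hf : Tendsto (fun ε : ℝ => (1 - ε) • D.pos v + ε • p) (𝓝[>] 0) (𝓝 (D.pos v)) := by
      have : Continuous (fun ε : ℝ => (1 - ε) • D.pos v + ε • p) := by fun_prop
      have h2 := this.tendsto 0
      simp only [sub_zero, one_smul, zero_smul, add_zero] at h2
      exact h2.mono_left nhdsWithin_le_nhds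
    obtain ⟨ε, h1, hε0, hε1⟩ := ((hf.eventually (D.near_vertex hall v)).and
      (Ioo_mem_nhdsGT (zero_lt_one (α := ℝ)))).exists
    have hxs : (1 - ε) • D.pos v + ε • p ∈ D.space :=
      hconv (D.pos_mem hall v) hp (by linarith) hε0.le (by ring)
    obtain ⟨b, c, ht, hT⟩ := h1 hxs
    have e := bary_eq ht.2.ne' ((1 - ε) • D.pos v + ε • p)
    have es := bary_sum ht.2.ne' ((1 - ε) • D.pos v + ε • p)
    have hs := div_nonneg hT.2.2 ht.2.le
    have htt := div_nonneg hT.1 ht.2.le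
    set s := d3 (D.pos c) (D.pos v) ((1 - ε) • D.pos v + ε • p) /
      d3 (D.pos v) (D.pos b) (D.pos c)
    set t := d3 (D.pos v) (D.pos b) ((1 - ε) • D.pos v + ε • p) /
      d3 (D.pos v) (D.pos b) (D.pos c)
    set w := d3 (D.pos b) (D.pos c) ((1 - ε) • D.pos v + ε • p) /
      d3 (D.pos v) (D.pos b) (D.pos c)
    have hw : w = 1 - s - t := by linarith
    have lind : ∀ m : ℝ × ℝ, ε * (lin m p - lin m (D.pos v)) =
        s * (lin m (D.pos b) - lin m (D.pos v)) + t * (lin m (D.pos c) - lin m (D.pos v)) := by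
      intro m
      have := congrArg (lin m) e
      rw [lin_comb, hw] at this
      have e5 : lin m ((1 - ε) • D.pos v + ε • p) = (1 - ε) * lin m (D.pos v) + ε * lin m p := by
        simp [lin]; ring
      rw [e5] at this
      linarith
    have Lb := lind l
    have La := lind d
    change _ = s * be b + t * be c at Lb
    change _ = s * al b + t * al c at La
    have hbpos : 0 < s * be b + t * be c := by rw [← Lb]; positivity
    suffices h : 0 ≤ (s * al b + t * al c) * be u - (s * be b + t * be c) * al u by
      rw [← Lb, ← La] at h
      have : 0 ≤ ε * ((lin d p - lin d (D.pos v)) * be u - (lin l p - lin l (D.pos v)) * al u) := by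
        linarith
      exact nonneg_of_mul_nonneg_right this hε0
    by_cases hbb : 0 < be b
    · by_cases hbc : 0 < be c
      · have h1 := mul_nonneg hs (hmin' b ht.adj1 hbb)
        have h2 := mul_nonneg htt (hmin' c ht.adj2 hbc)
        linarith
      · exact hmixed b c ht.adj1 ht.adj2 hbb (not_lt.1 hbc) s t hs htt hbpos
    · by_cases hbc : 0 < be c
      · have := hmixed c b ht.adj2 ht.adj1 hbc (not_lt.1 hbb) t s htt hs (by linarith)
        linarith
      · exfalso
        nlinarith [mul_nonneg hs (neg_nonneg.2 (not_lt.1 hbb)), mul_nonneg htt (neg_nonneg.2 (not_lt.1 hbc))]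
  -- conclusion
  intro hInt
  have hf : Tendsto (fun ε : ℝ => D.pos u - ε • d) (𝓝[>] 0) (𝓝 (D.pos u)) := by
    have : Continuous (fun ε : ℝ => D.pos u - ε • d) := by fun_prop
    have h2 := this.tendsto 0
    simp only [zero_smul, sub_zero] at h2
    exact h2.mono_left nhdsWithin_le_nhds
  have hin : ∀ᶠ p in 𝓝 (D.pos u), p ∈ D.space := mem_interior_iff_mem_nhds.1 hInt
  obtain ⟨ε, h1, h3⟩ := ((hf.eventually hin).and self_mem_nhdsWithin).exists
  have h3 : (0 : ℝ) < ε := h3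
  have e1 : lin l (D.pos u - ε • d) = lin l (D.pos u) := by
    have : lin l (D.pos u - ε • d) = lin l (D.pos u) - ε * lin l d := by simp [lin]; ring
    rw [this, hd0]; ring
  have e2 : lin d (D.pos u - ε • d) = lin d (D.pos u) - ε * lin d d := by simp [lin]; ring
  have := hK _ h1 (by rw [e1]; exact hub)
  rw [e1, e2] at this
  have hp := mul_pos (mul_pos h3 hdd) hub
  simp only [be, al] at this hp
  nlinarith

end TriDisk

end

section
open Filter Topology

lemma ev_pos {A : ℝ} (B : ℝ) (hA : 0 < A) : ∀ᶠ ε : ℝ in 𝓝[>] 0, 0 < A + ε * B := by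
  refine Filter.Eventually.filter_mono nhdsWithin_le_nhds ?_
  refine (isOpen_lt continuous_const (by fun_prop)).mem_nhds ?_
  show 0 < A + 0 * B
  simpa using hA

lemma ev_ne (A : ℝ) {B : ℝ} (hB : B ≠ 0) : ∀ᶠ ε : ℝ in 𝓝[>] 0, A + ε * B ≠ 0 := by
  rcases lt_trichotomy A 0 with h | h | h
  · filter_upwards [ev_pos (-B) (neg_pos.2 h)] with ε he
    intro h; linarith
  · filter_upwards [self_mem_nhdsWithin] with ε he
    rw [h, zero_add]; exact mul_ne_zero (ne_of_gt he) hB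
  · filter_upwards [ev_pos B h] with ε he
    exact he.ne'

namespace TriDisk

variable {ι : Type} [Fintype ι] [DecidableEq ι]

lemma count_le (D : TriDisk ι) (hconv : Convex ℝ D.space)
    (hall : ∀ v : ι, ∃ t ∈ D.tris, v ∈ vset t) (r : ι → ℝ) (l : ℝ × ℝ)
    (hb : ∀ v, ¬ D.Int v → r v = lin l (D.pos v))
    (hr : ∀ a b, D.Adj a b → r a ≠ r b)
    (hr0 : ∀ a b, D.Adj a b → lin l (D.pos a) ≠ lin l (D.pos b))
    (hi : ∀ v, D.Int v → (∃ u, D.Adj v u ∧ r v < r u) ∧ ∃ u, D.Adj v u ∧ r u < r v) (v : ι) :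
    (D.sc r v).card ≤ 2 := by
  classical
  have key : ∀ v ∈ (Finset.univ : Finset ι),
      (D.sc (fun u => lin l (D.pos u)) v).card ≤ (D.sc r v).card := by
    intro v _
    by_cases hv : D.Int v
    · refine (D.ref_le hconv l v).1.trans ?_
      obtain ⟨⟨u, hu1, hu2⟩, w, hw1, hw2⟩ := hi v hv
      obtain ⟨⟨b, c, k1, k2, k3⟩, b', c', k1', k2', k3'⟩ :=
        D.both_types hconv hall hv (fun x => r v < r x) hu1 hw1 hu2 (not_lt.2 hw2.le)
      have m1 : (b, c) ∈ D.sc r v := (D.mem_sc _ _ _ _).2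
        ⟨k1, Or.inr ⟨lt_of_le_of_ne (not_lt.1 k3) (hr _ _ k1.adj2).symm, k2⟩⟩
      have m2 : (b', c') ∈ D.sc r v := (D.mem_sc _ _ _ _).2
        ⟨k1', Or.inl ⟨lt_of_le_of_ne (not_lt.1 k2') (hr _ _ k1'.adj1).symm, k3'⟩⟩
      refine Finset.one_lt_card.2 ⟨_, m1, _, m2, ?_⟩
      intro h
      rw [Prod.mk.injEq] at h
      rw [h.1] at k2
      exact k2' k2
    · rcases (D.sc (fun u => lin l (D.pos u)) v).eq_empty_or_nonempty with h | ⟨⟨b0, c0⟩, h⟩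
      · rw [h]; simp
      refine ((D.ref_le hconv l v).2 hv).trans ?_
      obtain ⟨u, hu1, hu2, hu3⟩ := D.bdry_higher hconv hall hv l h
      have h' : (b0, c0) ∈ D.sc (fun u => lin (-l) (D.pos u)) v := by
        rw [mem_sc] at h ⊢
        have e : ∀ p, lin (-l) p = - lin l p := by intro p; simp [lin]; ring
        simp only [e, neg_lt_neg_iff]
        exact ⟨h.1, by tauto⟩
      obtain ⟨w, hw1, hw2, hw3⟩ := D.bdry_higher hconv hall hv (-l) h'
      have e : ∀ p, lin (-l) p = - lin l p := by intro p; simp [lin]; ring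
      rw [e, e, neg_lt_neg_iff, ← hb _ hw2, ← hb _ hv] at hw3
      rw [← hb _ hu2, ← hb _ hv] at hu3
      obtain ⟨b, c, k1, k2⟩ := D.link_conn hconv hall v (fun x => r v < r x) hu1 hw1 hu3
        (not_lt.2 hw3.le)
      refine Finset.card_pos.2 ⟨(b, c), (D.mem_sc _ _ _ _).2 ⟨k1, ?_⟩⟩
      have n1 := hr _ _ k1.adj1
      have n2 := hr _ _ k1.adj2
      rcases lt_or_gt_of_ne n1 with n1 | n1 <;> rcases lt_or_gt_of_ne n2 with n2 | n2
      · exact absurd (by simp [n1, n2]) k2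
      · exact Or.inr ⟨n2, n1⟩
      · exact Or.inl ⟨n1, n2⟩
      · exact absurd (by simp [n1.not_gt, n2.not_gt]) k2
  have hs : ∑ v, (D.sc (fun u => lin l (D.pos u)) v).card = ∑ v, (D.sc r v).card := by
    have h1 := D.sum_sc r hr
    have h2 := D.sum_sc (fun u => lin l (D.pos u)) hr0
    omega
  have := (Finset.sum_eq_sum_iff_of_le key).1 hs v (Finset.mem_univ v)
  rw [← this]
  exact (D.ref_le hconv l v).1

lemma exists_kappa (D : TriDisk ι) {a u0 u1 : ι} (h : d3 (D.pos a) (D.pos u0) (D.pos u1) ≠ 0)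
    {σ : ℝ} (hσ : σ ≠ 0) : ∃ κ : ℝ × ℝ, σ * (lin κ (D.pos u0) - lin κ (D.pos a)) < 0 ∧
      0 < σ * (lin κ (D.pos u1) - lin κ (D.pos a)) ∧
      ∀ x y, x ≠ y → lin κ (D.pos x) ≠ lin κ (D.pos y) := by
  have hd : Dense (⋂ i : {x : ι × ι // x.1 ≠ x.2}, {κ : ℝ × ℝ |
      (D.pos i.1.1 - D.pos i.1.2).1 * κ.1 + (D.pos i.1.1 - D.pos i.1.2).2 * κ.2 + 0 ≠ 0}) := by
    refine dense_finite _ ?_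
    rintro ⟨⟨x, y⟩, hxy⟩
    refine dense_affine ?_
    by_contra hcon
    push Not at hcon
    apply hxy
    apply D.inj
    exact sub_eq_zero.1 (Prod.ext (y := (0 : ℝ × ℝ)) hcon.1 hcon.2)
  have ho : IsOpen {κ : ℝ × ℝ | σ * (lin κ (D.pos u0) - lin κ (D.pos a)) < 0 ∧
      0 < σ * (lin κ (D.pos u1) - lin κ (D.pos a))} := by
    have c1 : ∀ u, Continuous fun κ : ℝ × ℝ => σ * (lin κ (D.pos u) - lin κ (D.pos a)) := by
      intro u; fun_prop
    exact (isOpen_lt (c1 u0) continuous_const).inter (isOpen_lt continuous_const (c1 u1))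
  have hne : {κ : ℝ × ℝ | σ * (lin κ (D.pos u0) - lin κ (D.pos a)) < 0 ∧
      0 < σ * (lin κ (D.pos u1) - lin κ (D.pos a))}.Nonempty := by
    set δ := d3 (D.pos a) (D.pos u0) (D.pos u1) with hδ
    let e0 := D.pos u0 - D.pos a
    let e1 := D.pos u1 - D.pos a
    let κ : ℝ × ℝ := ((- σ * e1.2 - σ * e0.2) / δ, (σ * e1.1 + σ * e0.1) / δ)
    have E : δ = e0.1 * e1.2 - e0.2 * e1.1 := by simp [hδ, d3, e0, e1]
    have k0 : lin κ (D.pos u0) - lin κ (D.pos a) = - σ := by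
      have : lin κ (D.pos u0) - lin κ (D.pos a) = κ.1 * e0.1 + κ.2 * e0.2 := by
        simp [lin, e0]; ring
      rw [this]; simp only [κ]; field_simp; rw [E]; ring
    have k1 : lin κ (D.pos u1) - lin κ (D.pos a) = σ := by
      have : lin κ (D.pos u1) - lin κ (D.pos a) = κ.1 * e1.1 + κ.2 * e1.2 := by
        simp [lin, e1]; ring
      rw [this]; simp only [κ]; field_simp; rw [E]; ring
    have := mul_self_pos.2 hσ
    refine ⟨κ, ?_, ?_⟩
    · rw [k0]; linarith
    · rw [k1]; exact this
  obtain ⟨κ, h1, h2⟩ := hd.exists_mem_open ho hne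
  refine ⟨κ, h2.1, h2.2, ?_⟩
  intro x y hxy he
  have := Set.mem_iInter.1 h1 ⟨(x, y), hxy⟩
  apply this
  simp [lin] at he ⊢
  linarith

lemma lemC (D : TriDisk ι) (hconv : Convex ℝ D.space)
    (hall : ∀ v : ι, ∃ t ∈ D.tris, v ∈ vset t) (h : ι → ℝ) (θ : ℝ × ℝ)
    (hb : ∀ v, ¬ D.Int v → h v = lin θ (D.pos v))
    (hfl : ∀ v, D.Int v → (∀ u, D.Adj v u → h u = h v) ∨
      ((∃ u, D.Adj v u ∧ h v < h u) ∧ ∃ u, D.Adj v u ∧ h u < h v)) {a b c : ι}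
    (ha : D.Int a) (hup : ∃ u, D.Adj a u ∧ h a < h u) (hdn : ∃ u, D.Adj a u ∧ h u < h a)
    (ht : D.Tr a b c) (hab : h b = h a) (hac : h c = h a) : False := by
  classical
  obtain ⟨u0, u1, p, e1, e2, l0, l1, lp, hadj, he1, he2, t1, t2, hun⟩ : ∃ u0 u1 p : ι,
      ∃ e1 e2 : ι × ι, h u0 = h a ∧ h u1 = h a ∧ h p ≠ h a ∧ D.Adj a p ∧
      (e1 = (u1, u0) ∨ e1 = (u0, u1)) ∧ (e2 = (p, u0) ∨ e2 = (u0, p)) ∧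
      D.Tr a e1.1 e1.2 ∧ D.Tr a e2.1 e2.2 ∧
      ∀ b c, D.Tr a b c → (b = u0 ∨ c = u0) → ((b, c) = e1 ∨ (b, c) = e2) := by
    obtain ⟨n, hn1, hn2⟩ := hup
    obtain ⟨x, y, k1, k2⟩ := D.link_conn hconv hall a
      (fun u => h u = h a ∧ ∃ w, (D.Tr a u w ∨ D.Tr a w u) ∧ h w = h a) ht.adj1 hn1
      ⟨hab, c, Or.inl ht, hac⟩ (fun h => hn2.ne' h.1)
    rw [not_iff] at k2
    by_cases hx : h x = h a ∧ ∃ w, (D.Tr a x w ∨ D.Tr a w x) ∧ h w = h a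
    · have hy : ¬ h y = h a := by
        intro hy
        exact k2.2 ⟨hy, x, Or.inr k1, hx.1⟩ hx
      obtain ⟨hx1, w, hw | hw, hx2⟩ := hx
      · exact absurd (D.third_unique hw k1 ▸ hx2) hy
      refine ⟨x, w, y, (w, x), (x, y), hx1, hx2, hy, k1.adj2, Or.inl rfl, Or.inr rfl, hw, k1, ?_⟩
      rintro b c hbc (rfl | rfl)
      · exact Or.inr (by rw [D.third_unique hbc k1])
      · exact Or.inl (by rw [D.pred_unique hbc hw])
    · have hy' := k2.1 hx
      have hx' : ¬ h x = h a := fun hh => hx ⟨hh, y, Or.inl k1, hy'.1⟩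
      obtain ⟨hx1, w, hw | hw, hx2⟩ := hy'
      · refine ⟨y, w, x, (y, w), (x, y), hx1, hx2, hx', k1.adj1, Or.inr rfl, Or.inl rfl, hw, k1, ?_⟩
        rintro b c hbc (rfl | rfl)
        · exact Or.inl (by rw [D.third_unique hbc hw])
        · exact Or.inr (by rw [D.pred_unique hbc k1])
      · exact absurd (D.pred_unique hw k1 ▸ hx2) hx'
  have hσ : h p - h a ≠ 0 := sub_ne_zero.2 lp
  set σ := h p - h a with hσd
  have hd3 : d3 (D.pos a) (D.pos u0) (D.pos u1) ≠ 0 := by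
    rcases he1 with rfl | rfl
    · have h1 := t1.2
      simp only at h1
      rw [← d3_rot, d3_swap, d3_rot] at h1
      intro h2; rw [h2] at h1; simp at h1
    · exact t1.2.ne'
  obtain ⟨κ, s0, s1, sg⟩ := D.exists_kappa hd3 hσ
  have hκ : κ ≠ 0 := by
    rintro rfl
    simp [lin] at s0
  let r : ℝ → ι → ℝ := fun ε v => h v + ε * lin κ (D.pos v)
  have E1 : ∀ᶠ ε in 𝓝[>] (0:ℝ), ∀ x y, x ≠ y → r ε x ≠ r ε y := by
    rw [eventually_all]; intro x; rw [eventually_all]; intro y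
    by_cases hxy : x = y
    · simp [hxy]
    filter_upwards [ev_ne (h x - h y) (sub_ne_zero.2 (sg x y hxy))] with ε he _ h2
    apply he; simp only [r] at h2; linarith
  have E2 : ∀ᶠ ε in 𝓝[>] (0:ℝ), ∀ x y, x ≠ y →
      lin (θ + ε • κ) (D.pos x) ≠ lin (θ + ε • κ) (D.pos y) := by
    rw [eventually_all]; intro x; rw [eventually_all]; intro y
    by_cases hxy : x = y
    · simp [hxy]
    filter_upwards [ev_ne (lin θ (D.pos x) - lin θ (D.pos y)) (sub_ne_zero.2 (sg x y hxy))]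
      with ε he _ h2
    apply he; simp [lin] at h2 ⊢; linarith
  have E3 : ∀ᶠ ε in 𝓝[>] (0:ℝ), ∀ x y, h x < h y → r ε x < r ε y := by
    rw [eventually_all]; intro x; rw [eventually_all]; intro y
    by_cases hxy : h x < h y
    · filter_upwards [ev_pos (lin κ (D.pos y) - lin κ (D.pos x)) (sub_pos.2 hxy)] with ε he _
      simp only [r]; linarith
    · simp [hxy]
  obtain ⟨ε, E1, E2, E3, hε⟩ := (E1.and (E2.and (E3.and self_mem_nhdsWithin))).exists
  have hε : (0 : ℝ) < ε := hε
  have hcount := D.count_le hconv hall (r ε) (θ + ε • κ)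
    (by intro v hv; simp only [r]; rw [hb v hv]; simp [lin]; ring)
    (fun a b hab => E1 _ _ hab.ne) (fun a b hab => E2 _ _ hab.ne)
    (by
      intro v hv
      rcases hfl v hv with hf | ⟨⟨u, hu1, hu2⟩, w, hw1, hw2⟩
      · obtain ⟨u, hu1, hu2⟩ := D.exists_higher hall hv hκ
        obtain ⟨w, hw1, hw2⟩ := D.exists_lower hall hv hκ
        refine ⟨⟨u, hu1, ?_⟩, w, hw1, ?_⟩
        · simp only [r, hf u hu1]
          have := mul_lt_mul_of_pos_left hu2 hε; linarith
        · simp only [r, hf w hw1]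
          have := mul_lt_mul_of_pos_left hw2 hε; linarith
      · exact ⟨⟨u, hu1, E3 _ _ hu2⟩, w, hw1, E3 _ _ hw2⟩) a
  -- signs
  have S0 : σ * (r ε u0 - r ε a) < 0 := by
    simp only [r, l0]
    have := mul_neg_of_pos_of_neg hε s0; linarith
  have S1 : 0 < σ * (r ε u1 - r ε a) := by
    simp only [r, l1]
    have := mul_pos hε s1; linarith
  have S : ∀ n, 0 < σ * (h n - h a) → 0 < σ * (r ε n - r ε a) := by
    intro n hn
    rcases lt_or_gt_of_ne hσ with hs | hs
    · exact mul_pos_of_neg_of_neg hs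
        (sub_neg.2 (E3 _ _ (sub_neg.1 (lt_of_not_ge (fun h2 => by nlinarith)))))
    · exact mul_pos hs (sub_pos.2 (E3 _ _ (sub_pos.1 (lt_of_not_ge fun h2 => by nlinarith))))
  have S' : ∀ n, σ * (h n - h a) < 0 → σ * (r ε n - r ε a) < 0 := by
    intro n hn
    rcases lt_or_gt_of_ne hσ with hs | hs
    · exact mul_neg_of_neg_of_pos hs
        (sub_pos.2 (E3 _ _ (sub_pos.1 (lt_of_not_ge fun h2 => by nlinarith))))
    · exact mul_neg_of_pos_of_neg hs (sub_neg.2 (E3 _ _ (sub_neg.1 (lt_of_not_ge fun h2 => by nlinarith))))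
  have Sp : 0 < σ * (r ε p - r ε a) := S p (by rw [← hσd]; exact mul_self_pos.2 hσ)
  obtain ⟨n, hn1, hn2⟩ : ∃ n, D.Adj a n ∧ σ * (h n - h a) < 0 := by
    rcases lt_or_gt_of_ne hσ with hs | hs
    · obtain ⟨n, h1, h2⟩ := hup
      exact ⟨n, h1, mul_neg_of_neg_of_pos hs (sub_pos.2 h2)⟩
    · obtain ⟨n, h1, h2⟩ := hdn
      exact ⟨n, h1, mul_neg_of_pos_of_neg hs (sub_neg.2 h2)⟩
  have hnu : n ≠ u0 := by rintro rfl; rw [l0] at hn2; simp at hn2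
  obtain ⟨x, y, k1, k2⟩ := D.link_conn hconv hall a
    (fun x => x = u0 ∨ 0 < σ * (r ε x - r ε a)) hadj hn1 (Or.inr Sp)
    (by rintro (h1 | h1)
        · exact hnu h1
        · exact lt_asymm h1 (S' n hn2))
  have msc : ∀ b c, D.Tr a b c → σ * (r ε b - r ε a) < 0 → 0 < σ * (r ε c - r ε a) →
      (D.Tr a b c ∧ ((r ε b < r ε a ∧ r ε a < r ε c) ∨ (r ε c < r ε a ∧ r ε a < r ε b))) := by
    intro b c t hb hc
    refine ⟨t, ?_⟩
    rcases lt_or_gt_of_ne hσ with hs | hs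
    · right; constructor <;> (by_contra hh; nlinarith)
    · left; constructor <;> (by_contra hh; nlinarith)
  have msc1 : ∀ b c, D.Tr a b c → σ * (r ε b - r ε a) < 0 → 0 < σ * (r ε c - r ε a) →
      (b, c) ∈ D.sc (r ε) a := fun b c t hb hc => (D.mem_sc _ _ _ _).2 (msc b c t hb hc)
  have msc2 : ∀ b c, D.Tr a b c → σ * (r ε c - r ε a) < 0 → 0 < σ * (r ε b - r ε a) →
      (b, c) ∈ D.sc (r ε) a := by
    intro b c t hb hc
    rw [mem_sc]
    refine ⟨t, ?_⟩
    rcases lt_or_gt_of_ne hσ with hs | hs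
    · left; constructor <;> (by_contra hh; nlinarith)
    · right; constructor <;> (by_contra hh; nlinarith)
  have M1 : e1 ∈ D.sc (r ε) a := by
    rcases he1 with rfl | rfl
    · exact msc2 _ _ t1 S0 S1
    · exact msc1 _ _ t1 S0 S1
  have M2 : e2 ∈ D.sc (r ε) a := by
    rcases he2 with rfl | rfl
    · exact msc2 _ _ t2 S0 Sp
    · exact msc1 _ _ t2 S0 Sp
  have hup1 : u1 ≠ p := by rintro rfl; exact lp l1
  have hu0p : u0 ≠ p := by rintro rfl; exact lp l0
  have hu01 : u0 ≠ u1 := by rintro rfl; linarith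
  have hxy : x ≠ u0 ∧ y ≠ u0 := by
    rw [← not_or]
    intro hh
    apply k2
    rcases hun x y k1 hh with hh | hh
    · rcases he1 with rfl | rfl <;> (rw [Prod.mk.injEq] at hh; obtain ⟨rfl, rfl⟩ := hh; simp [S1])
    · rcases he2 with rfl | rfl <;> (rw [Prod.mk.injEq] at hh; obtain ⟨rfl, rfl⟩ := hh; simp [Sp])
  have M3 : (x, y) ∈ D.sc (r ε) a := by
    have n1 : σ * (r ε x - r ε a) ≠ 0 :=
      mul_ne_zero hσ (sub_ne_zero.2 (E1 _ _ k1.adj1.ne.symm))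
    have n2 : σ * (r ε y - r ε a) ≠ 0 :=
      mul_ne_zero hσ (sub_ne_zero.2 (E1 _ _ k1.adj2.ne.symm))
    simp only [hxy.1, hxy.2, false_or] at k2
    rcases lt_or_gt_of_ne n1 with n1 | n1 <;> rcases lt_or_gt_of_ne n2 with n2 | n2
    · exact absurd (by simp [n1.not_gt, n2.not_gt]) k2
    · exact msc1 _ _ k1 n1 n2
    · exact msc2 _ _ k1 n2 n1
    · exact absurd (by simp [n1, n2]) k2
  have : 2 < (D.sc (r ε) a).card := by
    refine Finset.two_lt_card.2 ⟨e1, M1, e2, M2, (x, y), M3, ?_, ?_, ?_⟩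
    · rcases he1 with rfl | rfl <;> rcases he2 with rfl | rfl <;> simp [hup1, hu0p, hu01, hup1.symm, hu0p.symm, hu01.symm]
    · rcases he1 with rfl | rfl <;> simp [hxy.1.symm, hxy.2.symm]
    · rcases he2 with rfl | rfl <;> simp [hxy.1.symm, hxy.2.symm]
  omega

theorem thmN (D : TriDisk ι) (hconv : Convex ℝ D.space)
    (hall : ∀ v : ι, ∃ t ∈ D.tris, v ∈ vset t) (h : ι → ℝ) (θ : ℝ × ℝ) (hθ : θ ≠ 0)
    (hb : ∀ v, ¬ D.Int v → h v = lin θ (D.pos v))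
    (hfl : ∀ v, D.Int v → (∀ u, D.Adj v u → h u = h v) ∨
      ((∃ u, D.Adj v u ∧ h v < h u) ∧ ∃ u, D.Adj v u ∧ h u < h v)) :
    (∀ v, D.Int v → (∃ u, D.Adj v u ∧ h v < h u) ∧ ∃ u, D.Adj v u ∧ h u < h v) ∧
    (∀ a b c, D.Tr a b c → ¬ (h b = h a ∧ h c = h a)) := by
  classical
  have N1 : ∀ v, D.Int v → (∃ u, D.Adj v u ∧ h v < h u) ∧ ∃ u, D.Adj v u ∧ h u < h v := by
    by_contra hcon
    push Not at hcon
    obtain ⟨v0, hv0, hv0'⟩ := hcon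
    let A := Finset.univ.filter (fun v => D.Int v ∧ ∀ u, D.Adj v u → h u = h v)
    have hA : A.Nonempty := by
      refine ⟨v0, ?_⟩
      simp only [A, Finset.mem_filter, Finset.mem_univ, true_and]
      refine ⟨hv0, (hfl v0 hv0).resolve_right ?_⟩
      rintro ⟨⟨u, h1⟩, w, h2⟩
      exact (hv0' ⟨u, h1⟩ w h2.1).not_gt h2.2
    have hnb : ∀ v ∈ A, ∀ u, D.Adj v u → u ∉ A → ¬ D.Int u := by
      intro v hv u hu huA huI
      simp only [A, Finset.mem_filter, Finset.mem_univ, true_and] at hv huA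
      have hnf := (hfl u huI).resolve_left (fun hh => huA ⟨huI, hh⟩)
      obtain ⟨c, hc⟩ := hu.succ hconv hall hv.1
      exact D.lemC hconv hall h θ hb hfl huI hnf.1 hnf.2 hc.rot
        (by rw [hv.2 c hc.adj2, hv.2 u hu]) (by rw [hv.2 u hu])
    obtain ⟨v1, hv1, hmax⟩ := A.exists_max_image (fun v => lin θ (D.pos v) - h v) hA
    obtain ⟨v2, hv2, hmin⟩ := A.exists_min_image (fun v => lin θ (D.pos v) - h v) hA
    have hv1' := hv1
    have hv2' := hv2
    simp only [A, Finset.mem_filter, Finset.mem_univ, true_and] at hv1' hv2'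
    obtain ⟨u, hu1, hu2⟩ := D.exists_higher hall hv1'.1 hθ
    obtain ⟨w, hw1, hw2⟩ := D.exists_lower hall hv2'.1 hθ
    have e1 := hv1'.2 u hu1
    have e2 := hv2'.2 w hw1
    have huA : u ∉ A := fun hh => by have := hmax u hh; linarith
    have hwA : w ∉ A := fun hh => by have := hmin w hh; linarith
    have b1 := hb u (hnb v1 hv1 u hu1 huA)
    have b2 := hb w (hnb v2 hv2 w hw1 hwA)
    have := hmax v2 hv2
    linarith
  refine ⟨N1, ?_⟩
  rintro a b c ht ⟨h1, h2⟩
  by_cases ha : D.Int a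
  · exact D.lemC hconv hall h θ hb hfl ha (N1 a ha).1 (N1 a ha).2 ht h1 h2
  by_cases hb' : D.Int b
  · exact D.lemC hconv hall h θ hb hfl hb' (N1 b hb').1 (N1 b hb').2 ht.rot
      (by rw [h1, h2]) (by rw [h1])
  by_cases hc : D.Int c
  · exact D.lemC hconv hall h θ hb hfl hc (N1 c hc).1 (N1 c hc).2 ht.rot.rot
      (by rw [h2]) (by rw [h1, h2])
  rw [hb a ha, hb b hb'] at h1
  rw [hb a ha, hb c hc] at h2
  have h3 := ht.2
  simp only [lin, d3] at h1 h2 h3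
  have hδ := h3.ne'
  apply hθ
  ext
  · have : θ.1 * d3 (D.pos a) (D.pos b) (D.pos c) = 0 := by
      simp only [d3]
      linear_combination ((D.pos c).2 - (D.pos a).2) * h1 - ((D.pos b).2 - (D.pos a).2) * h2
    exact (mul_eq_zero.1 this).resolve_right hδ
  · have : θ.2 * d3 (D.pos a) (D.pos b) (D.pos c) = 0 := by
      simp only [d3]
      linear_combination (-(D.pos c).1 + (D.pos a).1) * h1 + ((D.pos b).1 - (D.pos a).1) * h2
    exact (mul_eq_zero.1 this).resolve_right hδ

end TriDisk

end

section
open Filter Topology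

lemma cont_of_graph {A K : Type*} [TopologicalSpace A] [TopologicalSpace K] [CompactSpace K]
    (f : A → K) (hf : IsClosed {p : A × K | p.2 = f p.1}) : Continuous f := by
  rw [continuous_iff_isClosed]
  intro C hC
  have h1 : IsClosed ({p : A × K | p.2 = f p.1} ∩ Prod.snd ⁻¹' C) :=
    hf.inter (hC.preimage continuous_snd)
  have h2 := isClosedMap_fst_of_compactSpace _ h1
  convert h2 using 1
  ext a
  simp

namespace TriDisk

variable {ι : Type} [Fintype ι] [DecidableEq ι]

open Classical in
/-- neighbours -/
noncomputable def Nb (D : TriDisk ι) (v : ι) : Finset ι := Finset.univ.filter (D.Adj v)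

lemma mem_Nb (D : TriDisk ι) {v j : ι} : j ∈ D.Nb v ↔ D.Adj v j := by simp [Nb]

/-- type of interior vertices -/
abbrev I (D : TriDisk ι) := {v : ι // D.Int v}

open Classical in
/-- extension by boundary values -/
noncomputable def ext {α : Type*} (D : TriDisk ι) (g : ι → α) (x : D.I → α) (v : ι) : α :=
  if h : D.Int v then x ⟨v, h⟩ else g v

lemma ext_int {α : Type*} (D : TriDisk ι) (g : ι → α) (x : D.I → α) (v : D.I) :
    D.ext g x v = x v := by simp [ext, v.2]

lemma ext_bdry {α : Type*} (D : TriDisk ι) (g : ι → α) (x : D.I → α) {v : ι} (h : ¬ D.Int v) :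
    D.ext g x v = g v := by simp [ext, h]

lemma ext_int' {α : Type*} (D : TriDisk ι) (g : ι → α) (x : D.I → α) {v : ι} (h : D.Int v) :
    D.ext g x v = x ⟨v, h⟩ := by simp [ext, h]

@[fun_prop]
lemma continuous_ext {α X : Type*} [TopologicalSpace α] [TopologicalSpace X] (D : TriDisk ι)
    (g : ι → α) (v : ι) {f : X → D.I → α} (hf : Continuous f) :
    Continuous fun a => D.ext g (f a) v := by
  by_cases h : D.Int v
  · simp only [D.ext_int' _ _ h]; fun_prop
  · simp only [D.ext_bdry _ _ h]; fun_prop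

lemma H_exists (D : TriDisk ι) (Φ : ι → ι → ℝ → ℝ) (hc : ∀ v j, Continuous (Φ v j))
    (hm : ∀ v j, StrictMono (Φ v j)) (h0 : ∀ v j, Φ v j 0 = 0) (g : ι → ℝ) (m M : ℝ)
    (hmM : m ≤ M) (hg1 : ∀ v, m ≤ g v) (hg2 : ∀ v, g v ≤ M) :
    ∃ x ∈ Set.Icc (fun _ => m) (fun _ : D.I => M), ∀ v : D.I, ∑ j ∈ D.Nb v, Φ v j (D.ext g x j - D.ext g x v) = 0 := by
  classical
  let F : (D.I → ℝ) → D.I → ℝ := fun x v => ∑ j ∈ D.Nb v, Φ v j (D.ext g x j - D.ext g x v)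
  have hF : ∀ v, Continuous fun x => F x v := by
    intro v
    refine continuous_finset_sum _ fun j _ => (hc v j).comp ?_
    fun_prop
  let S : Set (D.I → ℝ) := Set.Icc (fun _ => m) (fun _ => M) ∩ {x | ∀ v, 0 ≤ F x v}
  have hS : IsCompact S := by
    refine isCompact_Icc.inter_right ?_
    simp only [Set.setOf_forall]
    exact isClosed_iInter fun v => isClosed_le continuous_const (hF v)
  have hne : S.Nonempty := by
    refine ⟨fun _ => m, ⟨fun _ => le_refl _, fun _ => hmM⟩, ?_⟩
    intro v
    refine Finset.sum_nonneg fun j _ => ?_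
    rw [← h0 v j]
    refine (hm v j).monotone ?_
    rw [D.ext_int]
    by_cases hj : D.Int j
    · rw [D.ext_int' _ _ hj]; simp
    · rw [D.ext_bdry _ _ hj]; linarith [hg1 j]
  obtain ⟨x, hx, hmax⟩ := hS.exists_isMaxOn hne (f := fun x => ∑ v, x v) (by fun_prop)
  have hXM : ∀ j, D.ext g x j ≤ M := by
    intro j
    by_cases hj : D.Int j
    · rw [D.ext_int' _ _ hj]; exact hx.1.2 _
    · rw [D.ext_bdry _ _ hj]; exact hg2 j
  refine ⟨x, hx.1, ?_⟩
  by_contra hcon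
  push Not at hcon
  obtain ⟨v, hv⟩ := hcon
  have hvpos : 0 < F x v := lt_of_le_of_ne (hx.2 v) (Ne.symm hv)
  have hxv : x v < M := by
    refine lt_of_le_of_ne (hx.1.2 v) ?_
    intro h
    have : F x v ≤ 0 := by
      refine Finset.sum_nonpos fun j _ => ?_
      rw [← h0 v j]
      refine (hm v j).monotone ?_
      rw [D.ext_int, h]; linarith [hXM j]
    linarith
  let y : ℝ → D.I → ℝ := fun ε => Function.update x v (x v + ε)
  have hy : Continuous y := by
    refine continuous_pi fun w => ?_
    by_cases hw : w = v
    · subst hw; simp only [y, Function.update_self]; fun_prop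
    · simp only [y, Function.update_of_ne hw]; fun_prop
  have y0 : y 0 = x := by simp [y]
  have E1 : ∀ᶠ ε in 𝓝[>] (0:ℝ), 0 < F (y ε) v := by
    refine Filter.Eventually.filter_mono nhdsWithin_le_nhds ?_
    refine (isOpen_lt continuous_const ((hF v).comp hy)).mem_nhds ?_
    show 0 < F (y 0) v
    rw [y0]; exact hvpos
  have E2 : ∀ᶠ ε in 𝓝[>] (0:ℝ), x v + ε < M := by
    refine Filter.Eventually.filter_mono nhdsWithin_le_nhds ?_
    refine (isOpen_lt (by fun_prop) continuous_const).mem_nhds ?_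
    show x v + 0 < M
    simpa using hxv
  obtain ⟨ε, e1, e2, e3⟩ := (E1.and (E2.and self_mem_nhdsWithin)).exists
  have e3 : (0:ℝ) < ε := e3
  have hge : ∀ w, x w ≤ y ε w := by
    intro w
    by_cases hw : w = v
    · subst hw; simp only [y, Function.update_self]; linarith
    · simp only [y, Function.update_of_ne hw]; exact le_refl _
  have hyS : y ε ∈ S := by
    refine ⟨⟨fun w => (hx.1.1 w).trans (hge w), fun w => ?_⟩, fun w => ?_⟩
    · by_cases hw : w = v
      · subst hw; simp only [y, Function.update_self]; exact e2.le
      · simp only [y, Function.update_of_ne hw]; exact hx.1.2 w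
    · by_cases hw : w = v
      · rw [hw]; exact e1.le
      · refine (hx.2 w).trans ?_
        refine Finset.sum_le_sum fun j _ => (hm w j).monotone ?_
        rw [D.ext_int, D.ext_int]
        have : y ε w = x w := by simp only [y, Function.update_of_ne hw]
        rw [this]
        refine sub_le_sub_right ?_ _
        by_cases hj : D.Int j
        · rw [D.ext_int' _ _ hj, D.ext_int' _ _ hj]; exact hge _
        · rw [D.ext_bdry _ _ hj, D.ext_bdry _ _ hj]
  have h1 : ∑ w, y ε w ≤ ∑ w, x w := hmax hyS
  have h2 : ∑ w, x w < ∑ w, y ε w := by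
    refine Finset.sum_lt_sum (fun w _ => hge w) ⟨v, Finset.mem_univ _, ?_⟩
    simp only [y, Function.update_self]; linarith
  linarith

lemma H_le (D : TriDisk ι) (hall : ∀ v : ι, ∃ t ∈ D.tris, v ∈ vset t) (Φ : ι → ι → ℝ → ℝ)
    (hm : ∀ v j, StrictMono (Φ v j)) (g : ι → ℝ) (x y : D.I → ℝ)
    (hx : ∀ v : D.I, ∑ j ∈ D.Nb v, Φ v j (D.ext g x j - D.ext g x v) = 0)
    (hy : ∀ v : D.I, ∑ j ∈ D.Nb v, Φ v j (D.ext g y j - D.ext g y v) = 0) (w : D.I) :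
    x w ≤ y w := by
  classical
  by_contra hcon
  push Not at hcon
  set X := D.ext g x
  set Y := D.ext g y
  obtain ⟨v0, -, hv0⟩ := Finset.univ.exists_max_image (fun v => X v - Y v) ⟨(w : ι), Finset.mem_univ _⟩
  have hpos : 0 < X v0 - Y v0 := by
    have := hv0 w (Finset.mem_univ _)
    have e1 : X w = x w := D.ext_int _ _ _
    have e2 : Y w = y w := D.ext_int _ _ _
    rw [e1, e2] at this
    linarith
  obtain ⟨v, hv1, hv2⟩ := (Finset.univ.filter (fun v => X v - Y v = X v0 - Y v0)).exists_max_image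
    (fun v => lin (1, 0) (D.pos v)) ⟨v0, by simp⟩
  simp only [Finset.mem_filter, Finset.mem_univ, true_and] at hv1 hv2
  have hvI : D.Int v := by
    by_contra h
    have e1 : X v = g v := D.ext_bdry _ _ h
    have e2 : Y v = g v := D.ext_bdry _ _ h
    rw [e1, e2] at hv1; linarith
  obtain ⟨u, hu1, hu2⟩ := D.exists_higher hall hvI (l := (1, 0)) (by simp)
  have hle : ∀ j, X j - X v ≤ Y j - Y v := by
    intro j
    have := hv0 j (Finset.mem_univ _)
    linarith
  have hlt : X u - X v < Y u - Y v := by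
    refine lt_of_le_of_ne (hle u) ?_
    intro h
    have := hv2 u (by linarith)
    linarith
  have h1 := hx ⟨v, hvI⟩
  have h2 := hy ⟨v, hvI⟩
  have : ∑ j ∈ D.Nb v, Φ v j (X j - X v) < ∑ j ∈ D.Nb v, Φ v j (Y j - Y v) :=
    Finset.sum_lt_sum (fun j _ => (hm v j).monotone (hle j)) ⟨u, D.mem_Nb.2 hu1, hm v u hlt⟩
  simp only at h1 h2
  linarith

theorem lemH (D : TriDisk ι) (hall : ∀ v : ι, ∃ t ∈ D.tris, v ∈ vset t) {A : Type*}
    [TopologicalSpace A] (Φ : A → ι → ι → ℝ → ℝ)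
    (hc : ∀ v j, Continuous fun p : A × ℝ => Φ p.1 v j p.2)
    (hm : ∀ a v j, StrictMono (Φ a v j)) (h0 : ∀ a v j, Φ a v j 0 = 0) (g : ι → ℝ) :
    ∃ x : A → (D.I → ℝ), Continuous x ∧ ∀ a y, y = x a ↔
      ∀ v : D.I, ∑ j ∈ D.Nb v, Φ a v j (D.ext g y j - D.ext g y v) = 0 := by
  classical
  obtain ⟨m, M, hmM, hg1, hg2⟩ : ∃ m M : ℝ, m ≤ M ∧ (∀ v, m ≤ g v) ∧ ∀ v, g v ≤ M := by
    obtain ⟨m, hm⟩ := (Set.finite_range g).bddBelow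
    obtain ⟨M, hM⟩ := (Set.finite_range g).bddAbove
    refine ⟨min m M, max m M, min_le_max, fun v => (min_le_left _ _).trans (hm ⟨v, rfl⟩),
      fun v => (hM ⟨v, rfl⟩).trans (le_max_right _ _)⟩
  have hc' : ∀ a v j, Continuous (Φ a v j) := fun a v j =>
    (hc v j).comp (f := fun s : ℝ => (a, s)) (by fun_prop)
  have hex := fun a => D.H_exists (Φ a) (hc' a) (hm a) (h0 a) g m M hmM hg1 hg2
  choose x hx1 hx2 using hex
  have huniq : ∀ a y, y = x a ↔
      ∀ v : D.I, ∑ j ∈ D.Nb v, Φ a v j (D.ext g y j - D.ext g y v) = 0 := by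
    intro a y
    constructor
    · rintro rfl; exact hx2 a
    · intro h
      funext w
      exact le_antisymm (D.H_le hall (Φ a) (hm a) g _ _ h (hx2 a) w)
        (D.H_le hall (Φ a) (hm a) g _ _ (hx2 a) h w)
  refine ⟨x, ?_, huniq⟩
  let K := Set.Icc (fun _ => m) (fun _ : D.I => M)
  have : CompactSpace K := isCompact_iff_compactSpace.1 isCompact_Icc
  have hcont : Continuous (fun a => (⟨x a, hx1 a⟩ : K)) := by
    apply cont_of_graph
    have : {p : A × K | p.2 = (⟨x p.1, hx1 p.1⟩ : K)} = ⋂ v : D.I, {p : A × K |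
      ∑ j ∈ D.Nb v, Φ p.1 v j (D.ext g (p.2 : D.I → ℝ) j - D.ext g (p.2 : D.I → ℝ) v) = 0} := by
      ext p
      simp only [Set.mem_setOf_eq, Set.mem_iInter]
      rw [← huniq p.1 p.2, Subtype.ext_iff]
    rw [this]
    refine isClosed_iInter fun v => isClosed_eq ?_ continuous_const
    refine continuous_finset_sum _ fun j _ => ?_
    exact (hc v j).comp (f := fun p : A × K => (p.1, D.ext g (p.2 : D.I → ℝ) j - D.ext g (p.2 : D.I → ℝ) v))
      (by fun_prop)
  exact continuous_subtype_val.comp hcont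

end TriDisk

end

section
open Filter Topology

namespace TriDisk

variable {ι : Type} [Fintype ι] [DecidableEq ι]

/-- extension of first coordinates -/
noncomputable def eX (D : TriDisk ι) (x : D.I → ℝ) : ι → ℝ := D.ext (fun v => (D.pos v).1) x
/-- extension of second coordinates -/
noncomputable def eY (D : TriDisk ι) (x : D.I → ℝ) : ι → ℝ := D.ext (fun v => (D.pos v).2) x

/-- admissible first coordinates -/
def U (D : TriDisk ι) : Set (D.I → ℝ) := {x | ∀ v, D.Int v →
  (∃ u, D.Adj v u ∧ D.eX x v < D.eX x u) ∧ ∃ u, D.Adj v u ∧ D.eX x u < D.eX x v}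

/-- total ascent -/
noncomputable def sA (D : TriDisk ι) (X : ι → ℝ) (v : ι) : ℝ := ∑ j ∈ D.Nb v, max (X j - X v) 0
/-- total descent -/
noncomputable def sB (D : TriDisk ι) (X : ι → ℝ) (v : ι) : ℝ := ∑ j ∈ D.Nb v, max (- (X j - X v)) 0

lemma sA_pos (D : TriDisk ι) (X : ι → ℝ) (v : ι) :
    0 < D.sA X v ↔ ∃ u, D.Adj v u ∧ X v < X u := by
  unfold sA
  rw [Finset.sum_pos_iff_of_nonneg (fun _ _ => le_max_right _ _)]
  simp [mem_Nb]

lemma sB_pos (D : TriDisk ι) (X : ι → ℝ) (v : ι) :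
    0 < D.sB X v ↔ ∃ u, D.Adj v u ∧ X u < X v := by
  unfold sB
  rw [Finset.sum_pos_iff_of_nonneg (fun _ _ => le_max_right _ _)]
  simp [mem_Nb]

lemma sA_nonneg (D : TriDisk ι) (X : ι → ℝ) (v : ι) : 0 ≤ D.sA X v :=
  Finset.sum_nonneg (fun _ _ => le_max_right _ _)
lemma sB_nonneg (D : TriDisk ι) (X : ι → ℝ) (v : ι) : 0 ≤ D.sB X v :=
  Finset.sum_nonneg (fun _ _ => le_max_right _ _)

@[fun_prop]
lemma continuous_eX {A : Type*} [TopologicalSpace A] (D : TriDisk ι) (v : ι) {f : A → D.I → ℝ}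
    (hf : Continuous f) : Continuous fun a => D.eX (f a) v := by unfold eX; fun_prop
@[fun_prop]
lemma continuous_eY {A : Type*} [TopologicalSpace A] (D : TriDisk ι) (v : ι) {f : A → D.I → ℝ}
    (hf : Continuous f) : Continuous fun a => D.eY (f a) v := by unfold eY; fun_prop

lemma flat_or (D : TriDisk ι) {X : ι → ℝ} {v : ι} (h : 0 < D.sA X v ↔ 0 < D.sB X v) :
    (∀ u, D.Adj v u → X u = X v) ∨
      ((∃ u, D.Adj v u ∧ X v < X u) ∧ ∃ u, D.Adj v u ∧ X u < X v) := by
  by_cases hA : 0 < D.sA X v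
  · exact Or.inr ⟨(D.sA_pos X v).1 hA, (D.sB_pos X v).1 (h.1 hA)⟩
  · left
    intro u hu
    have hB : ¬ 0 < D.sB X v := fun hh => hA (h.2 hh)
    rw [sA_pos] at hA
    rw [sB_pos] at hB
    push Not at hA hB
    exact le_antisymm (hA u hu) (hB u hu)

theorem homeoU (D : TriDisk ι) (hconv : Convex ℝ D.space)
    (hall : ∀ v : ι, ∃ t ∈ D.tris, v ∈ vset t) : Nonempty (D.U ≃ₜ (D.I → ℝ)) := by
  let Φ : (D.I → ℝ) → ι → ι → ℝ → ℝ := fun t v _ s =>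
    Real.exp (D.ext (fun _ => 0) t v) * max s 0 - max (-s) 0
  have hsm : ∀ c : ℝ, 0 < c → StrictMono fun s : ℝ => c * max s 0 - max (-s) 0 := by
    intro c hc s t hst
    simp only
    have h1 : max s 0 ≤ max t 0 := max_le_max hst.le (le_refl _)
    have h2 : max (-t) 0 ≤ max (-s) 0 := max_le_max (by linarith) (le_refl _)
    have h3 := mul_le_mul_of_nonneg_left h1 hc.le
    by_cases ht : 0 < t
    · have : max s 0 < max t 0 := by rw [max_eq_left ht.le]; exact max_lt hst ht
      have := mul_lt_mul_of_pos_left this hc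
      linarith
    · have : max (-t) 0 < max (-s) 0 := by
        rw [max_eq_left (by linarith : 0 ≤ -t), max_eq_left (by linarith : 0 ≤ -s)]; linarith
      linarith
  obtain ⟨x, hxc, hx⟩ := D.lemH hall Φ (by intro v j; simp only [Φ]; fun_prop)
    (by intro t v j; exact hsm _ (Real.exp_pos _)) (by intro t v j; simp [Φ])
    (fun v => (D.pos v).1)
  have heq : ∀ t y, y = x t ↔ ∀ v : D.I, Real.exp (t v) * D.sA (D.eX y) v = D.sB (D.eX y) v := by
    intro t y
    rw [hx]
    refine forall_congr' fun v => ?_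
    simp only [Φ, D.ext_int]
    rw [Finset.sum_sub_distrib, ← Finset.mul_sum, sub_eq_zero]
    simp only [sA, sB, eX, ext_int]
  have hxU : ∀ t, x t ∈ D.U := by
    intro t
    have h1 := (heq t (x t)).1 rfl
    refine (D.thmN hconv hall (D.eX (x t)) (1, 0) (by simp) ?_ ?_).1
    · intro v hv; rw [eX, D.ext_bdry _ _ hv]; simp [lin]
    · intro v hv
      apply D.flat_or
      have := h1 ⟨v, hv⟩
      simp only at this
      rw [← this]
      constructor
      · intro h; have := Real.exp_pos (t ⟨v, hv⟩); positivity
      · intro h; exact (pos_iff_pos_of_mul_pos h).1 (Real.exp_pos _)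
  have hAp : ∀ y : D.U, ∀ v : D.I, 0 < D.sA (D.eX y) v := fun y v => (D.sA_pos _ _).2 (y.2 v v.2).1
  have hBp : ∀ y : D.U, ∀ v : D.I, 0 < D.sB (D.eX y) v := fun y v => (D.sB_pos _ _).2 (y.2 v v.2).2
  have cA : ∀ v, Continuous fun y : D.U => D.sA (D.eX y) v := by
    intro v; unfold sA; fun_prop
  have cB : ∀ v, Continuous fun y : D.U => D.sB (D.eX y) v := by
    intro v; unfold sB; fun_prop
  refine ⟨⟨⟨fun y v => Real.log (D.sB (D.eX y) v / D.sA (D.eX y) v), fun t => ⟨x t, hxU t⟩, ?_, ?_⟩, ?_, ?_⟩⟩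
  · intro y
    apply Subtype.ext
    symm
    refine (heq _ _).2 ?_
    intro v
    simp only
    rw [Real.exp_log (div_pos (hBp y v) (hAp y v)), div_mul_cancel₀ _ (hAp y v).ne']
  · intro t
    funext v
    have h1 := (heq t (x t)).1 rfl v
    simp only
    rw [← h1, mul_div_cancel_right₀ _ (hAp ⟨x t, hxU t⟩ v).ne', Real.log_exp]
  · refine continuous_pi fun v => ?_
    refine Continuous.log ((cB v).div (cA v) fun y => (hAp y v).ne') fun y => ?_
    exact (div_pos (hBp y v) (hAp y v)).ne'
  · exact hxc.subtype_mk _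

/-- positive weights for which the identity embedding is harmonic -/
lemma exists_w0 (D : TriDisk ι) (hall : ∀ v : ι, ∃ t ∈ D.tris, v ∈ vset t) {v : ι}
    (hv : D.Int v) : ∃ w : ι → ℝ, (∀ j, 0 < w j) ∧ ∑ j ∈ D.Nb v, w j • (D.pos j - D.pos v) = 0 := by
  set E := ∑ j ∈ D.Nb v, (D.pos j - D.pos v) with hE
  have hf : Tendsto (fun ε : ℝ => D.pos v - ε • E) (𝓝[>] 0) (𝓝 (D.pos v)) := by
    have : Continuous (fun ε : ℝ => D.pos v - ε • E) := by fun_prop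
    have h2 := this.tendsto 0
    simp only [sub_zero, zero_smul] at h2
    exact h2.mono_left nhdsWithin_le_nhds
  have hin : ∀ᶠ p in 𝓝 (D.pos v), p ∈ D.space := mem_interior_iff_mem_nhds.1 hv
  obtain ⟨ε, h1, h2, h3⟩ := ((hf.eventually (D.near_vertex hall v)).and ((hf.eventually hin).and
    self_mem_nhdsWithin)).exists
  have h3 : (0 : ℝ) < ε := h3
  obtain ⟨b, c, ht, hp⟩ := h1 h2
  have e := bary_eq ht.2.ne' (D.pos v - ε • E)
  have es := bary_sum ht.2.ne' (D.pos v - ε • E)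
  obtain ⟨p1, p2, p3⟩ := hp
  have q1 := div_nonneg p1 ht.2.le
  have q3 := div_nonneg p3 ht.2.le
  set w := d3 (D.pos b) (D.pos c) (D.pos v - ε • E) / d3 (D.pos v) (D.pos b) (D.pos c)
  set s := d3 (D.pos c) (D.pos v) (D.pos v - ε • E) / d3 (D.pos v) (D.pos b) (D.pos c)
  set t := d3 (D.pos v) (D.pos b) (D.pos v - ε • E) / d3 (D.pos v) (D.pos b) (D.pos c)
  have hw : w = 1 - s - t := by linarith
  refine ⟨fun j => ε + (if j = b then s else 0) + (if j = c then t else 0), ?_, ?_⟩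
  · intro j
    have : 0 ≤ (if j = b then s else 0) := by split_ifs <;> simp [q3]
    have : 0 ≤ (if j = c then t else 0) := by split_ifs <;> simp [q1]
    linarith
  · simp only [add_smul, Finset.sum_add_distrib, ite_smul, zero_smul]
    rw [Finset.sum_ite_eq', Finset.sum_ite_eq', if_pos (D.mem_Nb.2 ht.adj1),
      if_pos (D.mem_Nb.2 ht.adj2), ← Finset.smul_sum, ← hE]
    rw [hw] at e
    have e' : ε • E = D.pos v - ((1 - s - t) • D.pos v + s • D.pos b + t • D.pos c) := by
      rw [e]; abel
    rw [e']
    module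

theorem tutte (D : TriDisk ι) (hconv : Convex ℝ D.space)
    (hall : ∀ v : ι, ∃ t ∈ D.tris, v ∈ vset t) (w : ι → ι → ℝ) (hw : ∀ v j, 0 < w v j) :
    ∃ x y : D.I → ℝ,
      (∀ x', x' = x ↔ ∀ v : D.I, ∑ j ∈ D.Nb v, w v j * (D.eX x' j - D.eX x' v) = 0) ∧
      ∀ a b c, D.Tr a b c → 0 < d3 (D.eX x a, D.eY y a) (D.eX x b, D.eY y b)
        (D.eX x c, D.eY y c) := by
  classical
  let A := {w : ι → ι → ℝ // ∀ v j, 0 < w v j}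
  have hA : PreconnectedSpace A := by
    have : Convex ℝ {w : ι → ι → ℝ | ∀ v j, 0 < w v j} := by
      intro x hx y hy a b ha hb hab v j
      have h1 := hx v j
      have h2 := hy v j
      simp only [Pi.add_apply, Pi.smul_apply, smul_eq_mul]
      rcases ha.eq_or_lt with rfl | ha
      · have : b = 1 := by linarith
        subst this; simpa using h2
      · have := mul_pos ha h1
        have := mul_nonneg hb h2.le
        linarith
    exact Subtype.preconnectedSpace this.isPreconnected
  let Φ : A → ι → ι → ℝ → ℝ := fun w v j s => w.1 v j * s
  have hc : ∀ v j, Continuous fun p : A × ℝ => Φ p.1 v j p.2 := by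
    intro v j
    have : Continuous fun p : A × ℝ => p.1.1 v j :=
      (continuous_apply_apply v j).comp (continuous_subtype_val.comp continuous_fst)
    exact this.mul continuous_snd
  have hm : ∀ a v j, StrictMono (Φ a v j) := fun a v j s t hst =>
    mul_lt_mul_of_pos_left hst (a.2 v j)
  obtain ⟨x, hxc, hx⟩ := D.lemH hall Φ hc hm (by intro a v j; simp [Φ]) (fun v => (D.pos v).1)
  obtain ⟨y, hyc, hy⟩ := D.lemH hall Φ hc hm (by intro a v j; simp [Φ]) (fun v => (D.pos v).2)
  refine ⟨x ⟨w, hw⟩, y ⟨w, hw⟩, hx ⟨w, hw⟩, ?_⟩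
  -- nonvanishing
  have hnv : ∀ w : A, ∀ a b c, D.Tr a b c → d3 (D.eX (x w) a, D.eY (y w) a)
      (D.eX (x w) b, D.eY (y w) b) (D.eX (x w) c, D.eY (y w) c) ≠ 0 := by
    intro w a b c ht h0
    have hX := (hx w (x w)).1 rfl
    have hY := (hy w (y w)).1 rfl
    set X := D.eX (x w) with hXd
    set Y := D.eY (y w) with hYd
    obtain ⟨θ, hθ, h1, h2⟩ : ∃ θ : ℝ × ℝ, θ ≠ 0 ∧ lin θ (X b, Y b) = lin θ (X a, Y a) ∧
        lin θ (X c, Y c) = lin θ (X a, Y a) := by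
      simp only [d3] at h0
      by_cases hb : X b = X a ∧ Y b = Y a
      · by_cases hc : X c = X a ∧ Y c = Y a
        · exact ⟨(1, 0), by simp, by simp [lin, hb.1], by simp [lin, hc.1]⟩
        · refine ⟨(-(Y c - Y a), X c - X a), ?_, by simp [lin, hb.1, hb.2], by simp [lin]; ring⟩
          intro h
          simp [Prod.ext_iff] at h
          apply hc; constructor <;> linarith
      · refine ⟨(-(Y b - Y a), X b - X a), ?_, by simp [lin]; ring, ?_⟩
        · intro h
          simp [Prod.ext_iff] at h
          apply hb; constructor <;> linarith
        · simp [lin]; linarith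
    refine (D.thmN hconv hall (fun v => lin θ (X v, Y v)) θ hθ ?_ ?_).2 a b c ht ⟨h1, h2⟩
    · intro v hv
      rw [hXd, hYd, eX, eY, D.ext_bdry _ _ hv, D.ext_bdry _ _ hv]
    · intro v hv
      have hsum : ∑ j ∈ D.Nb v, w.1 v j * (lin θ (X j, Y j) - lin θ (X v, Y v)) = 0 := by
        have e1 := hX ⟨v, hv⟩
        have e2 := hY ⟨v, hv⟩
        simp only [Φ] at e1 e2
        have : ∀ j, w.1 v j * (lin θ (X j, Y j) - lin θ (X v, Y v)) =
          θ.1 * (w.1 v j * (X j - X v)) + θ.2 * (w.1 v j * (Y j - Y v)) := by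
          intro j; simp [lin]; ring
        simp_rw [this, Finset.sum_add_distrib, ← Finset.mul_sum]
        have e1' : ∑ j ∈ D.Nb v, w.1 v j * (X j - X v) = 0 := e1
        have e2' : ∑ j ∈ D.Nb v, w.1 v j * (Y j - Y v) = 0 := e2
        rw [e1', e2']; ring
      by_cases hup : ∃ u, D.Adj v u ∧ lin θ (X v, Y v) < lin θ (X u, Y u)
      · by_cases hdn : ∃ u, D.Adj v u ∧ lin θ (X u, Y u) < lin θ (X v, Y v)
        · exact Or.inr ⟨hup, hdn⟩
        · exfalso
          push Not at hdn
          obtain ⟨u, hu1, hu2⟩ := hup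
          have : 0 < ∑ j ∈ D.Nb v, w.1 v j * (lin θ (X j, Y j) - lin θ (X v, Y v)) :=
            Finset.sum_pos' (fun j hj => mul_nonneg (w.2 v j).le
              (sub_nonneg.2 (hdn j (D.mem_Nb.1 hj))))
              ⟨u, D.mem_Nb.2 hu1, mul_pos (w.2 v u) (sub_pos.2 hu2)⟩
          linarith
      · left
        push Not at hup
        intro u hu
        have h3 := (Finset.sum_eq_zero_iff_of_nonpos (fun j hj => mul_nonpos_of_nonneg_of_nonpos
          (w.2 v j).le (sub_nonpos.2 (hup j (D.mem_Nb.1 hj))))).1 hsum u (D.mem_Nb.2 hu)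
        have := (mul_eq_zero.1 h3).resolve_left (w.2 v u).ne'
        linarith
  -- the base point
  have hw0 : ∀ v, ∃ w : ι → ℝ, (∀ j, 0 < w j) ∧
      (D.Int v → ∑ j ∈ D.Nb v, w j • (D.pos j - D.pos v) = 0) := by
    intro v
    by_cases hv : D.Int v
    · obtain ⟨w, h1, h2⟩ := D.exists_w0 hall hv
      exact ⟨w, h1, fun _ => h2⟩
    · exact ⟨fun _ => 1, fun _ => one_pos, fun h => absurd h hv⟩
  choose w0 hw0 hw0' using hw0
  let W0 : A := ⟨w0, hw0⟩
  have hX0 : D.eX (x W0) = fun v => (D.pos v).1 := by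
    have hE : D.eX (fun v : D.I => (D.pos v).1) = fun v => (D.pos v).1 := by
      funext v
      by_cases hv : D.Int v
      · rw [eX, D.ext_int' _ _ hv]
      · rw [eX, D.ext_bdry _ _ hv]
    have : (fun v : D.I => (D.pos v).1) = x W0 := by
      rw [hx]
      intro v
      change ∑ j ∈ D.Nb v, w0 v j * (D.eX (fun v : D.I => (D.pos v).1) j - D.eX (fun v : D.I => (D.pos v).1) v) = 0
      rw [hE]
      have := congrArg Prod.fst (hw0' v v.2)
      simpa [Prod.fst_sum] using this
    rw [← this, hE]
  have hY0 : D.eY (y W0) = fun v => (D.pos v).2 := by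
    have hE : D.eY (fun v : D.I => (D.pos v).2) = fun v => (D.pos v).2 := by
      funext v
      by_cases hv : D.Int v
      · rw [eY, D.ext_int' _ _ hv]
      · rw [eY, D.ext_bdry _ _ hv]
    have : (fun v : D.I => (D.pos v).2) = y W0 := by
      rw [hy]
      intro v
      change ∑ j ∈ D.Nb v, w0 v j * (D.eY (fun v : D.I => (D.pos v).2) j - D.eY (fun v : D.I => (D.pos v).2) v) = 0
      rw [hE]
      have := congrArg Prod.snd (hw0' v v.2)
      simpa [Prod.snd_sum] using this
    rw [← this, hE]
  intro a b c ht
  by_contra hneg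
  have hcd : Continuous fun w : A => d3 (D.eX (x w) a, D.eY (y w) a)
      (D.eX (x w) b, D.eY (y w) b) (D.eX (x w) c, D.eY (y w) c) := by fun_prop
  obtain ⟨w1, hw1⟩ := mem_range_of_exists_le_of_exists_ge hcd (c := 0) ⟨⟨w, hw⟩, not_lt.1 hneg⟩
    ⟨W0, by rw [hX0, hY0]; exact ht.2.le⟩
  exact hnv w1 a b c ht hw1

theorem fiber_nonempty (D : TriDisk ι) (hconv : Convex ℝ D.space)
    (hall : ∀ v : ι, ∃ t ∈ D.tris, v ∈ vset t) (x : D.I → ℝ) (hx : x ∈ D.U) :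
    ∃ y : D.I → ℝ, ∀ a b c, D.Tr a b c → 0 < d3 (D.eX x a, D.eY y a) (D.eX x b, D.eY y b)
        (D.eX x c, D.eY y c) := by
  classical
  let w : ι → ι → ℝ := fun v j => if D.Int v then
    (if D.eX x v ≤ D.eX x j then D.sB (D.eX x) v else D.sA (D.eX x) v) else 1
  obtain ⟨x', y, h1, h2⟩ := D.tutte hconv hall w (by
    intro v j
    simp only [w]
    split_ifs with hv _
    · exact (D.sB_pos _ _).2 (hx v hv).2
    · exact (D.sA_pos _ _).2 (hx v hv).1
    · exact one_pos)
  have : x = x' := by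
    rw [h1]
    intro v
    have e : ∀ j, w v j * (D.eX x j - D.eX x v) = D.sB (D.eX x) v * max (D.eX x j - D.eX x v) 0 -
        D.sA (D.eX x) v * max (-(D.eX x j - D.eX x v)) 0 := by
      intro j
      simp only [w, v.2, if_true]
      split_ifs with h
      · rw [max_eq_left (by linarith), max_eq_right (by linarith)]; ring
      · rw [max_eq_right (by linarith), max_eq_left (by linarith)]; ring
    simp_rw [e, Finset.sum_sub_distrib, ← Finset.mul_sum]
    change D.sB (D.eX x) v * D.sA (D.eX x) v - D.sA (D.eX x) v * D.sB (D.eX x) v = 0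
    ring
  subst this
  exact ⟨y, h2⟩

end TriDisk

end

section
open Filter Topology

/-- planar cross product -/
def cr (p q : ℝ × ℝ) : ℝ := p.1 * q.2 - p.2 * q.1

lemma d3_cr (a b c : ℝ × ℝ) : d3 a b c = cr (b - a) (c - a) := by simp [d3, cr]

namespace TriDisk

variable {ι : Type} [Fintype ι] [DecidableEq ι]

lemma not_all_left (D : TriDisk ι) (hconv : Convex ℝ D.space)
    (hall : ∀ v : ι, ∃ t ∈ D.tris, v ∈ vset t) {v : ι} (hv : D.Int v) (E : ι → ℝ × ℝ)
    (hE : ∀ b c, D.Tr v b c → 0 < cr (E b) (E c)) (d : ℝ × ℝ)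
    (hd : ∀ j, D.Adj v j → 0 < cr d (E j)) : False := by
  obtain ⟨u0, hu0, -⟩ := D.exists_higher hall hv (l := (1, 0)) (by simp)
  obtain ⟨u, hu, hmin⟩ := (D.Nb v).exists_min_image (fun j => lin d (E j) / cr d (E j))
    ⟨u0, D.mem_Nb.2 hu0⟩
  rw [mem_Nb] at hu
  obtain ⟨c, hc⟩ := hu.succ hconv hall hv
  have h1 := hmin c (D.mem_Nb.2 hc.adj2)
  rw [div_le_div_iff₀ (hd u hu) (hd c hc.adj2)] at h1
  have h2 := hE u c hc
  have hdd : d ≠ 0 := by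
    rintro rfl
    have := hd u hu
    simp [cr] at this
  have h3 : 0 < d.1 ^ 2 + d.2 ^ 2 := by
    by_contra h
    apply hdd
    have h1 : d.1 = 0 := by nlinarith [sq_nonneg d.1, sq_nonneg d.2]
    have h2 : d.2 = 0 := by nlinarith [sq_nonneg d.1, sq_nonneg d.2]
    ext <;> simp [h1, h2]
  have h4 : lin d (E u) * cr d (E c) - lin d (E c) * cr d (E u) =
      (d.1 ^ 2 + d.2 ^ 2) * cr (E u) (E c) := by simp only [lin, cr]; ring
  have := mul_pos h3 h2
  linarith

lemma star_cover (D : TriDisk ι) (hconv : Convex ℝ D.space)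
    (hall : ∀ v : ι, ∃ t ∈ D.tris, v ∈ vset t) {v : ι} (hv : D.Int v) (E : ι → ℝ × ℝ)
    (hE : ∀ b c, D.Tr v b c → 0 < cr (E b) (E c)) {d : ℝ × ℝ} (hd : d ≠ 0) :
    ∃ b c, D.Tr v b c ∧ 0 ≤ cr (E b) d ∧ 0 < cr d (E c) := by
  have h3 : 0 < d.1 ^ 2 + d.2 ^ 2 := by
    by_contra h
    apply hd
    have h1 : d.1 = 0 := by nlinarith [sq_nonneg d.1, sq_nonneg d.2]
    have h2 : d.2 = 0 := by nlinarith [sq_nonneg d.1, sq_nonneg d.2]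
    ext <;> simp [h1, h2]
  have hsw : ∀ p q, cr p q = - cr q p := by intro p q; simp only [cr]; ring
  by_cases h1 : ∃ j, D.Adj v j ∧ 0 < cr d (E j)
  · by_cases h2 : ∃ j, D.Adj v j ∧ ¬ 0 < cr d (E j)
    · obtain ⟨u, hu1, hu2⟩ := h1
      obtain ⟨w, hw1, hw2⟩ := h2
      obtain ⟨-, b, c, k1, k2, k3⟩ := D.both_types hconv hall hv (fun j => 0 < cr d (E j))
        hu1 hw1 hu2 hw2
      exact ⟨b, c, k1, by rw [hsw]; linarith [not_lt.1 k2], k3⟩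
    · push Not at h2
      exact (D.not_all_left hconv hall hv E hE d h2).elim
  · push Not at h1
    refine (D.not_all_left hconv hall hv E hE (-d) ?_).elim
    intro j hj
    have e : cr (-d) (E j) = - cr d (E j) := by simp [cr]; ring
    rw [e, neg_pos]
    refine lt_of_le_of_ne (h1 j hj) ?_
    intro h0
    obtain ⟨s, hs⟩ := hj.succ hconv hall hv
    obtain ⟨p, hp⟩ := hj.pred hconv hall hv
    have a1 := hE _ _ hs
    have a2 := hE _ _ hp
    have b1 := h1 s hs.adj2
    have b2 := h1 p hp.adj1
    have i1 : (d.1 ^ 2 + d.2 ^ 2) * cr (E j) (E s) =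
        lin d (E j) * cr d (E s) - cr d (E j) * lin d (E s) := by simp only [lin, cr]; ring
    have i2 : (d.1 ^ 2 + d.2 ^ 2) * cr (E p) (E j) =
        - lin d (E j) * cr d (E p) + cr d (E j) * lin d (E p) := by simp only [lin, cr]; ring
    rw [h0] at i1 i2
    have c1 := mul_pos h3 a1
    have c2 := mul_pos h3 a2
    rcases le_or_gt 0 (lin d (E j)) with hl | hl
    · nlinarith [mul_nonneg hl (neg_nonneg.2 b1)]
    · nlinarith [mul_nonneg (neg_nonneg.2 hl.le) (neg_nonneg.2 b2)]

/-- realizations as pairs of coordinate functions -/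
def XX (D : TriDisk ι) : Set ((D.I → ℝ) × (D.I → ℝ)) :=
  {p | ∀ a b c, D.Tr a b c → 0 < d3 (D.eX p.1 a, D.eY p.2 a) (D.eX p.1 b, D.eY p.2 b)
        (D.eX p.1 c, D.eY p.2 c)}

lemma XX_U (D : TriDisk ι) (hconv : Convex ℝ D.space)
    (hall : ∀ v : ι, ∃ t ∈ D.tris, v ∈ vset t) {p} (hp : p ∈ D.XX) : p.1 ∈ D.U := by
  intro v hv
  let E : ι → ℝ × ℝ := fun j => (D.eX p.1 j, D.eY p.2 j) - (D.eX p.1 v, D.eY p.2 v)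
  have hE : ∀ b c, D.Tr v b c → 0 < cr (E b) (E c) := by
    intro b c ht
    have := hp v b c ht
    rwa [d3_cr] at this
  constructor
  · by_contra hcon
    push Not at hcon
    obtain ⟨b, c, ht, h1, h2⟩ := D.star_cover hconv hall hv E hE (d := (1, 0)) (by simp)
    have h3 := hE b c ht
    have h4 := hcon b ht.adj1
    have h5 := hcon c ht.adj2
    simp only [E, cr, Prod.fst_sub, Prod.snd_sub] at h1 h2 h3
    nlinarith
  · by_contra hcon
    push Not at hcon
    obtain ⟨b, c, ht, h1, h2⟩ := D.star_cover hconv hall hv E hE (d := (-1, 0)) (by simp)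
    have h3 := hE b c ht
    have h4 := hcon b ht.adj1
    have h5 := hcon c ht.adj2
    simp only [E, cr, Prod.fst_sub, Prod.snd_sub] at h1 h2 h3
    nlinarith

end TriDisk

lemma gauge_homeo {A E : Type*} [TopologicalSpace A] [TopologicalSpace E] [AddCommGroup E]
    [Module ℝ E] [ContinuousSMul ℝ E] (g : A × E → ℝ) (hg : Continuous g) (h0 : ∀ p, 0 ≤ g p)
    (hh : ∀ a d, ∀ r : ℝ, 0 < r → g (a, r • d) = r * g (a, d)) :
    Nonempty ({p : A × E | g p < 1} ≃ₜ A × E) := by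
  have hpos : ∀ p : {p : A × E | g p < 1}, 0 < 1 - g p.1 := fun p => sub_pos.2 p.2
  refine ⟨⟨⟨fun p => (p.1.1, (1 - g p.1)⁻¹ • p.1.2), fun q => ⟨(q.1, (1 + g q)⁻¹ • q.2), ?_⟩, ?_, ?_⟩, ?_, ?_⟩⟩
  · have := h0 q
    show g (q.1, (1 + g q)⁻¹ • q.2) < 1
    rw [hh _ _ _ (by positivity), inv_mul_lt_iff₀ (by positivity)]
    simp
  · rintro ⟨⟨a, d⟩, hp⟩
    have h1 : 0 < 1 - g (a, d) := hpos ⟨_, hp⟩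
    apply Subtype.ext
    simp only [Prod.mk.injEq, true_and]
    rw [hh _ _ _ (inv_pos.2 h1), smul_smul, ← mul_inv]
    have : (1 + (1 - g (a, d))⁻¹ * g (a, d)) * (1 - g (a, d)) = 1 := by field_simp; ring
    rw [this]; simp
  · rintro ⟨a, d⟩
    have h1 := h0 (a, d)
    have h2 : 0 < 1 + g (a, d) := by positivity
    simp only [Prod.mk.injEq, true_and]
    rw [hh _ _ _ (inv_pos.2 h2), smul_smul, ← mul_inv]
    have : (1 - (1 + g (a, d))⁻¹ * g (a, d)) * (1 + g (a, d)) = 1 := by field_simp; ring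
    rw [this]; simp
  · refine Continuous.prodMk (by fun_prop) ?_
    refine Continuous.smul (Continuous.inv₀ (by fun_prop) fun p => (hpos p).ne') (by fun_prop)
  · refine Continuous.subtype_mk (Continuous.prodMk (by fun_prop) ?_) _
    refine Continuous.smul (Continuous.inv₀ (by fun_prop) fun p => ?_) (by fun_prop)
    have := h0 p
    positivity

namespace TriDisk

variable {ι : Type} [Fintype ι] [DecidableEq ι]

/-- area of a realized triangle -/
noncomputable def ar (D : TriDisk ι) (x y : D.I → ℝ) (τ : ι × ι × ι) : ℝ :=
  d3 (D.eX x τ.1, D.eY y τ.1) (D.eX x τ.2.1, D.eY y τ.2.1) (D.eX x τ.2.2, D.eY y τ.2.2)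

@[fun_prop]
lemma continuous_ar {A : Type*} [TopologicalSpace A] (D : TriDisk ι) (τ : ι × ι × ι)
    {f g : A → D.I → ℝ} (hf : Continuous f) (hg : Continuous g) :
    Continuous fun a => D.ar (f a) (g a) τ := by unfold ar; fun_prop

lemma eY_aff (D : TriDisk ι) (y d : D.I → ℝ) (r : ℝ) (v : ι) :
    D.eY (y + r • d) v = D.eY y v + r * (D.eY (y + d) v - D.eY y v) := by
  by_cases hv : D.Int v
  · simp only [eY, D.ext_int' _ _ hv]; simp
  · simp only [eY, D.ext_bdry _ _ hv]; ring

lemma ar_aff (D : TriDisk ι) (x y d : D.I → ℝ) (r : ℝ) (τ : ι × ι × ι) :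
    D.ar x (y + r • d) τ = D.ar x y τ + r * (D.ar x (y + d) τ - D.ar x y τ) := by
  simp only [ar, d3, D.eY_aff y d r]; ring

theorem homeoXX (D : TriDisk ι) (hconv : Convex ℝ D.space)
    (hall : ∀ v : ι, ∃ t ∈ D.tris, v ∈ vset t) :
    Nonempty (D.XX ≃ₜ (D.I → ℝ) × (D.I → ℝ)) := by
  classical
  let J := {τ : ι × ι × ι // D.Tr τ.1 τ.2.1 τ.2.2}
  have memXX : ∀ p, p ∈ D.XX ↔ ∀ τ : J, 0 < D.ar p.1 p.2 τ := by
    intro p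
    constructor
    · intro h τ; exact h _ _ _ τ.2
    · intro h a b c ht; exact h ⟨(a, b, c), ht⟩
  obtain ⟨s, hs⟩ := exists_continuous_forall_mem_convex_of_local_const
    (X := D.U) (E := D.I → ℝ) (t := fun x => {y | ∀ τ : J, 0 < D.ar x y τ})
    (by
      intro x y hy z hz a b ha hb hab τ
      have h1 := hy τ
      have h2 := hz τ
      have e : a • y + b • z = y + b • (z - y) := by
        have : a = 1 - b := by linarith
        rw [this]; module
      rw [e, ar_aff, add_sub_cancel]
      rcases ha.eq_or_lt with rfl | ha
      · have : b = 1 := by linarith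
        subst this; linarith
      · have := mul_pos ha h1
        have := mul_nonneg hb h2.le
        have : a = 1 - b := by linarith
        subst this
        linarith)
    (by
      intro x
      obtain ⟨y, hy⟩ := D.fiber_nonempty hconv hall x x.2
      refine ⟨y, ?_⟩
      have : IsOpen {x : D.U | ∀ τ : J, 0 < D.ar x y τ} := by
        simp only [Set.setOf_forall]
        exact isOpen_iInter_of_finite fun τ => isOpen_lt continuous_const (by fun_prop)
      exact this.mem_nhds (fun τ => hy _ _ _ τ.2))
  let L : D.U × (D.I → ℝ) → J → ℝ := fun p τ =>
    max (-((D.ar p.1 (s p.1 + p.2) τ - D.ar p.1 (s p.1) τ) / D.ar p.1 (s p.1) τ)) 0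
  have hspos : ∀ (x : D.U) (τ : J), 0 < D.ar x (s x) τ := fun x τ => hs x τ
  have hLc : Continuous L := by
    refine continuous_pi fun τ => ?_
    refine Continuous.max (Continuous.neg (Continuous.div ?_ ?_ fun p => (hspos p.1 τ).ne'))
      continuous_const
    · fun_prop
    · fun_prop
  obtain ⟨e1⟩ := gauge_homeo (fun p => ‖L p‖) hLc.norm (fun p => norm_nonneg _) (by
    intro a d r hr
    have : L (a, r • d) = r • L (a, d) := by
      funext τ
      simp only [L, Pi.smul_apply, smul_eq_mul]
      rw [ar_aff, mul_max_of_nonneg _ _ hr.le, mul_zero]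
      congr 1
      ring
    simp only [this, norm_smul, Real.norm_eq_abs, abs_of_pos hr])
  have hlt : ∀ p : D.U × (D.I → ℝ), ‖L p‖ < 1 ↔ ∀ τ : J, 0 < D.ar p.1 (s p.1 + p.2) τ := by
    intro p
    rw [pi_norm_lt_iff one_pos]
    refine forall_congr' fun τ => ?_
    have h1 := hspos p.1 τ
    rw [Real.norm_eq_abs, abs_of_nonneg (le_max_right _ _), max_lt_iff]
    simp only [zero_lt_one, and_true]
    rw [neg_lt, lt_div_iff₀ h1]
    constructor <;> intro h <;> linarith
  obtain ⟨e2⟩ := D.homeoU hconv hall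
  have hXU : ∀ p : D.XX, p.1.1 ∈ D.U := fun p => D.XX_U hconv hall p.2
  let e0 : D.XX ≃ₜ {p : D.U × (D.I → ℝ) | ‖L p‖ < 1} :=
    { toFun := fun p => ⟨(⟨p.1.1, hXU p⟩, p.1.2 - s ⟨p.1.1, hXU p⟩), by
        rw [Set.mem_setOf_eq, hlt]
        intro τ
        simp only [add_sub_cancel]
        exact (memXX _).1 p.2 τ⟩
      invFun := fun q => ⟨(q.1.1.1, s q.1.1 + q.1.2), (memXX _).2 ((hlt _).1 q.2)⟩
      left_inv := by
        intro p
        apply Subtype.ext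
        simp
      right_inv := by
        intro q
        apply Subtype.ext
        simp
      continuous_toFun := by
        refine Continuous.subtype_mk (Continuous.prodMk ?_ ?_) _
        · exact (continuous_fst.comp continuous_subtype_val).subtype_mk _
        · refine (continuous_snd.comp continuous_subtype_val).sub (s.continuous.comp ?_)
          exact (continuous_fst.comp continuous_subtype_val).subtype_mk _
      continuous_invFun := by
        refine Continuous.subtype_mk (Continuous.prodMk ?_ ?_) _ <;> fun_prop }
  exact ⟨(e0.trans e1).trans (e2.prodCongr (Homeomorph.refl _))⟩

end TriDisk

end

section
open Filter Topology

open Classical in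
/-- abstract crossing number -/
noncomputable def wz (a b u : ℝ) : ℤ :=
  if a < 0 ∧ 0 < b ∧ 0 < u then 1 else if b < 0 ∧ 0 < a ∧ u < 0 then -1 else 0

lemma wz_anti (a b u : ℝ) : wz b a (-u) = - wz a b u := by
  unfold wz
  by_cases h1 : a < 0 ∧ 0 < b ∧ 0 < u
  · have h2 : ¬ (b < 0 ∧ 0 < a ∧ 0 < -u) := fun h => by linarith [h1.1, h.2.1]
    rw [if_neg h2, if_pos h1, if_pos ⟨h1.1, h1.2.1, by linarith [h1.2.2]⟩]
  · by_cases h2 : b < 0 ∧ 0 < a ∧ u < 0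
    · rw [if_pos ⟨h2.1, h2.2.1, by linarith [h2.2.2]⟩, if_neg h1, if_pos h2]; rfl
    · rw [if_neg h1, if_neg h2, if_neg, if_neg]
      · rfl
      · rintro ⟨x, y, z⟩; exact h1 ⟨x, y, by linarith⟩
      · rintro ⟨x, y, z⟩; exact h2 ⟨x, y, by linarith⟩

open Classical in
lemma wz_sum {a b c u v t : ℝ} (ha : a ≠ 0) (hb : b ≠ 0) (hc : c ≠ 0) (hu : u ≠ 0) (hv : v ≠ 0)
    (ht : t ≠ 0) (h : a * v + b * t + c * u = 0) :
    wz a b u + wz b c v + wz c a t = if 0 < u ∧ 0 < v ∧ 0 < t then 1 else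
      if u < 0 ∧ v < 0 ∧ t < 0 then -1 else 0 := by
  unfold wz
  rcases lt_or_gt_of_ne ha with ha | ha <;> rcases lt_or_gt_of_ne hb with hb | hb <;>
  rcases lt_or_gt_of_ne hc with hc | hc <;> rcases lt_or_gt_of_ne hu with hu | hu <;>
  rcases lt_or_gt_of_ne hv with hv | hv <;> rcases lt_or_gt_of_ne ht with ht | ht <;>
  simp only [ha, hb, hc, hu, hv, ht, ha.not_gt, hb.not_gt, hc.not_gt, hu.not_gt, hv.not_gt,
    ht.not_gt, true_and, and_true, false_and, and_false, if_true, if_false, and_self] <;>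
  first
  | norm_num
    done
  | (exfalso
     first
     | nlinarith [mul_pos ha hv, mul_pos hb ht, mul_pos hc hu]
     | nlinarith [mul_pos_of_neg_of_neg ha hv, mul_pos_of_neg_of_neg hb ht, mul_pos_of_neg_of_neg hc hu]
     | nlinarith [mul_neg_of_pos_of_neg ha hv, mul_neg_of_pos_of_neg hb ht, mul_neg_of_pos_of_neg hc hu]
     | nlinarith [mul_neg_of_neg_of_pos ha hv, mul_neg_of_neg_of_pos hb ht, mul_neg_of_neg_of_pos hc hu]
     | nlinarith)

/-- crossing number of an oriented edge with a horizontal ray -/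
noncomputable def wc (A B p : ℝ × ℝ) : ℤ := wz (A.2 - p.2) (B.2 - p.2) (d3 A B p)

lemma wc_anti (A B p : ℝ × ℝ) : wc B A p = - wc A B p := by
  unfold wc; rw [d3_swap, wz_anti]

open Classical in
lemma wc_sum {A B C p : ℝ × ℝ} (ha : p.2 ≠ A.2) (hb : p.2 ≠ B.2) (hc : p.2 ≠ C.2)
    (hu : d3 A B p ≠ 0) (hv : d3 B C p ≠ 0) (ht : d3 C A p ≠ 0) :
    wc A B p + wc B C p + wc C A p = if InO A B C p then 1 else
      if d3 A B p < 0 ∧ d3 B C p < 0 ∧ d3 C A p < 0 then -1 else 0 := by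
  unfold wc InO
  rw [wz_sum (sub_ne_zero.2 ha.symm) (sub_ne_zero.2 hb.symm) (sub_ne_zero.2 hc.symm) hu hv ht
    (by simp only [d3]; ring)]
  congr

namespace TriDisk

variable {ι : Type} [Fintype ι] [DecidableEq ι]

open Classical in
/-- triangle triples -/
noncomputable def TT (D : TriDisk ι) : Finset (ι × ι × ι) :=
  Finset.univ.filter (fun τ => D.Tr τ.1 τ.2.1 τ.2.2)

lemma mem_TT (D : TriDisk ι) {a b c : ι} : (a, b, c) ∈ D.TT ↔ D.Tr a b c := by simp [TT]

/-- index of a realized triangle -/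
noncomputable def ind (Q : ι → ℝ × ℝ) (p : ℝ × ℝ) (τ : ι × ι × ι) : ℤ :=
  wc (Q τ.1) (Q τ.2.1) p + wc (Q τ.2.1) (Q τ.2.2) p + wc (Q τ.2.2) (Q τ.1) p

lemma sum_rot (D : TriDisk ι) (f : ι × ι × ι → ℤ) :
    ∑ τ ∈ D.TT, f (τ.2.1, τ.2.2, τ.1) = ∑ τ ∈ D.TT, f τ := by
  refine Finset.sum_bij' (fun τ _ => (τ.2.1, τ.2.2, τ.1)) (fun τ _ => (τ.2.2, τ.1, τ.2.1))
    ?_ ?_ ?_ ?_ ?_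
  · rintro ⟨a, b, c⟩ h; exact D.mem_TT.2 (D.mem_TT.1 h).rot
  · rintro ⟨a, b, c⟩ h; exact D.mem_TT.2 (D.mem_TT.1 h).rot.rot
  · rintro ⟨a, b, c⟩ h; rfl
  · rintro ⟨a, b, c⟩ h; rfl
  · rintro ⟨a, b, c⟩ h; rfl

lemma sum_ind (D : TriDisk ι) (Q : ι → ℝ × ℝ) (p : ℝ × ℝ) :
    ∑ τ ∈ D.TT, ind Q p τ = 3 * ∑ τ ∈ D.TT, wc (Q τ.1) (Q τ.2.1) p := by
  have h1 := D.sum_rot (fun τ => wc (Q τ.1) (Q τ.2.1) p)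
  have h2 := D.sum_rot (fun τ => wc (Q τ.2.1) (Q τ.2.2) p)
  simp only at h1 h2
  simp only [ind, Finset.sum_add_distrib]
  rw [h2, h1]; ring

lemma sum_wc (D : TriDisk ι) (hconv : Convex ℝ D.space)
    (hall : ∀ v : ι, ∃ t ∈ D.tris, v ∈ vset t) (Q : ι → ℝ × ℝ)
    (hQ : ∀ v, ¬ D.Int v → Q v = D.pos v) (p : ℝ × ℝ) :
    ∑ τ ∈ D.TT, ind Q p τ = ∑ τ ∈ D.TT, ind D.pos p τ := by
  classical
  rw [sum_ind, sum_ind]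
  congr 1
  rw [← sub_eq_zero, ← Finset.sum_sub_distrib]
  let f : ι × ι → ℤ := fun e => (wc (Q e.1) (Q e.2) p - wc (D.pos e.1) (D.pos e.2) p)
  let g : ι × ι → ℤ := fun e => if ∃ c, D.Tr e.1 e.2 c then f e else 0
  have h1 : ∑ τ ∈ D.TT, (wc (Q τ.1) (Q τ.2.1) p - wc (D.pos τ.1) (D.pos τ.2.1) p) =
      ∑ e, g e := by
    simp only [g]
    rw [← Finset.sum_filter]
    refine Finset.sum_bij (fun τ _ => (τ.1, τ.2.1)) ?_ ?_ ?_ ?_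
    · rintro ⟨a, b, c⟩ h
      simp only [Finset.mem_filter, Finset.mem_univ, true_and]
      exact ⟨c, D.mem_TT.1 h⟩
    · rintro ⟨a, b, c⟩ h ⟨a', b', c'⟩ h' e
      simp only [Prod.mk.injEq] at e
      obtain ⟨rfl, rfl⟩ := e
      rw [D.third_unique (D.mem_TT.1 h) (D.mem_TT.1 h')]
    · rintro ⟨a, b⟩ h
      simp only [Finset.mem_filter, Finset.mem_univ, true_and] at h
      obtain ⟨c, hc⟩ := h
      exact ⟨(a, b, c), D.mem_TT.2 hc, rfl⟩
    · rintro ⟨a, b, c⟩ h; rfl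
  have h2 : ∀ e, g e.swap = - g e := by
    rintro ⟨a, b⟩
    have hf : f (b, a) = - f (a, b) := by
      simp only [f]; rw [wc_anti (Q a), wc_anti (D.pos a)]; ring
    have hsymm : ∀ a b, (D.Int a ∨ D.Int b) → (∃ c, D.Tr a b c) → ∃ c, D.Tr b a c := by
      rintro a b (h | h) ⟨c, hc⟩
      · obtain ⟨c', hc'⟩ := D.pred_exists hconv hall h hc
        exact ⟨c', hc'.rot.rot⟩
      · exact D.succ_exists hconv hall h hc.rot
    simp only [g, Prod.swap_prod_mk]
    by_cases hI : D.Int a ∨ D.Int b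
    · have : (∃ c, D.Tr b a c) ↔ ∃ c, D.Tr a b c := ⟨hsymm b a hI.symm, hsymm a b hI⟩
      simp only [this, hf]
      split_ifs <;> simp
    · push Not at hI
      have : f (a, b) = 0 := by simp [f, hQ a hI.1, hQ b hI.2]
      rw [hf, this]; simp
  have h3 : ∑ e, g e = - ∑ e, g e := by
    rw [← Finset.sum_neg_distrib]
    refine Fintype.sum_equiv (Equiv.prodComm ι ι) _ _ ?_
    intro e
    rw [← neg_eq_iff_eq_neg]
    exact (h2 e).symm
  rw [h1]; omega

/-- generic points -/
def Gen (D : TriDisk ι) (Q : ι → ℝ × ℝ) (p : ℝ × ℝ) : Prop :=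
  (∀ v, p.2 ≠ (Q v).2) ∧ ∀ a b, D.Adj a b → d3 (Q a) (Q b) p ≠ 0

lemma dense_Gen (D : TriDisk ι) (Q : ι → ℝ × ℝ) (hQ : ∀ a b, D.Adj a b → Q a ≠ Q b) :
    IsOpen {p | D.Gen Q p} ∧ Dense {p | D.Gen Q p} := by
  have e : {p | D.Gen Q p} = (⋂ v, {p : ℝ × ℝ | 0 * p.1 + 1 * p.2 + (- (Q v).2) ≠ 0}) ∩
     ⋂ i : {e : ι × ι // D.Adj e.1 e.2}, {p : ℝ × ℝ |
        (-((Q i.1.2).2 - (Q i.1.1).2)) * p.1 + ((Q i.1.2).1 - (Q i.1.1).1) * p.2 +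
        (((Q i.1.2).2 - (Q i.1.1).2) * (Q i.1.1).1 - ((Q i.1.2).1 - (Q i.1.1).1) * (Q i.1.1).2) ≠ 0} := by
    ext p
    simp only [Gen, Set.mem_inter_iff, Set.mem_iInter, Set.mem_setOf_eq, Subtype.forall, Prod.forall]
    refine and_congr (forall_congr' fun v => not_congr ?_)
      (forall_congr' fun a => forall_congr' fun b => imp_congr_right fun _ => not_congr ?_)
    · constructor <;> intro h <;> linarith
    · unfold d3; constructor <;> intro h <;> linarith
  have d1 : ∀ v, IsOpen {p : ℝ × ℝ | 0 * p.1 + 1 * p.2 + (- (Q v).2) ≠ 0} ∧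
      Dense {p : ℝ × ℝ | 0 * p.1 + 1 * p.2 + (- (Q v).2) ≠ 0} := fun v =>
    dense_affine (Or.inr one_ne_zero)
  have d2 : ∀ i : {e : ι × ι // D.Adj e.1 e.2}, _ := fun i => dense_affine
    (α := (-((Q i.1.2).2 - (Q i.1.1).2))) (β := ((Q i.1.2).1 - (Q i.1.1).1))
    (γ := (((Q i.1.2).2 - (Q i.1.1).2) * (Q i.1.1).1 - ((Q i.1.2).1 - (Q i.1.1).1) * (Q i.1.1).2))
    (by
      by_contra h
      push Not at h
      apply hQ _ _ i.2
      ext <;> linarith [h.1, h.2])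
  rw [e]
  have o1 := isOpen_iInter_of_finite fun v => (d1 v).1
  have o2 := isOpen_iInter_of_finite fun i => (d2 i).1
  exact ⟨o1.inter o2, (dense_finite _ d1).inter_of_isOpen_left (dense_finite _ d2) o1⟩

open Classical in
lemma ind_gen (D : TriDisk ι) {Q : ι → ℝ × ℝ} {p : ℝ × ℝ} (hp : D.Gen Q p) {a b c : ι}
    (h : D.Tr a b c) : ind Q p (a, b, c) = if InO (Q a) (Q b) (Q c) p then 1 else
      if d3 (Q a) (Q b) p < 0 ∧ d3 (Q b) (Q c) p < 0 ∧ d3 (Q c) (Q a) p < 0 then -1 else 0 :=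
  wc_sum (hp.1 a) (hp.1 b) (hp.1 c) (hp.2 _ _ h.adj1) (hp.2 _ _ h.rot.adj1) (hp.2 _ _ h.rot.rot.adj1)

lemma inT_gen (D : TriDisk ι) {Q : ι → ℝ × ℝ} {p : ℝ × ℝ} (hp : D.Gen Q p) {a b c : ι}
    (h : D.Tr a b c) (hT : InT (Q a) (Q b) (Q c) p) : InO (Q a) (Q b) (Q c) p :=
  ⟨lt_of_le_of_ne hT.1 (hp.2 _ _ h.adj1).symm, lt_of_le_of_ne hT.2.1 (hp.2 _ _ h.rot.adj1).symm,
    lt_of_le_of_ne hT.2.2 (hp.2 _ _ h.rot.rot.adj1).symm⟩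

open Classical in
lemma ind_pos (D : TriDisk ι) {Q : ι → ℝ × ℝ} {p : ℝ × ℝ} (hp : D.Gen Q p) {a b c : ι}
    (h : D.Tr a b c) (hpos : 0 < d3 (Q a) (Q b) (Q c)) :
    ind Q p (a, b, c) = if InO (Q a) (Q b) (Q c) p then 1 else 0 := by
  rw [D.ind_gen hp h]
  have : ¬ (d3 (Q a) (Q b) p < 0 ∧ d3 (Q b) (Q c) p < 0 ∧ d3 (Q c) (Q a) p < 0) := by
    rintro ⟨h1, h2, h3⟩
    have := d3_sum (Q a) (Q b) (Q c) p
    linarith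
  simp [this]

open Classical in
lemma sum_card (D : TriDisk ι) {Q : ι → ℝ × ℝ} {p : ℝ × ℝ} (hp : D.Gen Q p)
    (hpos : ∀ a b c, D.Tr a b c → 0 < d3 (Q a) (Q b) (Q c)) :
    ∑ τ ∈ D.TT, ind Q p τ =
      ((D.TT.filter (fun τ => InO (Q τ.1) (Q τ.2.1) (Q τ.2.2) p)).card : ℤ) := by
  rw [Finset.card_filter]
  push_cast
  refine Finset.sum_congr rfl ?_
  rintro ⟨a, b, c⟩ h
  rw [D.ind_pos hp (D.mem_TT.1 h) (hpos _ _ _ (D.mem_TT.1 h))]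

lemma card_pos (D : TriDisk ι) {p : ℝ × ℝ} (hp : D.Gen D.pos p) :
    (p ∈ D.space → ∑ τ ∈ D.TT, ind D.pos p τ = 3) ∧
    (p ∉ D.space → ∑ τ ∈ D.TT, ind D.pos p τ = 0) := by
  classical
  rw [D.sum_card hp (fun a b c h => h.2)]
  constructor
  · intro h
    obtain ⟨a, b, c, ht, hT⟩ := (D.mem_space p).1 h
    have hO := D.inT_gen hp ht hT
    have : (D.TT.filter (fun τ => InO (D.pos τ.1) (D.pos τ.2.1) (D.pos τ.2.2) p)) =
        {(a, b, c), (b, c, a), (c, a, b)} := by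
      ext ⟨a', b', c'⟩
      simp only [Finset.mem_filter, mem_TT, Finset.mem_insert, Finset.mem_singleton]
      constructor
      · rintro ⟨h1, h2⟩
        have := D.open_unique ht h1 hO h2.inT
        simp only [Prod.mk.injEq]
        tauto
      · rintro (h1 | h1 | h1) <;> simp only [Prod.mk.injEq] at h1 <;> obtain ⟨rfl, rfl, rfl⟩ := h1
        · exact ⟨ht, hO⟩
        · exact ⟨ht.rot, hO.rot⟩
        · exact ⟨ht.rot.rot, hO.rot.rot⟩
    rw [this]
    have n1 := ht.ne
    have n2 := ht.rot.ne
    have n3 := ht.rot.rot.ne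
    rw [Finset.card_insert_of_notMem, Finset.card_insert_of_notMem, Finset.card_singleton]
    · rfl
    · simp [n2]
    · simp [n1, n3.symm]
  · intro h
    have : (D.TT.filter (fun τ => InO (D.pos τ.1) (D.pos τ.2.1) (D.pos τ.2.2) p)) = ∅ := by
      rw [Finset.filter_eq_empty_iff]
      rintro ⟨a, b, c⟩ h1 h2
      exact h ((D.mem_space p).2 ⟨a, b, c, D.mem_TT.1 h1, h2.inT⟩)
    rw [this]; rfl

end TriDisk

end

section
open Filter Topology

/-- barycentric extension of a vertex assignment -/
noncomputable def bm (a b c A B C p : ℝ × ℝ) : ℝ × ℝ :=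
  (d3 b c p / d3 a b c) • A + (d3 c a p / d3 a b c) • B + (d3 a b p / d3 a b c) • C

lemma continuous_bm (a b c A B C : ℝ × ℝ) : Continuous (bm a b c A B C) := by
  unfold bm; fun_prop

lemma bm_self {a b c : ℝ × ℝ} (h : d3 a b c ≠ 0) (p : ℝ × ℝ) : bm a b c a b c p = p := bary_eq h p

lemma d3_bm {a b c : ℝ × ℝ} (h : d3 a b c ≠ 0) (A B C X Y p : ℝ × ℝ) :
    d3 X Y (bm a b c A B C p) = (d3 b c p / d3 a b c) * d3 X Y A + (d3 c a p / d3 a b c) * d3 X Y B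
      + (d3 a b p / d3 a b c) * d3 X Y C := d3_comb _ _ _ _ _ _ _ _ (bary_sum h p)

lemma bm1 {a b c : ℝ × ℝ} (h : d3 a b c ≠ 0) (A B C p : ℝ × ℝ) :
    d3 A B (bm a b c A B C p) = d3 a b p / d3 a b c * d3 A B C := by
  rw [d3_bm h, d3_self1, d3_self2]; ring

lemma bm2 {a b c : ℝ × ℝ} (h : d3 a b c ≠ 0) (A B C p : ℝ × ℝ) :
    d3 B C (bm a b c A B C p) = d3 b c p / d3 a b c * d3 A B C := by
  rw [d3_bm h, d3_self1, d3_self2, d3_rot A B C]; ring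

lemma bm3 {a b c : ℝ × ℝ} (h : d3 a b c ≠ 0) (A B C p : ℝ × ℝ) :
    d3 C A (bm a b c A B C p) = d3 c a p / d3 a b c * d3 A B C := by
  rw [d3_bm h, d3_self1, d3_self2, ← d3_rot A B C, ← d3_rot B C A]; ring

lemma bm_bm {a b c A B C : ℝ × ℝ} (h : d3 a b c ≠ 0) (H : d3 A B C ≠ 0) (p : ℝ × ℝ) :
    bm A B C a b c (bm a b c A B C p) = p := by
  conv_rhs => rw [← bm_self h p]
  conv_lhs => unfold bm
  change (d3 B C (bm a b c A B C p) / d3 A B C) • a + (d3 C A (bm a b c A B C p) / d3 A B C) • b +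
    (d3 A B (bm a b c A B C p) / d3 A B C) • c = _
  rw [bm1 h, bm2 h, bm3 h, mul_div_cancel_right₀ _ H, mul_div_cancel_right₀ _ H,
    mul_div_cancel_right₀ _ H]
  rfl

lemma bm_inT {a b c A B C : ℝ × ℝ} (h : 0 < d3 a b c) (H : 0 < d3 A B C) {p : ℝ × ℝ}
    (hp : InT a b c p) : InT A B C (bm a b c A B C p) := by
  obtain ⟨h1, h2, h3⟩ := hp
  refine ⟨?_, ?_, ?_⟩
  · rw [bm1 h.ne']; positivity
  · rw [bm2 h.ne']; positivity
  · rw [bm3 h.ne']; positivity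

lemma bm_inO {a b c A B C : ℝ × ℝ} (h : 0 < d3 a b c) (H : 0 < d3 A B C) {p : ℝ × ℝ}
    (hp : InO a b c p) : InO A B C (bm a b c A B C p) := by
  obtain ⟨h1, h2, h3⟩ := hp
  refine ⟨?_, ?_, ?_⟩
  · rw [bm1 h.ne']; positivity
  · rw [bm2 h.ne']; positivity
  · rw [bm3 h.ne']; positivity

lemma bm_affine (a b c A B C : ℝ × ℝ) : ∃ g : (ℝ × ℝ) →ᵃ[ℝ] (ℝ × ℝ), ∀ p, bm a b c A B C p = g p := by
  let L : (ℝ × ℝ) →ₗ[ℝ] (ℝ × ℝ) :=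
    { toFun := fun u => bm a b c A B C u - bm a b c A B C 0
      map_add' := by
        intro u v
        ext <;> simp [bm, d3] <;> ring
      map_smul' := by
        intro r u
        ext <;> simp [bm, d3] <;> ring }
  refine ⟨L.toAffineMap + AffineMap.const ℝ _ (bm a b c A B C 0), fun p => ?_⟩
  simp [L]

lemma affine_bm (a b c : ℝ × ℝ) (h : d3 a b c ≠ 0) (g : (ℝ × ℝ) →ᵃ[ℝ] (ℝ × ℝ)) (p : ℝ × ℝ) :
    g p = bm a b c (g a) (g b) (g c) p := by
  conv_lhs => rw [← bm_self h p]
  have hs := bary_sum h p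
  unfold bm
  set r := d3 b c p / d3 a b c
  set s := d3 c a p / d3 a b c
  set t := d3 a b p / d3 a b c
  rw [g.decomp]
  simp only [Pi.add_apply, map_add, map_smul]
  have : g 0 = r • g 0 + s • g 0 + t • g 0 := by rw [← add_smul, ← add_smul, hs, one_smul]
  nth_rewrite 1 [this]
  simp only [smul_add]
  abel

namespace TriDisk

variable {ι : Type} [Fintype ι] [DecidableEq ι]

/-- barycentric coordinate -/
noncomputable def co (D : TriDisk ι) (v b c : ι) (p : ℝ × ℝ) : ℝ :=
  d3 (D.pos b) (D.pos c) p / d3 (D.pos v) (D.pos b) (D.pos c)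

lemma co_unique (D : TriDisk ι) {v b c b' c' : ι} (h : D.Tr v b c) (h' : D.Tr v b' c') {p : ℝ × ℝ}
    (hp : InT (D.pos v) (D.pos b) (D.pos c) p) (hp' : InT (D.pos v) (D.pos b') (D.pos c') p) :
    D.co v b c p = D.co v b' c' p := by
  have e := d3_bm h.2.ne' (D.pos v) (D.pos b) (D.pos c) (D.pos b') (D.pos c') p
  rw [bm_self h.2.ne', d3_rot (D.pos v)] at e
  have hb : d3 (D.pos c) (D.pos v) p / d3 (D.pos v) (D.pos b) (D.pos c) *
      d3 (D.pos b') (D.pos c') (D.pos b) = 0 := by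
    by_cases h1 : b = b'
    · rw [h1, d3_self1, mul_zero]
    by_cases h2 : b = c'
    · rw [h2, d3_self2, mul_zero]
    rw [D.glue0 h.rot.rot h' hp.rot.rot hp' ⟨h.ne.symm, h1, h2⟩, zero_div, zero_mul]
  have hc : d3 (D.pos v) (D.pos b) p / d3 (D.pos v) (D.pos b) (D.pos c) *
      d3 (D.pos b') (D.pos c') (D.pos c) = 0 := by
    by_cases h1 : c = b'
    · rw [h1, d3_self1, mul_zero]
    by_cases h2 : c = c'
    · rw [h2, d3_self2, mul_zero]
    rw [D.glue0 h h' hp hp' ⟨h.rot.rot.ne, h1, h2⟩, zero_div, zero_mul]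
  rw [hb, hc, add_zero, add_zero] at e
  unfold co
  rw [e, mul_div_cancel_right₀ _ h'.2.ne']

open Classical in
/-- barycentric weights -/
noncomputable def wt (D : TriDisk ι) (p : ℝ × ℝ) (v : ι) : ℝ :=
  if h : ∃ e : ι × ι, D.Tr v e.1 e.2 ∧ InT (D.pos v) (D.pos e.1) (D.pos e.2) p then
    D.co v h.choose.1 h.choose.2 p else 0

lemma wt_eq (D : TriDisk ι) {v b c : ι} (h : D.Tr v b c) {p : ℝ × ℝ}
    (hp : InT (D.pos v) (D.pos b) (D.pos c) p) : D.wt p v = D.co v b c p := by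
  have hx : ∃ e : ι × ι, D.Tr v e.1 e.2 ∧ InT (D.pos v) (D.pos e.1) (D.pos e.2) p := ⟨(b, c), h, hp⟩
  rw [wt, dif_pos hx]
  exact D.co_unique hx.choose_spec.1 h hx.choose_spec.2 hp

lemma wt_zero (D : TriDisk ι) {a b c v : ι} (h : D.Tr a b c) {p : ℝ × ℝ}
    (hp : InT (D.pos a) (D.pos b) (D.pos c) p) (hv : v ≠ a ∧ v ≠ b ∧ v ≠ c) : D.wt p v = 0 := by
  by_cases hx : ∃ e : ι × ι, D.Tr v e.1 e.2 ∧ InT (D.pos v) (D.pos e.1) (D.pos e.2) p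
  · rw [wt, dif_pos hx, co, D.glue0 hx.choose_spec.1.rot h hx.choose_spec.2.rot hp hv, zero_div]
  · rw [wt, dif_neg hx]

/-- the PL map -/
noncomputable def phi (D : TriDisk ι) (Q : ι → ℝ × ℝ) (p : ℝ × ℝ) : ℝ × ℝ := ∑ v, D.wt p v • Q v

lemma phi_eq (D : TriDisk ι) (Q : ι → ℝ × ℝ) {a b c : ι} (h : D.Tr a b c) {p : ℝ × ℝ}
    (hp : InT (D.pos a) (D.pos b) (D.pos c) p) :
    D.phi Q p = bm (D.pos a) (D.pos b) (D.pos c) (Q a) (Q b) (Q c) p := by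
  have n1 := h.ne
  have n2 := h.rot.ne
  have n3 := h.rot.rot.ne
  have : D.phi Q p = ∑ v ∈ ({a, b, c} : Finset ι), D.wt p v • Q v := by
    symm
    refine Finset.sum_subset (Finset.subset_univ _) ?_
    intro v _ hv
    simp only [Finset.mem_insert, Finset.mem_singleton, not_or] at hv
    rw [D.wt_zero h hp hv, zero_smul]
  rw [this, Finset.sum_insert (by simp [n1, n3.symm]), Finset.sum_insert (by simp [n2]),
    Finset.sum_singleton, D.wt_eq h hp, D.wt_eq h.rot hp.rot, D.wt_eq h.rot.rot hp.rot.rot]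
  simp only [co, bm]
  rw [d3_rot (D.pos a), d3_rot (D.pos b), d3_rot (D.pos a), add_assoc]

lemma phi_pos (D : TriDisk ι) (hall : ∀ v : ι, ∃ t ∈ D.tris, v ∈ vset t) (Q : ι → ℝ × ℝ) (v : ι) :
    D.phi Q (D.pos v) = Q v := by
  obtain ⟨t, ht, hv⟩ := hall v
  obtain ⟨b, c, h⟩ := Tr.exists_third D ht hv
  rw [D.phi_eq Q h h.in1, bm, d3_self1, d3_self2, d3_rot, div_self h.2.ne']
  simp

lemma continuousOn_wt (D : TriDisk ι) (v : ι) : ContinuousOn (fun p => D.wt p v) D.space := by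
  have e : D.space = ⋃ x : {x : ι × ι × ι // D.Tr x.1 x.2.1 x.2.2},
      {p | InT (D.pos x.1.1) (D.pos x.1.2.1) (D.pos x.1.2.2) p} := by
    ext p
    rw [mem_space]
    simp only [Set.mem_iUnion, Subtype.exists, Prod.exists]
    constructor
    · rintro ⟨a, b, c, h, hp⟩; exact ⟨a, b, c, h, hp⟩
    · rintro ⟨a, b, c, h, hp⟩; exact ⟨a, b, c, h, hp⟩
  rw [e]
  refine (locallyFinite_of_finite _).continuousOn_iUnion (fun _ => isClosed_InT _ _ _) ?_
  rintro ⟨⟨a, b, c⟩, h⟩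
  simp only at h ⊢
  have hco : ∀ a b c, Continuous (D.co a b c) := fun a b c => by unfold co; fun_prop
  by_cases h1 : v = a
  · subst h1
    exact (hco v b c).continuousOn.congr fun p hp => D.wt_eq h hp
  by_cases h2 : v = b
  · subst h2
    exact (hco v c a).continuousOn.congr fun p hp => D.wt_eq h.rot (InT.rot hp)
  by_cases h3 : v = c
  · subst h3
    exact (hco v a b).continuousOn.congr fun p hp => D.wt_eq h.rot.rot (InT.rot (InT.rot hp))
  exact (continuousOn_const (c := (0:ℝ))).congr fun p hp => D.wt_zero h hp ⟨h1, h2, h3⟩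

lemma continuousOn_phi (D : TriDisk ι) (Q : ι → ℝ × ℝ) : ContinuousOn (D.phi Q) D.space := by
  unfold phi
  exact continuousOn_finsetSum _ fun v _ => (D.continuousOn_wt v).smul continuousOn_const

/-- PL map as continuous map -/
noncomputable def Phi (D : TriDisk ι) (Q : ι → ℝ × ℝ) : C(D.space, ℝ × ℝ) :=
  ⟨fun p => D.phi Q p, continuousOn_iff_continuous_restrict.1 (D.continuousOn_phi Q)⟩

lemma phi_congr (D : TriDisk ι) {Q Q' : ι → ℝ × ℝ} {a b c : ι} (h : D.Tr a b c) {p : ℝ × ℝ}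
    (hp : InT (D.pos a) (D.pos b) (D.pos c) p) (h1 : d3 (D.pos b) (D.pos c) p ≠ 0 → Q a = Q' a)
    (h2 : d3 (D.pos c) (D.pos a) p ≠ 0 → Q b = Q' b)
    (h3 : d3 (D.pos a) (D.pos b) p ≠ 0 → Q c = Q' c) : D.phi Q p = D.phi Q' p := by
  rw [D.phi_eq Q h hp, D.phi_eq Q' h hp]
  unfold bm
  congr 1
  · congr 1
    · by_cases e : d3 (D.pos b) (D.pos c) p = 0
      · simp [e]
      · rw [h1 e]
    · by_cases e : d3 (D.pos c) (D.pos a) p = 0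
      · simp [e]
      · rw [h2 e]
  · by_cases e : d3 (D.pos a) (D.pos b) p = 0
    · simp [e]
    · rw [h3 e]

/-- a positive coefficient at an interior vertex puts the point in the interior -/
lemma int_of_coeff (D : TriDisk ι) (hconv : Convex ℝ D.space) {a b c : ι} (h : D.Tr a b c)
    {p : ℝ × ℝ} (hp : InT (D.pos a) (D.pos b) (D.pos c) p) (hne : d3 (D.pos b) (D.pos c) p ≠ 0)
    (ha : D.Int a) : p ∈ interior D.space := by
  have h0 : 0 < d3 (D.pos b) (D.pos c) p / d3 (D.pos a) (D.pos b) (D.pos c) :=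
    div_pos (lt_of_le_of_ne hp.2.1 hne.symm) h.2
  set r := d3 (D.pos b) (D.pos c) p / d3 (D.pos a) (D.pos b) (D.pos c) with hr
  have hb : D.pos b ∈ D.space := (D.mem_space _).2 ⟨b, c, a, h.rot, h.rot.in1⟩
  have hc : D.pos c ∈ D.space := (D.mem_space _).2 ⟨c, a, b, h.rot.rot, h.rot.rot.in1⟩
  have e := bm_self h.2.ne' p
  have es := bary_sum h.2.ne' p
  unfold bm at e
  have hs0 : 0 ≤ d3 (D.pos c) (D.pos a) p / d3 (D.pos a) (D.pos b) (D.pos c) :=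
    div_nonneg hp.2.2 h.2.le
  have ht0 : 0 ≤ d3 (D.pos a) (D.pos b) p / d3 (D.pos a) (D.pos b) (D.pos c) :=
    div_nonneg hp.1 h.2.le
  set s := d3 (D.pos c) (D.pos a) p / d3 (D.pos a) (D.pos b) (D.pos c) with hs
  set t := d3 (D.pos a) (D.pos b) p / d3 (D.pos a) (D.pos b) (D.pos c) with ht
  rw [← hr] at e es
  by_cases hst : s + t = 0
  · have hs' : s = 0 := by linarith
    have ht' : t = 0 := by linarith
    have hr' : r = 1 := by linarith
    rw [hs', ht', hr'] at e
    simp only [one_smul, zero_smul, add_zero] at e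
    rw [← e]; exact ha
  · have hst' : 0 < s + t := lt_of_le_of_ne (by linarith) (Ne.symm hst)
    have hm : (s/(s+t)) • D.pos b + (t/(s+t)) • D.pos c ∈ D.space :=
      hconv hb hc (by positivity) (by positivity) (by field_simp)
    have := hconv.combo_interior_self_mem_interior ha hm h0 hst'.le (by linarith)
    rw [smul_add, smul_smul, smul_smul, mul_div_cancel₀ _ hst, mul_div_cancel₀ _ hst, ← add_assoc, e] at this
    exact this

lemma phi_frontier (D : TriDisk ι) (hconv : Convex ℝ D.space) {Q : ι → ℝ × ℝ}
    (hQ : ∀ v, ¬ D.Int v → Q v = D.pos v) {p : ℝ × ℝ} (hp : p ∈ frontier D.space) :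
    D.phi Q p = p := by
  have hps : p ∈ D.space := D.isClosed_space.frontier_subset hp
  obtain ⟨a, b, c, h, hT⟩ := (D.mem_space p).1 hps
  have hni : p ∉ interior D.space := hp.2
  have : D.phi Q p = D.phi D.pos p := by
    refine D.phi_congr h hT ?_ ?_ ?_
    · intro hne; exact hQ a fun hi => hni (D.int_of_coeff hconv h hT hne hi)
    · intro hne; exact hQ b fun hi => hni (D.int_of_coeff hconv h.rot hT.rot hne hi)
    · intro hne; exact hQ c fun hi => hni (D.int_of_coeff hconv h.rot.rot hT.rot.rot hne hi)
  rw [this, D.phi_eq D.pos h hT, bm_self h.2.ne']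

end TriDisk

end

section
open Filter Topology

lemma bm_inO_neg {a b c A B C : ℝ × ℝ} (h : 0 < d3 a b c) (H : d3 A B C < 0) {p : ℝ × ℝ}
    (h1 : d3 A B p < 0) (h2 : d3 B C p < 0) (h3 : d3 C A p < 0) :
    InO a b c (bm A B C a b c p) := by
  refine ⟨?_, ?_, ?_⟩
  · rw [bm1 H.ne]; exact mul_pos (div_pos_of_neg_of_neg h1 H) h
  · rw [bm2 H.ne]; exact mul_pos (div_pos_of_neg_of_neg h2 H) h
  · rw [bm3 H.ne]; exact mul_pos (div_pos_of_neg_of_neg h3 H) h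

lemma bm_rot (a b c A B C p : ℝ × ℝ) : bm b c a B C A p = bm a b c A B C p := by
  unfold bm
  rw [d3_rot a b c]; abel

/-- centroid -/
noncomputable def cen (a b c : ℝ × ℝ) : ℝ × ℝ := (1/3 : ℝ) • a + (1/3 : ℝ) • b + (1/3 : ℝ) • c

lemma d3_cen (a b c : ℝ × ℝ) : d3 a b (cen a b c) = d3 a b c / 3 ∧
    d3 b c (cen a b c) = d3 a b c / 3 ∧ d3 c a (cen a b c) = d3 a b c / 3 := by
  unfold cen
  rw [d3_comb _ _ _ _ _ _ _ _ (by norm_num), d3_comb _ _ _ _ _ _ _ _ (by norm_num),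
    d3_comb _ _ _ _ _ _ _ _ (by norm_num)]
  refine ⟨?_, ?_, ?_⟩ <;> unfold d3 <;> ring

lemma InO_cen {a b c : ℝ × ℝ} (h : 0 < d3 a b c) : InO a b c (cen a b c) := by
  obtain ⟨h1, h2, h3⟩ := d3_cen a b c
  refine ⟨?_, ?_, ?_⟩ <;> linarith

lemma closure_InO {a b c p : ℝ × ℝ} (h : 0 < d3 a b c) (hp : InT a b c p) :
    p ∈ closure {q | InO a b c q} := by
  have hf : Tendsto (fun ε : ℝ => (1 - ε) • p + ε • cen a b c) (𝓝[>] 0) (𝓝 p) := by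
    have : Continuous (fun ε : ℝ => (1 - ε) • p + ε • cen a b c) := by fun_prop
    have h2 := this.tendsto 0
    simp only [sub_zero, one_smul, zero_smul, add_zero] at h2
    exact h2.mono_left nhdsWithin_le_nhds
  refine mem_closure_of_tendsto hf ?_
  filter_upwards [Ioo_mem_nhdsGT (show (0:ℝ) < 1 by norm_num)] with ε hε
  obtain ⟨h1, h2, h3⟩ := d3_cen a b c
  obtain ⟨p1, p2, p3⟩ := hp
  obtain ⟨e1, e2⟩ := hε
  have e3 : 0 < 1 - ε := by linarith
  refine ⟨?_, ?_, ?_⟩ <;> rw [d3_comb2 _ _ _ _ _ _ (by ring)]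
  · rw [h1]; positivity
  · rw [h2]; positivity
  · rw [h3]; positivity

lemma kernel_vec {u w : ℝ × ℝ} (h : cr u w = 0) : ∃ α β : ℝ, (α ≠ 0 ∨ β ≠ 0) ∧ α • u + β • w = 0 := by
  unfold cr at h
  by_cases h1 : u.1 = 0 ∧ w.1 = 0
  · by_cases h2 : u.2 = 0 ∧ w.2 = 0
    · exact ⟨1, 0, Or.inl one_ne_zero, by ext <;> simp [h1.1, h2.1]⟩
    · refine ⟨w.2, -u.2, by rw [neg_ne_zero]; tauto, ?_⟩
      ext <;> simp [h1.1, h1.2]; ring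
  · refine ⟨w.1, -u.1, by rw [neg_ne_zero]; tauto, ?_⟩
    ext <;> simp <;> linarith

namespace TriDisk

variable {ι : Type} [Fintype ι] [DecidableEq ι]

lemma Tr.sub {D : TriDisk ι} {a b c : ι} (h : D.Tr a b c) {p : ℝ × ℝ}
    (hp : InT (D.pos a) (D.pos b) (D.pos c) p) : p ∈ D.space := (D.mem_space p).2 ⟨a, b, c, h, hp⟩

lemma nondeg (D : TriDisk ι) {Q : ι → ℝ × ℝ} (hinj : Set.InjOn (D.phi Q) D.space) {a b c : ι}
    (h : D.Tr a b c) : d3 (Q a) (Q b) (Q c) ≠ 0 := by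
  intro h0
  rw [d3_cr] at h0
  obtain ⟨α, β, hne, hk⟩ := kernel_vec h0
  obtain ⟨g, hg⟩ := bm_affine (D.pos a) (D.pos b) (D.pos c) (Q a) (Q b) (Q c)
  have hphi : ∀ p, InT (D.pos a) (D.pos b) (D.pos c) p → D.phi Q p = g p := fun p hp => by
    rw [D.phi_eq Q h hp, hg]
  have ga : g (D.pos a) = Q a := by
    rw [← hg, bm, d3_self1, d3_self2, d3_rot, div_self h.2.ne']; simp
  have gb : g (D.pos b) = Q b := by
    rw [← hg, bm, d3_self1, d3_self2, d3_rot, d3_rot, div_self h.rot.2.ne']; simp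
  have gc : g (D.pos c) = Q c := by
    rw [← hg, bm, d3_self1, d3_self2, div_self h.2.ne']; simp
  set δ := α • (D.pos b - D.pos a) + β • (D.pos c - D.pos a) with hδ
  have hgδ : g.linear δ = 0 := by
    rw [hδ, map_add, map_smul, map_smul]
    have e1 : g.linear (D.pos b - D.pos a) = Q b - Q a := by
      rw [← ga, ← gb]; exact g.linearMap_vsub _ _
    have e2 : g.linear (D.pos c - D.pos a) = Q c - Q a := by
      rw [← ga, ← gc]; exact g.linearMap_vsub _ _
    rw [e1, e2, hk]
  have hδ0 : δ ≠ 0 := by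
    intro h1
    have hd := h.2
    have x1 := congrArg Prod.fst h1
    have x2 := congrArg Prod.snd h1
    simp only [hδ, Prod.fst_add, Prod.snd_add, Prod.smul_fst, Prod.smul_snd, Prod.fst_sub,
      Prod.snd_sub, smul_eq_mul, Prod.fst_zero, Prod.snd_zero] at x1 x2
    have y1 : α * d3 (D.pos a) (D.pos b) (D.pos c) = 0 := by
      unfold d3
      linear_combination ((D.pos c).2 - (D.pos a).2) * x1 - ((D.pos c).1 - (D.pos a).1) * x2
    have y2 : β * d3 (D.pos a) (D.pos b) (D.pos c) = 0 := by
      unfold d3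
      linear_combination ((D.pos b).1 - (D.pos a).1) * x2 - ((D.pos b).2 - (D.pos a).2) * x1
    rcases hne with h3 | h3
    · exact h3 ((mul_eq_zero.1 y1).resolve_right hd.ne')
    · exact h3 ((mul_eq_zero.1 y2).resolve_right hd.ne')
  set z := cen (D.pos a) (D.pos b) (D.pos c)
  have hz : InO (D.pos a) (D.pos b) (D.pos c) z := InO_cen h.2
  have hf : Tendsto (fun ε : ℝ => ε • δ + z) (𝓝[>] 0) (𝓝 z) := by
    have : Continuous (fun ε : ℝ => ε • δ + z) := by fun_prop
    have h2 := this.tendsto 0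
    simp only [zero_smul, zero_add] at h2
    exact h2.mono_left nhdsWithin_le_nhds
  have ev := hf.eventually ((isOpen_InO (D.pos a) (D.pos b) (D.pos c)).mem_nhds hz)
  obtain ⟨ε, hε, hε0⟩ := (ev.and self_mem_nhdsWithin).exists
  have hε' : InO (D.pos a) (D.pos b) (D.pos c) (ε • δ + z) := hε
  have : ε • δ + z = z := by
    apply hinj (h.sub hε'.inT) (h.sub hz.inT)
    rw [hphi _ hε'.inT, hphi _ hz.inT]
    have := g.map_vadd z (ε • δ)
    simp only [vadd_eq_add, map_smul, hgδ, smul_zero, zero_add] at this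
    exact this
  have : ε • δ = 0 := by simpa using this
  rcases smul_eq_zero.1 this with h4 | h4
  · exact (ne_of_gt hε0) h4
  · exact hδ0 h4

lemma adj_ne (D : TriDisk ι) {Q : ι → ℝ × ℝ}
    (hnd : ∀ a b c, D.Tr a b c → d3 (Q a) (Q b) (Q c) ≠ 0) (a b : ι) (h : D.Adj a b) : Q a ≠ Q b := by
  intro e
  obtain ⟨c, h | h⟩ := h
  · apply hnd _ _ _ h; rw [e, d3_self0]
  · apply hnd _ _ _ h; rw [e, d3_self1]

lemma dense_GG (D : TriDisk ι) {Q : ι → ℝ × ℝ}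
    (hnd : ∀ a b c, D.Tr a b c → d3 (Q a) (Q b) (Q c) ≠ 0) :
    Dense {p | D.Gen Q p ∧ D.Gen D.pos p} := by
  have h1 := D.dense_Gen Q (D.adj_ne hnd)
  have h2 := D.dense_Gen D.pos (D.adj_ne fun a b c h => h.2.ne')
  exact h1.2.inter_of_isOpen_left h2.2 h1.1

lemma phi_inv (D : TriDisk ι) {Q : ι → ℝ × ℝ} {a b c : ι} (h : D.Tr a b c)
    (hd : d3 (Q a) (Q b) (Q c) ≠ 0) {p : ℝ × ℝ}
    (hp : InT (D.pos a) (D.pos b) (D.pos c) (bm (Q a) (Q b) (Q c) (D.pos a) (D.pos b) (D.pos c) p)) :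
    D.phi Q (bm (Q a) (Q b) (Q c) (D.pos a) (D.pos b) (D.pos c) p) = p := by
  rw [D.phi_eq Q h hp, bm_bm hd h.2.ne']

/-- Homeomorphisms preserve the orientation of every triangle. -/
lemma orient (D : TriDisk ι) (hconv : Convex ℝ D.space)
    (hall : ∀ v : ι, ∃ t ∈ D.tris, v ∈ vset t) {Q : ι → ℝ × ℝ}
    (hQ : ∀ v, ¬ D.Int v → Q v = D.pos v) (hinj : Set.InjOn (D.phi Q) D.space)
    (hmaps : ∀ x ∈ D.space, D.phi Q x ∈ D.space) {a b c : ι} (h : D.Tr a b c) :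
    0 < d3 (Q a) (Q b) (Q c) := by
  have hnd : ∀ a b c, D.Tr a b c → d3 (Q a) (Q b) (Q c) ≠ 0 := fun a b c h => D.nondeg hinj h
  by_contra hneg
  have hlt : d3 (Q a) (Q b) (Q c) < 0 := lt_of_le_of_ne (not_lt.1 hneg) (hnd _ _ _ h)
  have hO : IsOpen {p | d3 (Q a) (Q b) p < 0 ∧ d3 (Q b) (Q c) p < 0 ∧ d3 (Q c) (Q a) p < 0} := by
    refine IsOpen.and ?_ (IsOpen.and ?_ ?_) <;>
    exact isOpen_lt (by fun_prop) continuous_const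
  have hne : {p | d3 (Q a) (Q b) p < 0 ∧ d3 (Q b) (Q c) p < 0 ∧ d3 (Q c) (Q a) p < 0}.Nonempty := by
    refine ⟨cen (Q a) (Q b) (Q c), ?_⟩
    obtain ⟨h1, h2, h3⟩ := d3_cen (Q a) (Q b) (Q c)
    refine ⟨?_, ?_, ?_⟩ <;> linarith
  obtain ⟨p, ⟨h1, h2, h3⟩, g1, g2⟩ := (D.dense_GG hnd).inter_open_nonempty _ hO hne
  have hx := bm_inO_neg h.2 hlt h1 h2 h3
  have hphx := D.phi_inv h hlt.ne hx.inT
  have hps : p ∈ D.space := by rw [← hphx]; exact hmaps _ (h.sub hx.inT)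
  have hs := (D.card_pos g2).1 hps
  rw [← D.sum_wc hconv hall Q hQ p] at hs
  have : ∑ τ ∈ D.TT, ind Q p τ ≤ 0 := by
    refine Finset.sum_nonpos ?_
    rintro ⟨a', b', c'⟩ h'
    rw [mem_TT] at h'
    rw [D.ind_gen g1 h', if_neg]
    · split_ifs <;> norm_num
    intro hI
    have hd' : 0 < d3 (Q a') (Q b') (Q c') := by
      rw [← d3_sum _ _ _ p]; linarith [hI.1, hI.2.1, hI.2.2]
    have hx' := bm_inO hd' h'.2 hI
    have hphx' := D.phi_inv h' hd'.ne' hx'.inT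
    have e := hinj (h.sub hx.inT) (h'.sub hx'.inT) (hphx.trans hphx'.symm)
    rw [← e] at hx'
    rcases D.open_unique h h' hx hx'.inT with ⟨rfl, rfl, rfl⟩ | ⟨rfl, rfl, rfl⟩ | ⟨rfl, rfl, rfl⟩
    · linarith
    · rw [d3_rot] at hd'; linarith
    · rw [d3_rot, d3_rot] at hd'; linarith
  omega

lemma im_unique (D : TriDisk ι) (hconv : Convex ℝ D.space)
    (hall : ∀ v : ι, ∃ t ∈ D.tris, v ∈ vset t) {Q : ι → ℝ × ℝ}
    (hQ : ∀ v, ¬ D.Int v → Q v = D.pos v)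
    (hpos : ∀ a b c, D.Tr a b c → 0 < d3 (Q a) (Q b) (Q c)) {p : ℝ × ℝ} (g1 : D.Gen Q p) (g2 : D.Gen D.pos p)
    {a b c : ι} (h : D.Tr a b c) (hO : InO (Q a) (Q b) (Q c) p) :
    p ∈ D.space ∧ ∀ a' b' c', D.Tr a' b' c' → InO (Q a') (Q b') (Q c') p →
    ((a' = a ∧ b' = b ∧ c' = c) ∨ (a' = b ∧ b' = c ∧ c' = a) ∨ (a' = c ∧ b' = a ∧ c' = b)) := by
  classical
  have hs := D.sum_wc hconv hall Q hQ p
  rw [D.sum_card g1 hpos] at hs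
  have sub : ({(a, b, c), (b, c, a), (c, a, b)} : Finset (ι × ι × ι)) ⊆
      (D.TT.filter (fun τ => InO (Q τ.1) (Q τ.2.1) (Q τ.2.2) p)) := by
    rintro ⟨a', b', c'⟩
    simp only [Finset.mem_filter, mem_TT, Finset.mem_insert, Finset.mem_singleton]
    rintro (h1 | h1 | h1) <;> simp only [Prod.mk.injEq] at h1 <;> obtain ⟨rfl, rfl, rfl⟩ := h1
    · exact ⟨h, hO⟩
    · exact ⟨h.rot, hO.rot⟩
    · exact ⟨h.rot.rot, hO.rot.rot⟩
  have card3 : ({(a, b, c), (b, c, a), (c, a, b)} : Finset (ι × ι × ι)).card = 3 := by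
    have n1 := h.ne
    have n2 := h.rot.ne
    have n3 := h.rot.rot.ne
    rw [Finset.card_insert_of_notMem, Finset.card_insert_of_notMem, Finset.card_singleton]
    · simp [n2]
    · simp [n1, n3.symm]
  have hle := Finset.card_le_card sub
  rw [card3] at hle
  have hps : p ∈ D.space := by
    by_contra hn
    rw [(D.card_pos g2).2 hn] at hs
    omega
  refine ⟨hps, ?_⟩
  rw [(D.card_pos g2).1 hps] at hs
  have heq := Finset.eq_of_subset_of_card_le sub (by rw [card3]; omega)
  intro a' b' c' h' hO'
  have : (a', b', c') ∈ ({(a, b, c), (b, c, a), (c, a, b)} : Finset (ι × ι × ι)) := by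
    rw [heq]; simp only [Finset.mem_filter, mem_TT]; exact ⟨h', hO'⟩
  simpa only [Finset.mem_insert, Finset.mem_singleton, Prod.mk.injEq] using this

lemma im_exists (D : TriDisk ι) (hconv : Convex ℝ D.space)
    (hall : ∀ v : ι, ∃ t ∈ D.tris, v ∈ vset t) {Q : ι → ℝ × ℝ}
    (hQ : ∀ v, ¬ D.Int v → Q v = D.pos v)
    (hpos : ∀ a b c, D.Tr a b c → 0 < d3 (Q a) (Q b) (Q c)) {p : ℝ × ℝ} (g1 : D.Gen Q p) (g2 : D.Gen D.pos p)
    (hp : p ∈ D.space) : ∃ x ∈ D.space, D.phi Q x = p := by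
  classical
  have hs := D.sum_wc hconv hall Q hQ p
  rw [D.sum_card g1 hpos, (D.card_pos g2).1 hp] at hs
  have : (D.TT.filter (fun τ => InO (Q τ.1) (Q τ.2.1) (Q τ.2.2) p)).Nonempty := by
    rw [← Finset.card_pos]; omega
  obtain ⟨⟨a, b, c⟩, h⟩ := this
  simp only [Finset.mem_filter, mem_TT] at h
  have hx := bm_inO (hpos _ _ _ h.1) h.1.2 h.2
  exact ⟨_, h.1.sub hx.inT, D.phi_inv h.1 (hpos _ _ _ h.1).ne' hx.inT⟩

lemma inT_im_space (D : TriDisk ι) (hconv : Convex ℝ D.space)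
    (hall : ∀ v : ι, ∃ t ∈ D.tris, v ∈ vset t) {Q : ι → ℝ × ℝ}
    (hQ : ∀ v, ¬ D.Int v → Q v = D.pos v)
    (hpos : ∀ a b c, D.Tr a b c → 0 < d3 (Q a) (Q b) (Q c)) {a b c : ι} (h : D.Tr a b c) {z : ℝ × ℝ}
    (hz : InT (Q a) (Q b) (Q c) z) : z ∈ D.space := by
  have h1 := closure_InO (hpos _ _ _ h) hz
  have hd := D.dense_GG fun a b c h => (hpos a b c h).ne'
  have h2 := hd.open_subset_closure_inter (isOpen_InO (Q a) (Q b) (Q c))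
  have h3 := closure_minimal h2 isClosed_closure h1
  refine closure_minimal ?_ D.isClosed_space h3
  rintro p ⟨p1, p2, p3⟩
  exact (D.im_unique hconv hall hQ hpos p2 p3 h p1).1

lemma maps_space (D : TriDisk ι) (hconv : Convex ℝ D.space)
    (hall : ∀ v : ι, ∃ t ∈ D.tris, v ∈ vset t) {Q : ι → ℝ × ℝ}
    (hQ : ∀ v, ¬ D.Int v → Q v = D.pos v)
    (hpos : ∀ a b c, D.Tr a b c → 0 < d3 (Q a) (Q b) (Q c)) {x : ℝ × ℝ} (hx : x ∈ D.space) :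
    D.phi Q x ∈ D.space := by
  obtain ⟨a, b, c, h, hT⟩ := (D.mem_space x).1 hx
  rw [D.phi_eq Q h hT]
  exact D.inT_im_space hconv hall hQ hpos h (bm_inT h.2 (hpos _ _ _ h) hT)

lemma isCompact_space (D : TriDisk ι) : IsCompact D.space := by
  obtain ⟨e⟩ := D.disk
  have : CompactSpace (Metric.closedBall (0 : EuclideanSpace ℝ (Fin 2)) 1) :=
    isCompact_iff_compactSpace.1 (isCompact_closedBall _ _)
  exact isCompact_iff_compactSpace.2 e.symm.compactSpace

lemma space_sub_closure (D : TriDisk ι) : D.space ⊆ closure (interior D.space) := by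
  intro x hx
  obtain ⟨a, b, c, h, hT⟩ := (D.mem_space x).1 hx
  refine closure_mono ?_ (closure_InO h.2 hT)
  exact interior_maximal (fun p hp => h.sub (InO.inT hp)) (isOpen_InO _ _ _)

lemma surj_space (D : TriDisk ι) (hconv : Convex ℝ D.space)
    (hall : ∀ v : ι, ∃ t ∈ D.tris, v ∈ vset t) {Q : ι → ℝ × ℝ}
    (hQ : ∀ v, ¬ D.Int v → Q v = D.pos v)
    (hpos : ∀ a b c, D.Tr a b c → 0 < d3 (Q a) (Q b) (Q c)) : D.space ⊆ D.phi Q '' D.space := by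
  have hcl : IsClosed (D.phi Q '' D.space) :=
    (D.isCompact_space.image_of_continuousOn (D.continuousOn_phi Q)).isClosed
  have hd := D.dense_GG fun a b c h => (hpos a b c h).ne'
  have h2 := hd.open_subset_closure_inter (isOpen_interior (s := D.space))
  refine D.space_sub_closure.trans (closure_minimal (h2.trans (closure_minimal ?_ hcl)) hcl)
  rintro p ⟨p1, p2, p3⟩
  exact D.im_exists hconv hall hQ hpos p2 p3 (interior_subset p1)

end TriDisk

end

section
open Filter Topology

namespace TriDisk

variable {ι : Type} [Fintype ι] [DecidableEq ι]

/-- images of the triangles at `x` cover a neighborhood of the image of `x` -/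
def LC (D : TriDisk ι) (Q : ι → ℝ × ℝ) (x : ℝ × ℝ) : Prop :=
  ∀ᶠ p in 𝓝 (D.phi Q x), ∃ a b c, D.Tr a b c ∧ InT (D.pos a) (D.pos b) (D.pos c) x ∧
    InT (Q a) (Q b) (Q c) p

lemma LC_open (D : TriDisk ι) {Q : ι → ℝ × ℝ}
    (hpos : ∀ a b c, D.Tr a b c → 0 < d3 (Q a) (Q b) (Q c)) {a b c : ι} (h : D.Tr a b c)
    {x : ℝ × ℝ} (hx : InO (D.pos a) (D.pos b) (D.pos c) x) : D.LC Q x := by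
  have hz : InO (Q a) (Q b) (Q c) (D.phi Q x) := by
    rw [D.phi_eq Q h hx.inT]; exact bm_inO h.2 (hpos _ _ _ h) hx
  filter_upwards [(isOpen_InO (Q a) (Q b) (Q c)).mem_nhds hz] with p hp
  exact ⟨a, b, c, h, hx.inT, InO.inT hp⟩

lemma LC_edge (D : TriDisk ι) {Q : ι → ℝ × ℝ}
    (hpos : ∀ a b c, D.Tr a b c → 0 < d3 (Q a) (Q b) (Q c)) {a b c : ι} (h : D.Tr a b c)
    {x : ℝ × ℝ} (h1 : d3 (D.pos a) (D.pos b) x = 0) (h2 : 0 < d3 (D.pos b) (D.pos c) x)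
    (h3 : 0 < d3 (D.pos c) (D.pos a) x) (hi : x ∈ interior D.space) : D.LC Q x := by
  have hT : InT (D.pos a) (D.pos b) (D.pos c) x := ⟨h1.ge, h2.le, h3.le⟩
  have e := bm_self h.2.ne' x
  have es := bary_sum h.2.ne' x
  unfold bm at e
  rw [h1, zero_div, zero_smul, add_zero] at e
  rw [h1, zero_div, add_zero] at es
  have r0 : 0 < d3 (D.pos b) (D.pos c) x / d3 (D.pos a) (D.pos b) (D.pos c) := div_pos h2 h.2
  have s0 : 0 < d3 (D.pos c) (D.pos a) x / d3 (D.pos a) (D.pos b) (D.pos c) := div_pos h3 h.2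
  set r := d3 (D.pos b) (D.pos c) x / d3 (D.pos a) (D.pos b) (D.pos c)
  set s := d3 (D.pos c) (D.pos a) x / d3 (D.pos a) (D.pos b) (D.pos c)
  have hr : r = 1 - s := by linarith
  rw [hr] at e
  obtain ⟨c', h'⟩ := D.other_side h s0 (by linarith) (by rw [e]; exact hi)
  have k1 : d3 (D.pos b) (D.pos a) x = 0 := by rw [d3_swap, h1, neg_zero]
  have k2 : 0 < d3 (D.pos a) (D.pos c') x := by
    rw [← e, d3_comb2 _ _ _ _ _ _ (by ring), d3_self1, mul_zero, zero_add, d3_rot]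
    exact mul_pos s0 h'.2
  have k3 : 0 < d3 (D.pos c') (D.pos b) x := by
    rw [← e, d3_comb2 _ _ _ _ _ _ (by ring), d3_self2, mul_zero, add_zero, d3_rot, d3_rot]
    exact mul_pos (by linarith) h'.2
  have hT' : InT (D.pos b) (D.pos a) (D.pos c') x := ⟨k1.ge, k2.le, k3.le⟩
  have q := hpos _ _ _ h
  have q' := hpos _ _ _ h'
  have H := h.2
  have H' := h'.2
  have z2 : 0 < d3 (Q b) (Q c) (D.phi Q x) := by rw [D.phi_eq Q h hT, bm2 h.2.ne']; positivity
  have z3 : 0 < d3 (Q c) (Q a) (D.phi Q x) := by rw [D.phi_eq Q h hT, bm3 h.2.ne']; positivity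
  have y2 : 0 < d3 (Q a) (Q c') (D.phi Q x) := by rw [D.phi_eq Q h' hT', bm2 h'.2.ne']; positivity
  have y3 : 0 < d3 (Q c') (Q b) (D.phi Q x) := by rw [D.phi_eq Q h' hT', bm3 h'.2.ne']; positivity
  have op : ∀ u v : ℝ × ℝ, IsOpen {p | 0 < d3 u v p} := fun u v =>
    isOpen_lt continuous_const (by fun_prop)
  filter_upwards [(op _ _).mem_nhds z2, (op _ _).mem_nhds z3, (op _ _).mem_nhds y2,
    (op _ _).mem_nhds y3] with p p2 p3 p4 p5
  rcases le_total 0 (d3 (Q a) (Q b) p) with g | g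
  · exact ⟨a, b, c, h, hT, g, le_of_lt p2, le_of_lt p3⟩
  · exact ⟨b, a, c', h', hT', by rw [d3_swap]; linarith, le_of_lt p4, le_of_lt p5⟩

lemma LC_vertex (D : TriDisk ι) (hconv : Convex ℝ D.space)
    (hall : ∀ v : ι, ∃ t ∈ D.tris, v ∈ vset t) {Q : ι → ℝ × ℝ}
    (hpos : ∀ a b c, D.Tr a b c → 0 < d3 (Q a) (Q b) (Q c)) {v : ι} (hv : D.Int v) :
    D.LC Q (D.pos v) := by
  unfold LC
  rw [D.phi_pos hall]
  have ev : ∀ᶠ p in 𝓝 (Q v), ∀ e : ι × ι, D.Tr v e.1 e.2 → 0 < d3 (Q e.1) (Q e.2) p := by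
    rw [eventually_all]
    intro e
    by_cases h : D.Tr v e.1 e.2
    · have : 0 < d3 (Q e.1) (Q e.2) (Q v) := by rw [d3_rot]; exact hpos _ _ _ h
      filter_upwards [(isOpen_lt continuous_const
        (show Continuous fun p => d3 (Q e.1) (Q e.2) p by fun_prop)).mem_nhds this] with p hp _
      exact hp
    · exact Eventually.of_forall fun p hp => absurd hp h
  filter_upwards [ev] with p hp
  by_cases hd : p - Q v = 0
  · obtain ⟨t, ht, hvt⟩ := hall v
    obtain ⟨b, c, h⟩ := Tr.exists_third D ht hvt
    have : p = Q v := sub_eq_zero.1 hd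
    refine ⟨v, b, c, h, h.in1, ?_, ?_, ?_⟩
    · rw [this, d3_self1]
    · exact (hp (b, c) h).le
    · rw [this, d3_self2]
  · obtain ⟨b, c, h, h1, h2⟩ := D.star_cover hconv hall hv (fun j => Q j - Q v)
      (fun b c h => by rw [← d3_cr]; exact hpos _ _ _ h) hd
    rw [← d3_cr] at h1 h2
    refine ⟨v, b, c, h, h.in1, h1, (hp (b, c) h).le, ?_⟩
    rw [← d3_rot, ← d3_rot, d3_rot, ← d3_rot] at h2
    rw [← d3_rot]
    first
    | exact h2.le
    | (have e : d3 (Q v) (Q c) p = - d3 (Q c) (Q v) p := d3_swap _ _ _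
       unfold d3 at *; linarith)

lemma LC_all (D : TriDisk ι) (hconv : Convex ℝ D.space)
    (hall : ∀ v : ι, ∃ t ∈ D.tris, v ∈ vset t) {Q : ι → ℝ × ℝ}
    (hpos : ∀ a b c, D.Tr a b c → 0 < d3 (Q a) (Q b) (Q c)) {x : ℝ × ℝ}
    (hi : x ∈ interior D.space) : D.LC Q x := by
  obtain ⟨a, b, c, h, hT⟩ := (D.mem_space x).1 (interior_subset hi)
  have vert : ∀ a b c, D.Tr a b c → d3 (D.pos a) (D.pos b) x = 0 → d3 (D.pos c) (D.pos a) x = 0 →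
      D.LC Q x := by
    intro a b c h e1 e3
    have e := bm_self h.2.ne' x
    have es := bary_sum h.2.ne' x
    unfold bm at e
    rw [e1, e3, zero_div, add_zero, add_zero] at es
    rw [e1, e3, es, zero_div, zero_smul, zero_smul, one_smul, add_zero, add_zero] at e
    rw [← e] at hi ⊢
    exact D.LC_vertex hconv hall hpos hi
  obtain ⟨h1, h2, h3⟩ := hT
  rcases h1.lt_or_eq with h1 | h1 <;> rcases h2.lt_or_eq with h2 | h2 <;>
  rcases h3.lt_or_eq with h3 | h3
  · exact D.LC_open hpos h ⟨h1, h2, h3⟩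
  · exact D.LC_edge hpos h.rot.rot h3.symm h1 h2 hi
  · exact D.LC_edge hpos h.rot h2.symm h3 h1 hi
  · exact vert c a b h.rot.rot h3.symm h2.symm
  · exact D.LC_edge hpos h h1.symm h2 h3 hi
  · exact vert a b c h h1.symm h3.symm
  · exact vert b c a h.rot h2.symm h1.symm
  · exact vert a b c h h1.symm h3.symm

lemma LC_nhds (D : TriDisk ι) {Q : ι → ℝ × ℝ}
    (hpos : ∀ a b c, D.Tr a b c → 0 < d3 (Q a) (Q b) (Q c)) {x : ℝ × ℝ} (hx : D.LC Q x)
    {N : Set (ℝ × ℝ)} (hN : N ∈ 𝓝 x) : ∀ᶠ p in 𝓝 (D.phi Q x), ∃ a b c, D.Tr a b c ∧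
    InT (Q a) (Q b) (Q c) p ∧ bm (Q a) (Q b) (Q c) (D.pos a) (D.pos b) (D.pos c) p ∈ N := by
  have ev : ∀ᶠ p in 𝓝 (D.phi Q x), ∀ e : ι × ι × ι, D.Tr e.1 e.2.1 e.2.2 →
      InT (D.pos e.1) (D.pos e.2.1) (D.pos e.2.2) x →
      bm (Q e.1) (Q e.2.1) (Q e.2.2) (D.pos e.1) (D.pos e.2.1) (D.pos e.2.2) p ∈ N := by
    rw [eventually_all]
    rintro ⟨a, b, c⟩
    by_cases h : D.Tr a b c
    · by_cases hT : InT (D.pos a) (D.pos b) (D.pos c) x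
      · have hc := (continuous_bm (Q a) (Q b) (Q c) (D.pos a) (D.pos b) (D.pos c)).tendsto (D.phi Q x)
        have e : bm (Q a) (Q b) (Q c) (D.pos a) (D.pos b) (D.pos c) (D.phi Q x) = x := by
          rw [D.phi_eq Q h hT, bm_bm h.2.ne' (hpos _ _ _ h).ne']
        rw [e] at hc
        filter_upwards [hc.eventually hN] with p hp _ _
        exact hp
      · exact Eventually.of_forall fun p _ h2 => absurd h2 hT
    · exact Eventually.of_forall fun p h2 => absurd h2 h
  filter_upwards [ev, hx] with p h1 h2
  obtain ⟨a, b, c, h, hT, hp⟩ := h2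
  exact ⟨a, b, c, h, hp, h1 (a, b, c) h hT⟩

lemma inj_space (D : TriDisk ι) (hconv : Convex ℝ D.space)
    (hall : ∀ v : ι, ∃ t ∈ D.tris, v ∈ vset t) {Q : ι → ℝ × ℝ}
    (hQ : ∀ v, ¬ D.Int v → Q v = D.pos v)
    (hpos : ∀ a b c, D.Tr a b c → 0 < d3 (Q a) (Q b) (Q c)) : Set.InjOn (D.phi Q) D.space := by
  have key : ∀ x ∈ interior D.space, D.phi Q x ∈ interior D.space := by
    intro x hx
    rw [mem_interior_iff_mem_nhds]
    filter_upwards [D.LC_all hconv hall hpos hx] with p hp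
    obtain ⟨a, b, c, h, _, hp⟩ := hp
    exact D.inT_im_space hconv hall hQ hpos h hp
  have fr : ∀ x ∈ D.space, x ∉ interior D.space → D.phi Q x = x := fun x hx hx' =>
    D.phi_frontier hconv hQ ⟨subset_closure hx, hx'⟩
  intro x hx y hy e
  by_cases hxi : x ∈ interior D.space
  · by_cases hyi : y ∈ interior D.space
    · by_contra hne
      obtain ⟨N, M, hN, hM, hdis⟩ := t2_separation_nhds hne
      have e1 := D.LC_nhds hpos (D.LC_all hconv hall hpos hxi) hN
      have e2 := D.LC_nhds hpos (D.LC_all hconv hall hpos hyi) hM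
      rw [← e] at e2
      have hd := D.dense_GG fun a b c h => (hpos a b c h).ne'
      obtain ⟨p, hp1, hp2⟩ := hd.inter_nhds_nonempty (e1.and e2)
      obtain ⟨⟨a, b, c, h, hT, hpN⟩, ⟨a', b', c', h', hT', hpM⟩⟩ := hp2
      have hO := D.inT_gen hp1.1 h hT
      have hO' := D.inT_gen hp1.1 h' hT'
      have hu := (D.im_unique hconv hall hQ hpos hp1.1 hp1.2 h hO).2 _ _ _ h' hO'
      refine Set.disjoint_left.1 hdis hpN ?_
      rcases hu with ⟨rfl, rfl, rfl⟩ | ⟨rfl, rfl, rfl⟩ | ⟨rfl, rfl, rfl⟩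
      · exact hpM
      · rw [bm_rot] at hpM; exact hpM
      · rw [bm_rot, bm_rot] at hpM; exact hpM
    · exfalso
      rw [fr y hy hyi] at e
      exact hyi (e ▸ key x hxi)
  · by_cases hyi : y ∈ interior D.space
    · exfalso
      rw [fr x hx hxi] at e
      exact hxi (e ▸ key y hyi)
    · rw [fr x hx hxi, fr y hy hyi] at e
      exact e

end TriDisk

end

section
open Filter Topology

namespace TriDisk

variable {ι : Type} [Fintype ι] [DecidableEq ι]

/-- simplexwise linear homeomorphisms fixing the boundary -/
def SS (D : TriDisk ι) : Set C(D.space, ℝ × ℝ) := {φ : C(D.space, ℝ × ℝ) |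
      (∀ t ∈ D.tris, ∃ g : (ℝ × ℝ) →ᵃ[ℝ] (ℝ × ℝ),
        ∀ p : D.space, (p : ℝ × ℝ) ∈ triSet D.pos t → φ p = g (p : ℝ × ℝ)) ∧
      Function.Injective φ ∧
      Set.range φ = D.space ∧
      (∀ p : D.space, (p : ℝ × ℝ) ∈ frontier D.space → φ p = (p : ℝ × ℝ))}

/-- vertex positions from coordinates -/
noncomputable def QQ (D : TriDisk ι) (q : (D.I → ℝ) × (D.I → ℝ)) (v : ι) : ℝ × ℝ :=
  (D.eX q.1 v, D.eY q.2 v)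

lemma QQ_bdry (D : TriDisk ι) (q : (D.I → ℝ) × (D.I → ℝ)) (v : ι) (hv : ¬ D.Int v) :
    D.QQ q v = D.pos v := by
  ext
  · exact D.ext_bdry (fun v => (D.pos v).1) q.1 hv
  · exact D.ext_bdry (fun v => (D.pos v).2) q.2 hv

lemma Phi_mem (D : TriDisk ι) (hconv : Convex ℝ D.space)
    (hall : ∀ v : ι, ∃ t ∈ D.tris, v ∈ vset t) {Q : ι → ℝ × ℝ}
    (hQ : ∀ v, ¬ D.Int v → Q v = D.pos v)
    (hpos : ∀ a b c, D.Tr a b c → 0 < d3 (Q a) (Q b) (Q c)) : D.Phi Q ∈ D.SS := by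
  refine ⟨?_, ?_, ?_, ?_⟩
  · intro t ht
    obtain ⟨a, b, c, h, hv⟩ := D.exists_orient ht
    obtain ⟨g, hg⟩ := bm_affine (D.pos a) (D.pos b) (D.pos c) (Q a) (Q b) (Q c)
    refine ⟨g, fun p hp => ?_⟩
    rw [hull_of_vset hv, mem_hull h.2] at hp
    rw [← hg]
    exact D.phi_eq Q h hp
  · intro x y e
    exact Subtype.ext (D.inj_space hconv hall hQ hpos x.2 y.2 e)
  · ext z
    constructor
    · rintro ⟨x, rfl⟩
      exact D.maps_space hconv hall hQ hpos x.2
    · intro hz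
      obtain ⟨x, hx, e⟩ := D.surj_space hconv hall hQ hpos hz
      exact ⟨⟨x, hx⟩, e⟩
  · intro p hp
    exact D.phi_frontier hconv hQ hp

lemma SS_spec (D : TriDisk ι) (hconv : Convex ℝ D.space)
    (hall : ∀ v : ι, ∃ t ∈ D.tris, v ∈ vset t) {φ : C(D.space, ℝ × ℝ)} (hφ : φ ∈ D.SS) :
    ∃ Q : ι → ℝ × ℝ, (∀ v, Q v = φ ⟨D.pos v, D.pos_mem hall v⟩) ∧ φ = D.Phi Q ∧
      (∀ v, ¬ D.Int v → Q v = D.pos v) ∧ ∀ a b c, D.Tr a b c → 0 < d3 (Q a) (Q b) (Q c) := by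
  obtain ⟨h1, h2, h3, h4⟩ := hφ
  let Q : ι → ℝ × ℝ := fun v => φ ⟨D.pos v, D.pos_mem hall v⟩
  have hQ : ∀ v, ¬ D.Int v → Q v = D.pos v := fun v hv =>
    h4 ⟨D.pos v, D.pos_mem hall v⟩ ⟨subset_closure (D.pos_mem hall v), hv⟩
  have hval : ∀ p : D.space, φ p = D.phi Q p := by
    intro p
    obtain ⟨a, b, c, h, hT⟩ := (D.mem_space p).1 p.2
    obtain ⟨t, ht, hv⟩ := h.1
    obtain ⟨g, hg⟩ := h1 t ht
    have hg' : ∀ p : D.space, InT (D.pos a) (D.pos b) (D.pos c) p → φ p = g p := fun p hp =>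
      hg p (by rw [hull_of_vset hv, mem_hull h.2]; exact hp)
    rw [hg' p hT, D.phi_eq Q h hT, affine_bm _ _ _ h.2.ne' g]
    have ga : g (D.pos a) = Q a := (hg' ⟨_, D.pos_mem hall a⟩ h.in1).symm
    have gb : g (D.pos b) = Q b := (hg' ⟨_, D.pos_mem hall b⟩ h.rot.in1.rot.rot).symm
    have gc : g (D.pos c) = Q c := (hg' ⟨_, D.pos_mem hall c⟩ h.rot.rot.in1.rot).symm
    rw [ga, gb, gc]
  refine ⟨Q, fun v => rfl, ContinuousMap.ext hval, hQ, ?_⟩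
  intro a b c h
  refine D.orient hconv hall hQ ?_ ?_ h
  · intro x hx y hy e
    have e2 : φ ⟨x, hx⟩ = φ ⟨y, hy⟩ := by rw [hval, hval]; exact e
    exact congrArg Subtype.val (h2 e2)
  · intro x hx
    rw [← h3]
    exact ⟨⟨x, hx⟩, hval _⟩

lemma homeoSS (D : TriDisk ι) (hconv : Convex ℝ D.space)
    (hall : ∀ v : ι, ∃ t ∈ D.tris, v ∈ vset t) : Nonempty (D.SS ≃ₜ D.XX) := by
  let F : C(D.space, ℝ × ℝ) → (D.I → ℝ) × (D.I → ℝ) := fun φ =>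
    (fun v => (φ ⟨D.pos v, D.pos_mem hall v⟩).1, fun v => (φ ⟨D.pos v, D.pos_mem hall v⟩).2)
  have hF : Continuous F := by
    have : ∀ x : D.space, Continuous fun φ : C(D.space, ℝ × ℝ) => φ x := fun x =>
      by fun_prop
    refine Continuous.prodMk ?_ ?_
    · exact continuous_pi fun v => continuous_fst.comp (this _)
    · exact continuous_pi fun v => continuous_snd.comp (this _)
  have hFQ : ∀ Q : ι → ℝ × ℝ, (∀ v, ¬ D.Int v → Q v = D.pos v) → D.QQ (F (D.Phi Q)) = Q := by
    intro Q hQ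
    funext v
    by_cases hv : D.Int v
    · have e : (D.Phi Q) ⟨D.pos v, D.pos_mem hall v⟩ = Q v := D.phi_pos hall Q v
      ext
      · exact (D.ext_int' (fun v => (D.pos v).1) (F (D.Phi Q)).1 hv).trans (congrArg Prod.fst e)
      · exact (D.ext_int' (fun v => (D.pos v).2) (F (D.Phi Q)).2 hv).trans (congrArg Prod.snd e)
    · rw [D.QQ_bdry _ v hv, hQ v hv]
  have hQF : ∀ q, F (D.Phi (D.QQ q)) = q := by
    intro q
    have e : ∀ v : ι, (D.Phi (D.QQ q)) ⟨D.pos v, D.pos_mem hall v⟩ = D.QQ q v := fun v =>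
      D.phi_pos hall _ v
    refine Prod.ext ?_ ?_
    · funext v
      exact (congrArg Prod.fst (e v)).trans (D.ext_int (fun v => (D.pos v).1) q.1 v)
    · funext v
      exact (congrArg Prod.snd (e v)).trans (D.ext_int (fun v => (D.pos v).2) q.2 v)
  have hG : Continuous fun q => D.Phi (D.QQ q) := by
    refine ContinuousMap.continuous_of_continuous_uncurry _ ?_
    have : ∀ v, Continuous fun p : D.space => D.wt p v := fun v =>
      continuousOn_iff_continuous_restrict.1 (D.continuousOn_wt v)
    change Continuous fun x : ((D.I → ℝ) × (D.I → ℝ)) × D.space => ∑ v, D.wt x.2 v • D.QQ x.1 v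
    refine continuous_finsetSum _ fun v _ => ?_
    refine ((this v).comp continuous_snd).smul ?_
    unfold QQ
    fun_prop
  refine ⟨{ toFun := fun φ => ⟨F φ.1, ?_⟩
            invFun := fun q => ⟨D.Phi (D.QQ q.1), D.Phi_mem hconv hall (D.QQ_bdry q.1) q.2⟩
            left_inv := ?_
            right_inv := ?_
            continuous_toFun := ?_
            continuous_invFun := ?_ }⟩
  · obtain ⟨Q, _, e, hQ, hpos⟩ := D.SS_spec hconv hall φ.2
    intro a b c h
    have : 0 < d3 (D.QQ (F φ.1) a) (D.QQ (F φ.1) b) (D.QQ (F φ.1) c) := by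
      rw [e, hFQ Q hQ]; exact hpos a b c h
    exact this
  · intro φ
    obtain ⟨Q, _, e, hQ, hpos⟩ := D.SS_spec hconv hall φ.2
    apply Subtype.ext
    change D.Phi (D.QQ (F φ.1)) = φ.1
    rw [e, hFQ Q hQ]
  · intro q
    exact Subtype.ext (hQF q.1)
  · exact (hF.comp continuous_subtype_val).subtype_mk _
  · exact (hG.comp continuous_subtype_val).subtype_mk _

lemma homeoE (D : TriDisk ι) (m : ℕ) (hm : m = Nat.card D.I) :
    Nonempty (((D.I → ℝ) × (D.I → ℝ)) ≃ₜ EuclideanSpace ℝ (Fin (2 * m))) := by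
  classical
  have : Fintype D.I := Fintype.ofFinite _
  refine ⟨(ContinuousLinearEquiv.ofFinrankEq (𝕜 := ℝ) ?_).toHomeomorph⟩
  rw [Module.finrank_prod, Module.finrank_fintype_fun_eq_card, finrank_euclideanSpace_fin, hm,
    Nat.card_eq_fintype_card]
  ring

end TriDisk

end

/-- **Theorem 2.** Let `K` be a convex triangulated 2-disk in the
plane with `m` interior vertices. The space of simplexwise linear homeomorphisms of
`K` fixing `∂K` pointwise, with the compact-open topology, is homeomorphic to
`ℝ^{2m}`. -/
theorem space_of_SL_homeomorphisms
    {ι : Type} [Fintype ι] [DecidableEq ι]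
    (D : TriDisk ι)
    (hconv : Convex ℝ D.space)
    (hall : ∀ v : ι, ∃ t ∈ D.tris, v ∈ vset t)
    (m : ℕ) (hm : m = Nat.card {v : ι // D.pos v ∈ interior D.space})
    (S : Set C(D.space, ℝ × ℝ))
    (hS : S = {φ : C(D.space, ℝ × ℝ) |
      (∀ t ∈ D.tris, ∃ g : (ℝ × ℝ) →ᵃ[ℝ] (ℝ × ℝ),
        ∀ p : D.space, (p : ℝ × ℝ) ∈ triSet D.pos t → φ p = g (p : ℝ × ℝ)) ∧
      Function.Injective φ ∧
      Set.range φ = D.space ∧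
      (∀ p : D.space, (p : ℝ × ℝ) ∈ frontier D.space → φ p = (p : ℝ × ℝ))}) :
    Nonempty (S ≃ₜ EuclideanSpace ℝ (Fin (2 * m))) := by
  have hS' : S = D.SS := hS
  subst hS'
  obtain ⟨e1⟩ := D.homeoSS hconv hall
  obtain ⟨e2⟩ := D.homeoXX hconv hall
  obtain ⟨e3⟩ := D.homeoE m hm
  exact ⟨(e1.trans e2).trans e3⟩
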